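/- Let (A_S,S) be an Artin-Tits system, let X,Y ⊆ S be of spherical type and let g ∈ A_S⁺ be reduced-X (no element of X right-divides g). If there exists k ∈ ℕ, k ≥ 1, such that gΔ_X^k g⁻¹ ∈ A_Y⁺, then g ∈ Conj⁺(S;X,R) for some subset R ⊆ Y. -/

import Mathlib

/-!
Common definitions for formalizing "Normalisateur des sous-groupes paraboliques
des groupes d'Artin-Tits" (E. Godelle).

We fix a Coxeter matrix `M` over a finite index set `B` (Mathlib's convention:
`M s t = 0` encodes `m_{s,t} = ∞`).  The Artin-Tits group `Artin M` is the
presented group on the braid relations, the Coxeter group is Mathlib's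
`M.Group`, and `proj : Artin M →* M.Group` is the canonical projection
(adding the relations `s² = 1`).
-/

namespace ArtinTitsPaper

open List

variable {B : Type*}

/-- The alternating list `[s, t, s, t, ...]` with `n` terms, starting with `s`. -/
def altList (s t : B) : ℕ → List B
  | 0 => []
  | n + 1 => s :: altList t s n

/-- The braid relators `(sts⋯)(tst⋯)⁻¹` (`m_{s,t}` letters each) for `s ≠ t`,
`m_{s,t} ≠ ∞`. -/
def braidRels (M : CoxeterMatrix B) : Set (FreeGroup B) :=
  { r | ∃ s t : B, s ≠ t ∧ M s t ≠ 0 ∧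
      r = ((altList s t (M s t)).map FreeGroup.of).prod *
          (((altList t s (M s t)).map FreeGroup.of).prod)⁻¹ }

/-- The Artin-Tits group associated to the Coxeter matrix `M`. -/
def Artin (M : CoxeterMatrix B) : Type _ := PresentedGroup (braidRels M)

instance (M : CoxeterMatrix B) : Group (Artin M) :=
  QuotientGroup.Quotient.group _

/-- The standard generator of `Artin M` indexed by `s : B` (the image of `S` in `A_S`). -/
def gen (M : CoxeterMatrix B) (s : B) : Artin M := PresentedGroup.of s

theorem altList_eq_reverse_alternatingWord (s t : B) (n : ℕ) :
    altList s t n = (CoxeterSystem.alternatingWord t s n).reverse := by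
  induction n generalizing s t with
  | zero => rfl
  | succ n ih =>
      rw [altList, CoxeterSystem.alternatingWord_succ, List.concat_eq_append,
        List.reverse_append]
      simp [ih]

theorem lift_simple_listProd (M : CoxeterMatrix B) (l : List B) :
    FreeGroup.lift M.simple ((l.map FreeGroup.of).prod) =
      M.toCoxeterSystem.wordProd l := by
  rw [CoxeterSystem.wordProd, map_list_prod, List.map_map]
  simp [Function.comp_def, CoxeterMatrix.toCoxeterSystem_simple]

theorem braid_lift (M : CoxeterMatrix B) :
    ∀ r ∈ braidRels M, FreeGroup.lift M.simple r = 1 := by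
  rintro r ⟨s, t, hst, hm, rfl⟩
  rw [map_mul, map_inv, lift_simple_listProd, lift_simple_listProd,
    altList_eq_reverse_alternatingWord, altList_eq_reverse_alternatingWord,
    CoxeterSystem.wordProd_reverse, CoxeterSystem.wordProd_reverse]
  have hsym : M s t = M t s := M.symmetric s t
  have hb := M.toCoxeterSystem.wordProd_braidWord_eq t s
  rw [CoxeterSystem.braidWord, CoxeterSystem.braidWord, ← hsym] at hb
  rw [hb]
  simp

/-- The canonical projection from the Artin-Tits group onto the Coxeter group
(adding the relations `s² = 1`). -/
def proj (M : CoxeterMatrix B) : Artin M →* M.Group :=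
  PresentedGroup.toGroup (braid_lift M)

/-- The positive monoid `A_S⁺`, the submonoid of `A_S` generated by `S`. -/
def posMon (M : CoxeterMatrix B) : Submonoid (Artin M) :=
  Submonoid.closure (Set.range (gen M))

/-- The submonoid `A_X⁺` of `A_S` generated by `X ⊆ S`. -/
def posMonOn (M : CoxeterMatrix B) (X : Set B) : Submonoid (Artin M) :=
  Submonoid.closure (gen M '' X)

/-- The standard parabolic subgroup `A_X` of `A_S` generated by `X ⊆ S`. -/
def stdSub (M : CoxeterMatrix B) (X : Set B) : Subgroup (Artin M) :=
  Subgroup.closure (gen M '' X)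

/-- The standard parabolic subgroup `W_X` of the Coxeter group `W_S`. -/
def coxSub (M : CoxeterMatrix B) (X : Set B) : Subgroup M.Group :=
  Subgroup.closure (M.simple '' X)

/-- `X ⊆ S` is of spherical type if the Coxeter group `W_X` is finite. -/
def IsSpherical (M : CoxeterMatrix B) (X : Set B) : Prop :=
  Finite (coxSub M X)

/-- `a` left-divides `b` in the positive monoid: `b = a c` with `c ∈ A_S⁺`. -/
def ldvd (M : CoxeterMatrix B) (a b : Artin M) : Prop :=
  ∃ c ∈ posMon M, a * c = b

/-- `a` right-divides `b` in the positive monoid: `b = c a` with `c ∈ A_S⁺`. -/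
def rdvd (M : CoxeterMatrix B) (a b : Artin M) : Prop :=
  ∃ c ∈ posMon M, c * a = b

/-- `d` is the least common multiple `Δ_X` of `X` in `A_X⁺` (for left-divisibility). -/
def IsDelta (M : CoxeterMatrix B) (X : Set B) (d : Artin M) : Prop :=
  d ∈ posMonOn M X ∧
  (∀ s ∈ X, ∃ c ∈ posMonOn M X, gen M s * c = d) ∧
  ∀ m ∈ posMonOn M X, (∀ s ∈ X, ∃ c ∈ posMonOn M X, gen M s * c = m) →
    ∃ c ∈ posMonOn M X, d * c = m

/-- The subset `Xg = {σ_x g : x ∈ X}` of `A_S`. -/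
def leftMul (M : CoxeterMatrix B) (X : Set B) (g : Artin M) : Set (Artin M) :=
  (fun x => gen M x * g) '' X

/-- The subset `gX = {g σ_x : x ∈ X}` of `A_S`. -/
def rightMul (M : CoxeterMatrix B) (X : Set B) (g : Artin M) : Set (Artin M) :=
  (fun x => g * gen M x) '' X

/-- `Conj(S;X,Y) = {g ∈ A_S : gX = Yg}`. -/
def conjSet (M : CoxeterMatrix B) (X Y : Set B) : Set (Artin M) :=
  { g | rightMul M X g = leftMul M Y g }

/-- `Conj⁺(S;X,Y) = {g ∈ A_S⁺ : gX = Yg}`. -/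
def conjPos (M : CoxeterMatrix B) (X Y : Set B) : Set (Artin M) :=
  { g | g ∈ posMon M ∧ rightMul M X g = leftMul M Y g }

/-- The quasi-centralizer `QZ_{A_S}(A_X) = {g ∈ A_S : gX = Xg}`. -/
def QZset (M : CoxeterMatrix B) (X : Set B) : Set (Artin M) :=
  conjSet M X X

/-- The indecomposable component of `Z` containing `t` (vertices of `Z` joined to `t`
by a path of edges `m_{a,b} ≠ 2` in the Coxeter diagram on `Z`). -/
def comp (M : CoxeterMatrix B) (Z : Set B) (t : B) : Set B :=
  { s ∈ Z | Relation.ReflTransGen (fun a b => a ∈ Z ∧ b ∈ Z ∧ a ≠ b ∧ M a b ≠ 2) t s }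

/-- `Z` is indecomposable: it admits no nontrivial partition `Z = Z₁ ∪ Z₂` with
`m_{a,b} = 2` for `a ∈ Z₁`, `b ∈ Z₂`. -/
def Indecomp (M : CoxeterMatrix B) (Z : Set B) : Prop :=
  ¬ ∃ Z₁ Z₂ : Set B, Z₁.Nonempty ∧ Z₂.Nonempty ∧ Z₁ ∪ Z₂ = Z ∧ Disjoint Z₁ Z₂ ∧
      ∀ a ∈ Z₁, ∀ b ∈ Z₂, M a b = 2

/-- `g` is an elementary positive `Y`-ribbon-`X`: `g = d_{X,t}` for some `t ∈ S` with
`X(t)` of spherical type, where `d_{X,t} = Δ_{X(t)}` if `t ∈ X` and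
`d_{X,t} = Δ_{X(t)} Δ_{X(t)∖{t}}⁻¹` otherwise, and `Y ⊆ X ∪ {t}` satisfies `Yg = gX`. -/
def IsElemRibbon (M : CoxeterMatrix B) (X Y : Set B) (g : Artin M) : Prop :=
  ∃ t : B, IsSpherical M (comp M (X ∪ {t}) t) ∧
    ((t ∈ X ∧ IsDelta M (comp M (X ∪ {t}) t) g) ∨
      (t ∉ X ∧ ∃ d₁ d₂ : Artin M, IsDelta M (comp M (X ∪ {t}) t) d₁ ∧
        IsDelta M ((comp M (X ∪ {t}) t) \ {t}) d₂ ∧ g = d₁ * d₂⁻¹)) ∧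
    Y ⊆ X ∪ {t} ∧ leftMul M Y g = rightMul M X g

/-- `g` is a positive `Y`-ribbon-`X`: a product `g = g_n ⋯ g_1` of elementary positive
`X_i`-ribbons-`X_{i-1}` with `X_0 = X`, `X_n = Y`. -/
inductive IsRibbon (M : CoxeterMatrix B) : Set B → Set B → Artin M → Prop
  | nil (X : Set B) : IsRibbon M X X 1
  | cons {X Y Z : Set B} {g h : Artin M} :
      IsRibbon M X Y g → IsElemRibbon M Y Z h → IsRibbon M X Z (h * g)

/-- `g` is `X`-reduced: no element of `X` left-divides `g`. -/
def lreduced (M : CoxeterMatrix B) (X : Set B) (g : Artin M) : Prop :=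
  ∀ s ∈ X, ¬ ldvd M (gen M s) g

/-- `g` is reduced-`X`: no element of `X` right-divides `g`. -/
def rreduced (M : CoxeterMatrix B) (X : Set B) (g : Artin M) : Prop :=
  ∀ s ∈ X, ¬ rdvd M (gen M s) g

/-- The set `H_X` of elements `g₁ g₂⁻¹` where `g₁, g₂` are `X`-reduced positive
`X`-ribbons-`X`. -/
def HXset (M : CoxeterMatrix B) (X : Set B) : Set (Artin M) :=
  { g | ∃ g₁ g₂ : Artin M, IsRibbon M X X g₁ ∧ lreduced M X g₁ ∧
      IsRibbon M X X g₂ ∧ lreduced M X g₂ ∧ g = g₁ * g₂⁻¹ }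

/-- The length of a positive element (the common length of its expressions as words
in the generators; junk value `0` outside of `A_S⁺`). -/
noncomputable def len (M : CoxeterMatrix B) (g : Artin M) : ℕ :=
  sInf { n | ∃ l : List B, l.length = n ∧ (l.map (gen M)).prod = g }

/-- The length of an element of the Coxeter group `W_S`. -/
noncomputable def wlen (M : CoxeterMatrix B) (w : M.Group) : ℕ :=
  sInf { n | ∃ l : List B, l.length = n ∧ (l.map M.simple).prod = w }

/-- `g ∈ A_{S,red}`: `g` is positive and has the same length as its image in `W_S`. -/
def Red (M : CoxeterMatrix B) (g : Artin M) : Prop :=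
  g ∈ posMon M ∧ len M g = wlen M (proj M g)

/-- `C` is a simple `s`-chain-`u`: either `C = 1` and `s = u`, or
`C = tst⋯` (`k` letters, `k < m_{s,t}`) with `u ∈ {s,t}` and `C·u = tst⋯` (`k+1` letters). -/
def IsSimpleChain (M : CoxeterMatrix B) (s u : B) (C : Artin M) : Prop :=
  (C = 1 ∧ s = u) ∨
  ∃ t : B, t ≠ s ∧ (u = s ∨ u = t) ∧ ∃ k : ℕ,
    (M s t = 0 ∨ k < M s t) ∧
    C = ((altList t s k).map (gen M)).prod ∧
    C * gen M u = ((altList t s (k + 1)).map (gen M)).prod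

/-- `C` is an `s`-chain-`t`: a product `C₁ ⋯ C_k` of simple chains composing from
origin `s` to target `t`. -/
inductive IsChain (M : CoxeterMatrix B) : B → B → Artin M → Prop
  | single {s u : B} {C : Artin M} : IsSimpleChain M s u C → IsChain M s u C
  | comp {s u v : B} {C D : Artin M} :
      IsChain M s u C → IsSimpleChain M u v D → IsChain M s v (C * D)

end ArtinTitsPaper

namespace SmallType

open scoped Classical in
/-- The pairing of a vector with the simple coroot `i`, for the simply laced graph `G`. -/
noncomputable def pr {I : Type*} [Fintype I] (G : SimpleGraph I) (v : I → ℤ) (i : I) : ℤ :=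
  2 * v i - ∑ j, if G.Adj i j then v j else 0

open scoped Classical in
/-- The simple root `α i`. -/
noncomputable def sr {I : Type*} (i : I) : I → ℤ := Pi.single i 1

/-- The simple reflection `i`. -/
noncomputable def rf {I : Type*} [Fintype I] (G : SimpleGraph I) (i : I) (v : I → ℤ) : I → ℤ :=
  v - pr G v i • sr i

theorem sr_self {I : Type*} (i : I) : sr i i = 1 := by simp [sr]

theorem sr_ne {I : Type*} {i j : I} (h : j ≠ i) : sr i j = 0 := by simp [sr, h]

section Pairing

variable {I : Type*} [Fintype I] (G : SimpleGraph I)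

theorem sr_injective {I : Type*} {i j : I} (h : sr i = sr j) : i = j := by
  by_contra hne
  have := congrFun h i
  rw [sr_self, sr_ne hne] at this
  omega

theorem pr_sub (v w : I → ℤ) (i : I) : pr G (v - w) i = pr G v i - pr G w i := by
  classical
  have : ∑ j, (if G.Adj i j then (v - w) j else 0) =
      (∑ j, if G.Adj i j then v j else 0) - ∑ j, if G.Adj i j then w j else 0 := by
    rw [← Finset.sum_sub_distrib]
    exact Finset.sum_congr rfl fun j _ => by split_ifs <;> simp
  rw [pr, pr, pr, this, Pi.sub_apply]
  ring

theorem pr_smul (c : ℤ) (v : I → ℤ) (i : I) : pr G (c • v) i = c * pr G v i := by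
  classical
  have : ∑ j, (if G.Adj i j then (c • v) j else 0) = c * ∑ j, if G.Adj i j then v j else 0 := by
    rw [Finset.mul_sum]
    exact Finset.sum_congr rfl fun j _ => by split_ifs <;> simp
  rw [pr, pr, this, Pi.smul_apply, smul_eq_mul]
  ring

theorem pr_zero (i : I) : pr G (0 : I → ℤ) i = 0 := by
  have := pr_smul G 0 (0 : I → ℤ) i
  simpa using this

theorem pr_add (v w : I → ℤ) (i : I) : pr G (v + w) i = pr G v i + pr G w i := by
  have h1 := pr_sub G v ((-1 : ℤ) • w) i
  rw [pr_smul] at h1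
  have : v - (-1 : ℤ) • w = v + w := by simp
  rw [this] at h1
  linarith

theorem pr_sr_self (i : I) : pr G (sr i) i = 2 := by
  classical
  have : ∑ j, (if G.Adj i j then sr i j else 0) = 0 :=
    Finset.sum_eq_zero fun j _ => by
      split_ifs with h
      · exact sr_ne h.ne'
      · rfl
  rw [pr, this, sr_self]
  norm_num

theorem pr_sr_adj {i j : I} (h : G.Adj i j) : pr G (sr i) j = -1 := by
  classical
  have : ∑ k, (if G.Adj j k then sr i k else 0) = 1 := by
    rw [Finset.sum_eq_single i]
    · simp [h.symm, sr_self]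
    · intro k _ hk
      simp [sr_ne hk]
    · simp
  rw [pr, this, sr_ne h.ne']
  norm_num

theorem pr_sr_nonadj {i j : I} (hne : i ≠ j) (h : ¬ G.Adj i j) : pr G (sr i) j = 0 := by
  classical
  have : ∑ k, (if G.Adj j k then sr i k else 0) = 0 :=
    Finset.sum_eq_zero fun k _ => by
      split_ifs with hk
      · refine sr_ne ?_
        rintro rfl
        exact h hk.symm
      · rfl
  rw [pr, this, sr_ne hne.symm]
  norm_num

theorem pr_rf_self (i : I) (v : I → ℤ) : pr G (rf G i v) i = - pr G v i := by
  rw [rf, pr_sub, pr_smul, pr_sr_self]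
  ring

theorem pr_rf_adj {i j : I} (h : G.Adj i j) (v : I → ℤ) :
    pr G (rf G i v) j = pr G v j + pr G v i := by
  rw [rf, pr_sub, pr_smul, pr_sr_adj G h]
  ring

theorem pr_rf_nonadj {i j : I} (hne : i ≠ j) (h : ¬ G.Adj i j) (v : I → ℤ) :
    pr G (rf G i v) j = pr G v j := by
  rw [rf, pr_sub, pr_smul, pr_sr_nonadj G hne h]
  ring

theorem rf_rf (i : I) (v : I → ℤ) : rf G i (rf G i v) = v := by
  have := pr_rf_self G i v
  rw [rf, this, rf]
  simp

theorem rf_eq_self {i : I} {v : I → ℤ} (h : pr G v i = 0) : rf G i v = v := by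
  simp [rf, h]

theorem rf_apply_ne {i j : I} (h : j ≠ i) (v : I → ℤ) : rf G i v j = v j := by
  simp [rf, sr_ne h]

theorem rf_apply_self (i : I) (v : I → ℤ) : rf G i v i = v i - pr G v i := by
  simp [rf, sr_self]

theorem rf_comm {i j : I} (hne : i ≠ j) (h : ¬ G.Adj i j) (v : I → ℤ) :
    rf G i (rf G j v) = rf G j (rf G i v) := by
  have h' : ¬ G.Adj j i := fun hh => h hh.symm
  rw [rf, pr_rf_nonadj G hne.symm h', rf, rf, pr_rf_nonadj G hne h, rf]
  abel

theorem rf_braid {i j : I} (h : G.Adj i j) (v : I → ℤ) :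
    rf G i (rf G j (rf G i v)) = rf G j (rf G i (rf G j v)) := by
  have e1 : pr G (rf G j (rf G i v)) i = pr G v j := by
    rw [pr_rf_adj G h.symm, pr_rf_adj G h, pr_rf_self]; ring
  have e2 : pr G (rf G i (rf G j v)) j = pr G v i := by
    rw [pr_rf_adj G h, pr_rf_adj G h.symm, pr_rf_self]; ring
  have e3 := pr_rf_adj G h v
  have e4 := pr_rf_adj G h.symm v
  rw [rf, e1, rf, e3, rf, rf, e2, rf, e4, rf]
  module

end Pairing

/-- The positive roots: everything obtained from simple roots by height-increasing
simple reflections. -/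
inductive IsRoot {I : Type*} [Fintype I] (G : SimpleGraph I) : (I → ℤ) → Prop
  | simple (i : I) : IsRoot G (sr i)
  | up {v : I → ℤ} (i : I) : IsRoot G v → pr G v i < 0 → IsRoot G (rf G i v)

/-- The height of a vector. -/
def ht {I : Type*} [Fintype I] (v : I → ℤ) : ℤ := ∑ i, v i

section Roots

variable {I : Type*} [Fintype I] {G : SimpleGraph I}

theorem ht_sr (i : I) : ht (sr i) = 1 := by
  classical
  simp [ht, sr]

theorem ht_rf (i : I) (v : I → ℤ) : ht (rf G i v) = ht v - pr G v i := by
  have := ht_sr i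
  simp only [ht, rf, Pi.sub_apply, Pi.smul_apply, smul_eq_mul, Finset.sum_sub_distrib,
    ← Finset.mul_sum] at this ⊢
  rw [this]
  ring

theorem IsRoot.nonneg {v : I → ℤ} (h : IsRoot G v) (j : I) : 0 ≤ v j := by
  induction h with
  | simple i =>
    by_cases hj : j = i
    · subst hj; rw [sr_self]; norm_num
    · rw [sr_ne hj]
  | @up v i _ hv ih =>
    by_cases hj : j = i
    · subst hj; rw [rf_apply_self]; omega
    · rwa [rf_apply_ne G hj]

theorem IsRoot.one_le_ht {v : I → ℤ} (h : IsRoot G v) : 1 ≤ ht v := by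
  induction h with
  | simple i => rw [ht_sr]
  | up i _ hv ih => rw [ht_rf]; omega

theorem IsRoot.ne_zero {v : I → ℤ} (h : IsRoot G v) : v ≠ 0 := by
  rintro rfl
  have := h.one_le_ht
  simp [ht] at this

theorem not_isRoot_neg_sr (i : I) : ¬ IsRoot G (-sr i) := fun h => by
  have := h.nonneg i
  rw [Pi.neg_apply, sr_self] at this
  omega

theorem rf_sr_self (i : I) : rf G i (sr i) = -sr i := by
  rw [rf, pr_sr_self]
  module

/-- A simple root paired positively only with itself. -/
theorem eq_of_pr_sr_pos {i j : I} (h : 0 < pr G (sr i) j) : i = j := by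
  by_contra hne
  by_cases hadj : G.Adj i j
  · rw [pr_sr_adj G hadj] at h; omega
  · rw [pr_sr_nonadj G hne hadj] at h; omega

theorem rf_ne_sr {v : I → ℤ} (h : IsRoot G v) {i : I} (hi : pr G v i < 0) (j : I) :
    rf G i v ≠ sr j := by
  intro he
  have h1 : 0 < pr G (sr j) i := by rw [← he, pr_rf_self]; omega
  obtain rfl := eq_of_pr_sr_pos h1
  have : v = -sr j := by rw [← rf_rf G j v, he, rf_sr_self]
  exact not_isRoot_neg_sr j (this ▸ h)

theorem IsRoot.cases_descent {v : I → ℤ} (h : IsRoot G v) :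
    (∃ i, v = sr i) ∨ ∃ i, 0 < pr G v i ∧ IsRoot G (rf G i v) ∧ ∀ j, v ≠ sr j := by
  cases h with
  | simple i => exact Or.inl ⟨i, rfl⟩
  | up i h hi =>
    exact Or.inr ⟨i, by rw [pr_rf_self]; omega, by rwa [rf_rf], rf_ne_sr h hi⟩

theorem IsRoot.down {v : I → ℤ} (h : IsRoot G v) {s : I} (hs : 0 < pr G v s)
    (hne : v ≠ sr s) : IsRoot G (rf G s v) := by
  induction hn : (ht v).toNat using Nat.strong_induction_on generalizing v s with
  | _ n ih =>
  subst hn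
  have key : ∀ {w : I → ℤ}, IsRoot G w → ht w < ht v → ∀ {s : I}, 0 < pr G w s → w ≠ sr s →
      IsRoot G (rf G s w) := by
    intro w hw hlt s hs hne
    have := hw.one_le_ht
    exact ih _ (by omega) hw hs hne rfl
  rcases h.cases_descent with ⟨i, rfl⟩ | ⟨t, ht0, hroot, -⟩
  · obtain rfl := eq_of_pr_sr_pos hs
    exact absurd rfl hne
  set u := rf G t v with hu
  have hvu : v = rf G t u := by rw [hu, rf_rf]
  have hut : pr G u t = - pr G v t := by rw [hu, pr_rf_self]
  have htu : ht u < ht v := by rw [hu, ht_rf]; omega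
  by_cases hst : t = s
  · subst hst; exact hroot
  by_cases hadj : G.Adj t s
  · have hus : pr G u s = pr G v s + pr G v t := by rw [hu, pr_rf_adj G hadj]
    by_cases h1 : u = sr s
    · have h2 : pr G u t = -1 := by rw [h1, pr_sr_adj G hadj.symm]
      have h3 : rf G s v = sr t := by
        rw [rf, hvu, rf, pr_sub, pr_smul, h2, h1, pr_sr_self, pr_sr_adj G hadj]
        module
      rw [h3]; exact .simple t
    have r1 := key hroot htu (s := s) (by omega) h1
    have q1 : pr G (rf G s u) t = pr G v s := by rw [pr_rf_adj G hadj.symm, hut, hus]; ring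
    have l1 : ht (rf G s u) < ht v := by rw [ht_rf]; omega
    by_cases h2 : rf G s u = sr t
    · have : pr G (rf G s u) s = -1 := by rw [h2, pr_sr_adj G hadj]
      rw [pr_rf_self] at this
      omega
    have r2 := key r1 l1 (s := t) (by omega) h2
    have q2 : pr G (rf G t (rf G s u)) s = - pr G v t := by
      rw [pr_rf_adj G hadj, q1, pr_rf_self, hus]; ring
    have r3 := IsRoot.up s r2 (by omega)
    have q3 : pr G (rf G s (rf G t (rf G s u))) t < 0 := by
      rw [pr_rf_adj G hadj.symm, q2, pr_rf_self, q1]; omega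
    have r4 := IsRoot.up t r3 q3
    rw [← rf_braid G hadj, rf_rf] at r4
    rwa [← hvu] at r4
  · have hus : pr G u s = pr G v s := by rw [hu, pr_rf_nonadj G hst hadj]
    have h1 : u ≠ sr s := by
      intro h1
      have : pr G u t = 0 := by
        rw [h1, pr_sr_nonadj G (Ne.symm hst) fun h => hadj h.symm]
      omega
    have r1 := key hroot htu (s := s) (by omega) h1
    have q1 : pr G (rf G s u) t < 0 := by
      rw [pr_rf_nonadj G (Ne.symm hst) fun h => hadj h.symm]; omega
    have r2 := IsRoot.up t r1 q1
    rwa [rf_comm G hst hadj, ← hvu] at r2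

end Roots


section Consistency

variable {I : Type*} [Fintype I] (G : SimpleGraph I)

/-- A root of height less than `N`. -/
def RootBelow (N : ℤ) (v : I → ℤ) : Prop := IsRoot G v ∧ ht v < N

/-- The recursion rule expressing the coefficient `s` at `v` through a descent `t` of `v`. -/
noncomputable def rule (H : I → (I → ℤ) → ℤ) (s t : I) (v : I → ℤ) : ℤ :=
  open scoped Classical in
  if G.Adj t s then
    if 0 < pr G v t + pr G v s then 2 * H t (rf G s (rf G t v))
    else if pr G v t + pr G v s = 0 then 2 * H t (rf G t v) - H s (rf G t v)
    else H s (rf G t v) + 2 * H t (rf G t v)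
  else H s (rf G t v)

/-- `H` satisfies the initial conditions and all recursion rules at roots of height below `N`. -/
structure Rules (H : I → (I → ℤ) → ℤ) (N : ℤ) : Prop where
  pos : ∀ {s : I} {v : I → ℤ}, RootBelow G N v → 0 < pr G v s → v ≠ sr s → H s v = 0
  self : ∀ s, H s (sr s) = 2
  simple : ∀ {s t : I}, t ≠ s → H s (sr t) = 1
  rule : ∀ {s t : I} {v : I → ℤ}, RootBelow G N v → pr G v s ≤ 0 → 0 < pr G v t → v ≠ sr t →
    H s v = rule G H s t v

variable {G}

theorem RootBelow.down {N : ℤ} {v : I → ℤ} (h : RootBelow G N v) {t : I} (ht0 : 0 < pr G v t)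
    (hne : v ≠ sr t) : RootBelow G N (rf G t v) :=
  ⟨h.1.down ht0 hne, by have := h.2; rw [ht_rf]; omega⟩

theorem ne_sr_of_adj {v : I → ℤ} {i j : I} (h : G.Adj i j) (hv : pr G v j ≠ -1) : v ≠ sr i := by
  rintro rfl
  exact hv (pr_sr_adj G h)

theorem ne_sr_of_nonadj {v : I → ℤ} {i j : I} (hne : i ≠ j) (h : ¬ G.Adj i j)
    (hv : pr G v j ≠ 0) : v ≠ sr i := by
  rintro rfl
  exact hv (pr_sr_nonadj G hne h)

theorem ne_sr_of_self {v : I → ℤ} {i : I} (hv : pr G v i ≠ 2) : v ≠ sr i := by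
  rintro rfl
  exact hv (pr_sr_self G i)

variable {H : I → (I → ℤ) → ℤ} {N : ℤ}

theorem Rules.nonadj (R : Rules G H N) {s t : I} {v : I → ℤ} (hv : RootBelow G N v)
    (ha : ¬ G.Adj t s) (hs : pr G v s ≤ 0) (h0 : 0 < pr G v t) (hne : v ≠ sr t) :
    H s v = H s (rf G t v) := by
  rw [R.rule hv hs h0 hne, SmallType.rule, if_neg ha]

theorem Rules.adj_pos (R : Rules G H N) {s t : I} {v : I → ℤ} (hv : RootBelow G N v)
    (ha : G.Adj t s) (hs : pr G v s ≤ 0) (h0 : 0 < pr G v t) (hne : v ≠ sr t)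
    (h1 : 0 < pr G v t + pr G v s) :
    H s v = 2 * H t (rf G s (rf G t v)) := by
  rw [R.rule hv hs h0 hne, SmallType.rule, if_pos ha, if_pos h1]

theorem Rules.adj_zero (R : Rules G H N) {s t : I} {v : I → ℤ} (hv : RootBelow G N v)
    (ha : G.Adj t s) (hs : pr G v s ≤ 0) (h0 : 0 < pr G v t) (hne : v ≠ sr t)
    (h1 : pr G v t + pr G v s = 0) :
    H s v = 2 * H t (rf G t v) - H s (rf G t v) := by
  rw [R.rule hv hs h0 hne, SmallType.rule, if_pos ha, if_neg (by omega), if_pos h1]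

theorem Rules.adj_neg (R : Rules G H N) {s t : I} {v : I → ℤ} (hv : RootBelow G N v)
    (ha : G.Adj t s) (hs : pr G v s ≤ 0) (h0 : 0 < pr G v t) (hne : v ≠ sr t)
    (h1 : pr G v t + pr G v s < 0) :
    H s v = H s (rf G t v) + 2 * H t (rf G t v) := by
  rw [R.rule hv hs h0 hne, SmallType.rule, if_pos ha, if_neg (by omega), if_neg (by omega)]

/-- Consistency for nonadjacent descents `t, u` when `s` is adjacent to `t` at most. -/
theorem rule_eq_of_nonadj_of_not_adj {v : I → ℤ} (R : Rules G H (ht v)) (hv : IsRoot G v)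
    {s t u : I} (hs : pr G v s ≤ 0) (h0 : 0 < pr G v t) (h1 : 0 < pr G v u)
    (hut : u ≠ t) (htu : ¬ G.Adj u t) (hsu : ¬ G.Adj u s) (hnt : v ≠ sr t) (hnu : v ≠ sr u) :
    rule G H s t v = rule G H s u v := by
  have hus : u ≠ s := by rintro rfl; omega
  have hts : t ≠ s := by rintro rfl; omega
  have ε := rf_comm G hut htu v
  have a1 := pr_rf_self G t v
  have a2 := pr_rf_nonadj G hut.symm (fun h => htu h.symm) v
  have b1 := pr_rf_self G u v
  have b2 := pr_rf_nonadj G hut htu v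
  have b3 := pr_rf_nonadj G hus hsu v
  have ot : RootBelow G (ht v) (rf G t v) := ⟨hv.down h0 hnt, by rw [ht_rf]; omega⟩
  have ou : RootBelow G (ht v) (rf G u v) := ⟨hv.down h1 hnu, by rw [ht_rf]; omega⟩
  have nt : rf G t v ≠ sr u := ne_sr_of_nonadj hut htu (by omega)
  have nu : rf G u v ≠ sr t := ne_sr_of_nonadj hut.symm (fun h => htu h.symm) (by omega)
  have e : rule G H s u v = rule G H s t (rf G u v) := by
    rw [rule, if_neg hsu, R.rule ou (t := t) (by omega) (by omega) nu]
  rw [e]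
  by_cases hst : G.Adj t s
  · have a3 := pr_rf_adj G hst v
    have b4 := pr_rf_adj G hst (rf G u v)
    have k1 : pr G (rf G t v) s ≤ 0 → H s (rf G t v) = H s (rf G t (rf G u v)) := fun h => by
      rw [R.nonadj ot hsu h (by omega) nt, ε]
    have k2 : H t (rf G t v) = H t (rf G t (rf G u v)) := by
      rw [R.nonadj ot htu (by omega) (by omega) nt, ε]
    rcases lt_trichotomy (pr G v t + pr G v s) 0 with h | h | h
    · rw [rule, if_pos hst, if_neg (by omega), if_neg (by omega), rule, if_pos hst,
        if_neg (by omega), if_neg (by omega), k1 (by omega), k2]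
    · rw [rule, if_pos hst, if_neg (by omega), if_pos (by omega), rule, if_pos hst,
        if_neg (by omega), if_pos (by omega), k1 (by omega), k2]
    · have c1 := pr_rf_adj G hst.symm (rf G t v)
      have c2 := pr_rf_nonadj G hus.symm (fun h => hsu h.symm) (rf G t v)
      have c3 := pr_rf_self G s (rf G t v)
      have os := ot.down (t := s) (by omega)
        (ne_sr_of_nonadj hus.symm (fun h => hsu h.symm) (by omega))
      rw [rule, if_pos hst, if_pos h, rule, if_pos hst, if_pos (by omega),
        R.nonadj os htu (by omega) (by omega) (ne_sr_of_nonadj hus hsu (by omega)),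
        rf_comm G hus hsu, ε]
  · have a3 := pr_rf_nonadj G hts hst v
    rw [rule, if_neg hst, rule, if_neg hst, R.nonadj ot hsu (by omega) (by omega) nt, ε]

end Consistency


section Consistency

variable {I : Type*} [Fintype I] {G : SimpleGraph I}
variable {H : I → (I → ℤ) → ℤ} {N : ℤ}

set_option maxHeartbeats 1000000 in
/-- Consistency for nonadjacent descents `t, u`, both adjacent to `s`. -/
theorem rule_eq_of_nonadj_of_adj_of_le {v : I → ℤ} (R : Rules G H (ht v)) (hv : IsRoot G v)
    {s t u : I} (hs : pr G v s ≤ 0) (h0 : 0 < pr G v t) (h1 : 0 < pr G v u)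
    (hut : u ≠ t) (htu : ¬ G.Adj u t) (hts : G.Adj t s) (hus : G.Adj u s)
    (hnt : v ≠ sr t) (hnu : v ≠ sr u) (hle : pr G v u ≤ pr G v t) :
    rule G H s t v = rule G H s u v := by
  have htu' : ¬ G.Adj t u := fun h => htu h.symm
  have ε := rf_comm G hut htu v
  set γ := rf G t v with hγ
  set γ' := rf G u v with hγ'
  have a1 : pr G γ t = _ := pr_rf_self G t v
  have a2 : pr G γ u = _ := pr_rf_nonadj G hut.symm htu' v
  have a3 : pr G γ s = _ := pr_rf_adj G hts v
  have b1 : pr G γ' u = _ := pr_rf_self G u v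
  have b2 : pr G γ' t = _ := pr_rf_nonadj G hut htu v
  have b3 : pr G γ' s = _ := pr_rf_adj G hus v
  have ot : RootBelow G (ht v) γ := ⟨hv.down h0 hnt, by rw [hγ, ht_rf]; omega⟩
  have ou : RootBelow G (ht v) γ' := ⟨hv.down h1 hnu, by rw [hγ', ht_rf]; omega⟩
  have nt : γ ≠ sr u := ne_sr_of_nonadj hut htu (by omega)
  have nu : γ' ≠ sr t := ne_sr_of_nonadj hut.symm htu' (by omega)
  have kt : H t γ = H t (rf G u γ) := R.nonadj ot htu (by omega) (by omega) nt
  have ku : H u γ' = H u (rf G u γ) := by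
    rw [R.nonadj ou htu' (by omega) (by omega) nu, ε]
  have oε := ot.down (by omega) nt
  set e := rf G u γ with he
  have e1 : pr G e t = - pr G v t := by rw [he, pr_rf_nonadj G hut htu, a1]
  have e2 : pr G e u = - pr G v u := by rw [he, pr_rf_self, a2]
  have e3 : pr G e s = pr G v s + pr G v t + pr G v u := by rw [he, pr_rf_adj G hus, a3, a2]
  have f1 : pr G (rf G s e) t = _ := pr_rf_adj G hts.symm e
  have f2 : pr G (rf G s e) u = _ := pr_rf_adj G hus.symm e
  have f3 : pr G (rf G s e) s = _ := pr_rf_self G s e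
  by_cases c1 : 0 < pr G v u + pr G v s
  · rw [rule, if_pos hts, if_pos (by omega), rule, if_pos hus, if_pos (by omega), ← hγ, ← hγ']
    have a4 : pr G (rf G s γ) s = _ := pr_rf_self G s γ
    have a5 : pr G (rf G s γ) t = _ := pr_rf_adj G hts.symm γ
    have a6 : pr G (rf G s γ) u = _ := pr_rf_adj G hus.symm γ
    have b4 : pr G (rf G s γ') s = _ := pr_rf_self G s γ'
    have b5 : pr G (rf G s γ') t = _ := pr_rf_adj G hts.symm γ'
    have b6 : pr G (rf G s γ') u = _ := pr_rf_adj G hus.symm γ'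
    have os := ot.down (t := s) (by omega) (ne_sr_of_adj hus.symm (by omega))
    have os' := ou.down (t := s) (by omega) (ne_sr_of_adj hts.symm (by omega))
    by_cases d : rf G s γ = sr u
    · have d1 : γ = rf G s (sr u) := by rw [← d, rf_rf]
      have d2 : v = rf G t (rf G s (sr u)) := by rw [← d1, hγ, rf_rf]
      have d' : rf G s γ' = sr t := by
        have p1 := pr_sr_adj G hus
        have p2 := pr_sr_nonadj G hut htu
        have p3 : pr G (rf G s (sr u)) t = -1 := by
          rw [pr_rf_adj G hts.symm, p1, p2]; rfl
        have p4 := pr_sr_self G u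
        have p5 := pr_sr_adj G hus.symm
        have p6 := pr_sr_nonadj G hut.symm htu'
        have p7 := pr_sr_self G s
        have p8 := pr_sr_adj G hts
        have d3 : v = sr u + sr s + sr t := by
          rw [d2, rf, p3, rf, p1]; module
        have d4 : γ' = sr s + sr t := by
          rw [hγ', rf, d3, pr_add, pr_add, p4, p5, p6]; module
        rw [d4, rf, pr_add, p7, p8]
        module
      rw [d, d', R.simple hut, R.simple hut.symm]
    · have d' : rf G s γ' ≠ sr t := by
        intro d'
        apply d
        have q1 : pr G (rf G s γ') t = 2 := by rw [d', pr_sr_self]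
        have q2 : pr G (rf G s γ') u = 0 := by rw [d', pr_sr_nonadj G hut.symm htu']
        have q3 : pr G (rf G s γ') s = -1 := by rw [d', pr_sr_adj G hts]
        have d1 : γ' = rf G s (sr t) := by rw [← d', rf_rf]
        have d2 : v = rf G u (rf G s (sr t)) := by rw [← d1, hγ', rf_rf]
        have p1 := pr_sr_adj G hts
        have p2 := pr_sr_nonadj G hut.symm htu'
        have p3 : pr G (rf G s (sr t)) u = -1 := by
          rw [pr_rf_adj G hus.symm, p1, p2]; rfl
        have p4 := pr_sr_self G t
        have p5 := pr_sr_adj G hts.symm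
        have p6 := pr_sr_nonadj G hut htu
        have p7 := pr_sr_self G s
        have p8 := pr_sr_adj G hus
        have d3 : v = sr t + sr s + sr u := by
          rw [d2, rf, p3, rf, p1]; module
        have d4 : γ = sr s + sr u := by
          rw [hγ, rf, d3, pr_add, pr_add, p4, p5, p6]; module
        rw [d4, rf, pr_add, p7, p8]
        module
      have oo := os.down (by omega) d
      have oo' := os'.down (by omega) d'
      have g1 : pr G (rf G u (rf G s γ)) t = _ := pr_rf_nonadj G hut htu _
      have g2 : pr G (rf G u (rf G s γ)) s = _ := pr_rf_adj G hus _
      have g3 : pr G (rf G u (rf G s γ)) u = _ := pr_rf_self G u _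
      have g4 : pr G (rf G t (rf G s γ')) u = _ := pr_rf_nonadj G hut.symm htu' _
      have g5 : pr G (rf G t (rf G s γ')) s = _ := pr_rf_adj G hts _
      have g6 : pr G (rf G t (rf G s γ')) t = _ := pr_rf_self G t _
      rw [R.nonadj os htu (by omega) (by omega) d, R.nonadj os' htu' (by omega) (by omega) d',
        R.adj_pos oo hts.symm (by omega) (by omega) (ne_sr_of_adj hus.symm (by omega)) (by omega),
        R.adj_pos oo' hus.symm (by omega) (by omega) (ne_sr_of_adj hts.symm (by omega)) (by omega)]
      congr 3
      rw [rf_braid G hus.symm γ, ← he, rf_braid G hts.symm γ', ← ε]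
      rw [rf_comm G hut.symm htu']
  by_cases c2 : 0 < pr G v t + pr G v s
  · rw [rule, if_pos hts, if_pos (by omega), rule, if_pos hus, if_neg (by omega), ← hγ, ← hγ', ku]
    have a4 : pr G (rf G s γ) s = _ := pr_rf_self G s γ
    have a5 : pr G (rf G s γ) t = _ := pr_rf_adj G hts.symm γ
    have a6 : pr G (rf G s γ) u = _ := pr_rf_adj G hus.symm γ
    have os := ot.down (t := s) (by omega) (ne_sr_of_adj hts.symm (by omega))
    have d : rf G s γ ≠ sr u := ne_sr_of_nonadj hut htu (by omega)
    have oo := os.down (by omega) d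
    have g1 : pr G (rf G u (rf G s γ)) t = _ := pr_rf_nonadj G hut htu _
    have g2 : pr G (rf G u (rf G s γ)) s = _ := pr_rf_adj G hus _
    have g3 : pr G (rf G u (rf G s γ)) u = _ := pr_rf_self G u _
    have d2 : rf G u (rf G s γ) ≠ sr s := ne_sr_of_adj hus.symm (by omega)
    have oes := oε.down (t := s) (by omega) (ne_sr_of_adj hts.symm (by omega))
    have θ : rf G s (rf G u (rf G s γ)) = rf G u (rf G s e) := by rw [rf_braid G hus.symm γ]
    rw [R.nonadj os htu (by omega) (by omega) d,
      R.adj_pos oε hus.symm (by omega) (by omega) (ne_sr_of_adj hts.symm (by omega)) (by omega)]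
    by_cases c3 : pr G v u + pr G v s = 0
    · rw [if_pos c3, R.adj_zero oo hts.symm (by omega) (by omega) d2 (by omega), θ]
      have : H s γ' = 2 * H t (rf G u (rf G s e)) := by
        rw [R.adj_pos ou hts (by omega) (by omega) nu (by omega), ← ε,
          R.nonadj oes htu (by omega) (by omega) (ne_sr_of_adj hus (by omega))]
      rw [this]
      ring
    · rw [if_neg c3, R.adj_neg oo hts.symm (by omega) (by omega) d2 (by omega), θ]
      have : H s γ' = 2 * H t (rf G u (rf G s e)) := by
        rw [R.adj_pos ou hts (by omega) (by omega) nu (by omega), ← ε,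
          R.nonadj oes htu (by omega) (by omega) (ne_sr_of_nonadj hut htu (by omega))]
      rw [this]
      ring
  by_cases c3 : pr G v t + pr G v s = 0
  · have m1 : H s γ = 2 * H u (rf G s e) := by
      rw [R.adj_pos ot hus (by omega) (by omega) nt (by omega)]
    have m2 : H s γ' = 2 * H t (rf G s e) := by
      rw [R.adj_pos ou hts (by omega) (by omega) nu (by omega), ← ε]
    have d : e ≠ sr s := fun h => by
      have q1 : pr G e u = -1 := by rw [h, pr_sr_adj G hus.symm]
      have q2 : pr G e s = 2 := by rw [h, pr_sr_self]
      omega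
    have m4 : H u e = 2 * H s (rf G s e) - H u (rf G s e) := by
      rw [R.adj_zero oε hus.symm (by omega) (by omega) d (by omega)]
    by_cases c4 : pr G v u + pr G v s = 0
    · have m3 : H t e = 2 * H s (rf G s e) - H t (rf G s e) := by
        rw [R.adj_zero oε hts.symm (by omega) (by omega) d (by omega)]
      rw [rule, if_pos hts, if_neg c2, if_pos c3, rule, if_pos hus, if_neg c1, if_pos c4,
        ← hγ, ← hγ', kt, ku, m1, m2, m3, m4]
      ring
    · have m3 : H t e = H t (rf G s e) + 2 * H s (rf G s e) := by
        rw [R.adj_neg oε hts.symm (by omega) (by omega) d (by omega)]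
      rw [rule, if_pos hts, if_neg c2, if_pos c3, rule, if_pos hus, if_neg c1, if_neg c4,
        ← hγ, ← hγ', kt, ku, m1, m2, m3, m4]
      ring
  rw [rule, if_pos hts, if_neg c2, if_neg c3, rule, if_pos hus, if_neg c1, if_neg (by omega),
    ← hγ, ← hγ', kt, ku]
  rcases lt_trichotomy (pr G v t + pr G v u + pr G v s) 0 with h | h | h
  · rw [R.adj_neg ot hus (by omega) (by omega) nt (by omega), ← he,
      R.adj_neg ou hts (by omega) (by omega) nu (by omega), ← ε]
    ring
  · rw [R.adj_zero ot hus (by omega) (by omega) nt (by omega), ← he,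
      R.adj_zero ou hts (by omega) (by omega) nu (by omega), ← ε]
    ring
  · have d : e ≠ sr s := fun h => by
      have q1 : pr G e t = -1 := by rw [h, pr_sr_adj G hts.symm]
      have q2 : pr G e u = -1 := by rw [h, pr_sr_adj G hus.symm]
      omega
    rw [R.adj_pos ot hus (by omega) (by omega) nt (by omega), ← he,
      R.adj_pos ou hts (by omega) (by omega) nu (by omega), ← ε,
      R.adj_neg oε hts.symm (by omega) (by omega) d (by omega),
      R.adj_neg oε hus.symm (by omega) (by omega) d (by omega)]
    ring

end Consistency


section Consistency

variable {I : Type*} [Fintype I] {G : SimpleGraph I}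
variable {H : I → (I → ℤ) → ℤ} {N : ℤ}

theorem rf_sr_adj {i j : I} (h : G.Adj i j) : rf G j (sr i) = sr i + sr j := by
  rw [rf, pr_sr_adj G h]
  module

theorem rf_sr_nonadj {i j : I} (hne : i ≠ j) (h : ¬ G.Adj i j) : rf G j (sr i) = sr i :=
  rf_eq_self G (pr_sr_nonadj G hne h)

theorem rf_add_adj {i j : I} (h : G.Adj i j) : rf G j (sr i + sr j) = sr i := by
  rw [← rf_sr_adj h, rf_rf]

/-- If `rf t v` is simple then so is `rf u v`, when `t, u` are adjacent descents. -/
theorem rf_eq_sr_of_adj {v : I → ℤ} {t u : I} (htu : G.Adj t u) (h : rf G t v = sr u) :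
    rf G u v = sr t := by
  have : v = sr t + sr u := by rw [← rf_rf G t v, h, rf_sr_adj htu.symm, add_comm]
  rw [this, rf_add_adj htu]

/-- Consistency for adjacent descents `t, u`, both not adjacent to `s`. -/
theorem rule_eq_of_adj_of_nonadj {v : I → ℤ} (R : Rules G H (ht v)) (hv : IsRoot G v)
    {s t u : I} (hs : pr G v s ≤ 0) (h0 : 0 < pr G v t) (h1 : 0 < pr G v u)
    (htu : G.Adj t u) (hts : ¬ G.Adj t s) (hus : ¬ G.Adj u s)
    (hnt : v ≠ sr t) (hnu : v ≠ sr u) :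
    rule G H s t v = rule G H s u v := by
  have hus' : u ≠ s := by rintro rfl; omega
  have hts' : t ≠ s := by rintro rfl; omega
  rw [rule, if_neg hts, rule, if_neg hus]
  have a1 := pr_rf_self G t v
  have a2 := pr_rf_adj G htu v
  have a3 := pr_rf_nonadj G hts' hts v
  have b1 := pr_rf_self G u v
  have b2 := pr_rf_adj G htu.symm v
  have b3 := pr_rf_nonadj G hus' hus v
  have ot : RootBelow G (ht v) (rf G t v) := ⟨hv.down h0 hnt, by rw [ht_rf]; omega⟩
  have ou : RootBelow G (ht v) (rf G u v) := ⟨hv.down h1 hnu, by rw [ht_rf]; omega⟩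
  by_cases d : rf G t v = sr u
  · rw [d, rf_eq_sr_of_adj htu d, R.simple hus', R.simple hts']
  have d' : rf G u v ≠ sr t := fun h => d (rf_eq_sr_of_adj htu.symm h)
  have c1 := pr_rf_adj G htu.symm (rf G t v)
  have c2 := pr_rf_nonadj G hus' hus (rf G t v)
  have c3 := pr_rf_self G u (rf G t v)
  have c1' := pr_rf_adj G htu (rf G u v)
  have c2' := pr_rf_nonadj G hts' hts (rf G u v)
  have c3' := pr_rf_self G t (rf G u v)
  rw [R.nonadj ot hus (by omega) (by omega) d, R.nonadj ou hts (by omega) (by omega) d',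
    R.nonadj (ot.down (by omega) d) hts (by omega) (by omega) (ne_sr_of_adj htu (by omega)),
    R.nonadj (ou.down (by omega) d') hus (by omega) (by omega) (ne_sr_of_adj htu.symm (by omega)),
    rf_braid G htu]

set_option maxHeartbeats 1000000 in
/-- Consistency for adjacent descents `t, u`, when `s` is adjacent to `t` only. -/
theorem rule_eq_of_adj_of_adj {v : I → ℤ} (R : Rules G H (ht v)) (hv : IsRoot G v)
    {s t u : I} (hs : pr G v s ≤ 0) (h0 : 0 < pr G v t) (h1 : 0 < pr G v u)
    (htu : G.Adj t u) (hts : G.Adj t s) (hus : ¬ G.Adj u s)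
    (hnt : v ≠ sr t) (hnu : v ≠ sr u) :
    rule G H s t v = rule G H s u v := by
  have hus' : u ≠ s := by rintro rfl; omega
  have hsu : ¬ G.Adj s u := fun h => hus h.symm
  set γ := rf G t v with hγ
  set γ' := rf G u v with hγ'
  have a1 : pr G γ t = _ := pr_rf_self G t v
  have a2 : pr G γ u = _ := pr_rf_adj G htu v
  have a3 : pr G γ s = _ := pr_rf_adj G hts v
  have b1 : pr G γ' u = _ := pr_rf_self G u v
  have b2 : pr G γ' t = _ := pr_rf_adj G htu.symm v
  have b3 : pr G γ' s = _ := pr_rf_nonadj G hus' hus v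
  have ot : RootBelow G (ht v) γ := ⟨hv.down h0 hnt, by rw [hγ, ht_rf]; omega⟩
  have ou : RootBelow G (ht v) γ' := ⟨hv.down h1 hnu, by rw [hγ', ht_rf]; omega⟩
  have e0 : rule G H s u v = H s γ' := by rw [rule, if_neg hus]
  rw [e0]
  by_cases d : γ = sr u
  · have d' : γ' = sr t := rf_eq_sr_of_adj htu d
    have q1 : pr G γ s = 0 := by rw [d, pr_sr_nonadj G hus' hus]
    rw [rule, if_pos hts, if_neg (by omega), if_pos (by omega), ← hγ, d, d', R.simple hus',
      R.simple htu.ne', R.simple hts.ne]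
    rfl
  have d' : γ' ≠ sr t := fun h => d (rf_eq_sr_of_adj htu.symm h)
  have od := ou.down (t := t) (by omega) d'
  have od' := ot.down (t := u) (by omega) d
  have ω : rf G u (rf G t γ') = rf G t (rf G u γ) := by rw [hγ, hγ', rf_braid G htu]
  set δ := rf G t γ' with hδ
  set δ' := rf G u γ with hδ'
  have g1 : pr G δ t = _ := pr_rf_self G t γ'
  have g2 : pr G δ u = _ := pr_rf_adj G htu γ'
  have g3 : pr G δ s = _ := pr_rf_adj G hts γ'
  have k1 : pr G δ' u = _ := pr_rf_self G u γ
  have k2 : pr G δ' t = _ := pr_rf_adj G htu.symm γ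
  have k3 : pr G δ' s = _ := pr_rf_nonadj G hus' hus γ
  have nδ : δ ≠ sr u := ne_sr_of_adj htu.symm (by omega)
  have nδ' : δ' ≠ sr t := ne_sr_of_adj htu (by omega)
  have ow := od'.down (by omega) nδ'
  set w := rf G t δ' with hw
  have w1 : pr G w t = _ := pr_rf_self G t δ'
  have w2 : pr G w u = _ := pr_rf_adj G htu δ'
  have w3 : pr G w s = _ := pr_rf_adj G hts δ'
  have x1 : pr G (rf G s δ) s = _ := pr_rf_self G s δ
  have x2 : pr G (rf G s δ) t = _ := pr_rf_adj G hts.symm δ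
  have x3 : pr G (rf G s δ) u = _ := pr_rf_nonadj G hus'.symm hsu δ
  have hsw : rf G u (rf G s δ) = rf G s w := by rw [rf_comm G hus' hus, ω]
  have nw : w ≠ sr s := ne_sr_of_nonadj hus'.symm hsu (by omega)
  have kw : 0 < pr G w s → H u w = H u (rf G s w) := fun h =>
    R.nonadj ow hsu (by omega) h nw
  have ods : 0 < pr G δ s → RootBelow G (ht v) (rf G s δ) := fun h =>
    od.down h (ne_sr_of_nonadj hus'.symm hsu (by omega))
  rcases lt_trichotomy (pr G v t + pr G v s) 0 with h | h | h
  · have t1 : H t γ = 2 * H u w := by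
      rw [R.adj_pos ot htu.symm (by omega) (by omega) d (by omega)]
    have t2 : H s γ = H s δ' := R.nonadj ot hus (by omega) (by omega) d
    rw [rule, if_pos hts, if_neg (by omega), if_neg (by omega), ← hγ, t1, t2]
    rcases lt_trichotomy (pr G v t + pr G v u + pr G v s) 0 with h' | h' | h'
    · rw [R.adj_neg od' hts (by omega) (by omega) nδ' (by omega),
        R.adj_neg ou hts (by omega) (by omega) d' (by omega), ← hw, ← hδ,
        R.nonadj od hus (by omega) (by omega) nδ,
        R.adj_neg od htu.symm (by omega) (by omega) nδ (by omega), ω]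
      ring
    · rw [R.adj_zero od' hts (by omega) (by omega) nδ' (by omega),
        R.adj_zero ou hts (by omega) (by omega) d' (by omega), ← hw, ← hδ,
        R.nonadj od hus (by omega) (by omega) nδ,
        R.adj_neg od htu.symm (by omega) (by omega) nδ (by omega), ω]
      ring
    · rw [R.adj_pos od' hts (by omega) (by omega) nδ' (by omega),
        R.adj_pos ou hts (by omega) (by omega) d' (by omega), ← hw, ← hδ,
        R.adj_neg (ods (by omega)) htu.symm (by omega) (by omega)
          (ne_sr_of_nonadj hus' hus (by omega)) (by omega), hsw, kw (by omega)]
      ring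
  · have t1 : H t γ = 2 * H u w := by
      rw [R.adj_pos ot htu.symm (by omega) (by omega) d (by omega)]
    have t2 : H s γ = H s δ' := R.nonadj ot hus (by omega) (by omega) d
    rw [rule, if_pos hts, if_neg (by omega), if_pos (by omega), ← hγ, t1, t2,
      R.adj_pos od' hts (by omega) (by omega) nδ' (by omega),
      R.adj_pos ou hts (by omega) (by omega) d' (by omega), ← hw, ← hδ,
      R.adj_zero (ods (by omega)) htu.symm (by omega) (by omega)
        (ne_sr_of_nonadj hus' hus (by omega)) (by omega), hsw, kw (by omega)]
    ring
  · have y1 : pr G (rf G s γ) s = _ := pr_rf_self G s γ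
    have y2 : pr G (rf G s γ) t = _ := pr_rf_adj G hts.symm γ
    have y3 : pr G (rf G s γ) u = _ := pr_rf_nonadj G hus'.symm hsu γ
    have z1 : pr G (rf G s δ') s = _ := pr_rf_self G s δ'
    have z2 : pr G (rf G s δ') t = _ := pr_rf_adj G hts.symm δ'
    have z3 : pr G (rf G s δ') u = _ := pr_rf_nonadj G hus'.symm hsu δ'
    have z4 : pr G (rf G t (rf G s δ')) s = _ := pr_rf_adj G hts _
    have z5 : pr G (rf G t (rf G s δ')) u = _ := pr_rf_adj G htu _
    have z6 : pr G (rf G t (rf G s δ')) t = _ := pr_rf_self G t _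
    have os := ot.down (t := s) (by omega) (ne_sr_of_nonadj hus'.symm hsu (by omega))
    have os' := od'.down (t := s) (by omega) (ne_sr_of_nonadj hus'.symm hsu (by omega))
    have os2 := os'.down (t := t) (by omega) (ne_sr_of_adj htu (by omega))
    have key : rf G s (rf G t (rf G s δ')) = rf G t (rf G s w) := by
      rw [rf_braid G hts.symm]
    rw [rule, if_pos hts, if_pos (by omega), ← hγ,
      R.adj_pos os htu.symm (by omega) (by omega) (ne_sr_of_nonadj hus' hus (by omega)) (by omega),
      rf_comm G hus' hus, ← hδ',
      R.nonadj os2 hsu (by omega) (by omega) (fun h => by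
        have q1 : pr G (rf G t (rf G s δ')) s = 2 := by rw [h, pr_sr_self]
        have q2 : pr G (rf G t (rf G s δ')) t = -1 := by rw [h, pr_sr_adj G hts.symm]
        omega), key,
      R.adj_pos ou hts (by omega) (by omega) d' (by omega), ← hδ,
      R.adj_pos (ods (by omega)) htu.symm (by omega) (by omega)
          (ne_sr_of_nonadj hus' hus (by omega)) (by omega), hsw]

/-- The recursion does not depend on the chosen descent. -/
theorem rule_eq_rule (hT : ∀ i j k, G.Adj i j → G.Adj j k → ¬ G.Adj i k)
    {v : I → ℤ} (R : Rules G H (ht v)) (hv : IsRoot G v)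
    {s t u : I} (hs : pr G v s ≤ 0) (h0 : 0 < pr G v t) (h1 : 0 < pr G v u)
    (hnt : v ≠ sr t) (hnu : v ≠ sr u) :
    rule G H s t v = rule G H s u v := by
  by_cases htu : t = u
  · rw [htu]
  by_cases hadj : G.Adj t u
  · by_cases hts : G.Adj t s
    · exact rule_eq_of_adj_of_adj R hv hs h0 h1 hadj hts
        (fun h => hT t u s hadj h hts) hnt hnu
    · by_cases hus : G.Adj u s
      · exact (rule_eq_of_adj_of_adj R hv hs h1 h0 hadj.symm hus hts hnu hnt).symm
      · exact rule_eq_of_adj_of_nonadj R hv hs h0 h1 hadj hts hus hnt hnu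
  · have hadj' : ¬ G.Adj u t := fun h => hadj h.symm
    by_cases hus : G.Adj u s
    · by_cases hts : G.Adj t s
      · rcases le_total (pr G v u) (pr G v t) with h | h
        · exact rule_eq_of_nonadj_of_adj_of_le R hv hs h0 h1 (Ne.symm htu) hadj' hts hus hnt hnu h
        · exact (rule_eq_of_nonadj_of_adj_of_le R hv hs h1 h0 htu hadj hus hts hnu hnt h).symm
      · exact (rule_eq_of_nonadj_of_not_adj R hv hs h1 h0 htu hadj hts hnu hnt).symm
    · exact rule_eq_of_nonadj_of_not_adj R hv hs h0 h1 (Ne.symm htu) hadj' hus hnt hnu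

end Consistency


section Existence

variable {I : Type*} [Fintype I] {G : SimpleGraph I}

variable (G) in
open scoped Classical in
/-- One step of the recursion defining the coefficients. -/
noncomputable def coeffStep (H : I → (I → ℤ) → ℤ) (s : I) (v : I → ℤ) : ℤ :=
  if 0 < pr G v s then (if v = sr s then 2 else 0)
  else if ∃ t, v = sr t then 1
  else if h : ∃ t, 0 < pr G v t then rule G H s h.choose v else 0

variable (G) in
/-- The recursion iterated finitely often. -/
noncomputable def coeffIter : ℕ → I → (I → ℤ) → ℤ
  | 0 => fun _ _ => 0
  | n + 1 => coeffStep G (coeffIter n)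

variable (G) in
/-- Twice the coefficients (up to an additive constant) of the small-type Krammer
representation. -/
noncomputable def coeff (s : I) (v : I → ℤ) : ℤ := coeffIter G (ht v).toNat s v

theorem rule_congr {H H' : I → (I → ℤ) → ℤ} {v : I → ℤ} (hv : IsRoot G v)
    (h : ∀ i w, IsRoot G w → ht w < ht v → H i w = H' i w) {s t : I} (hs : pr G v s ≤ 0)
    (h0 : 0 < pr G v t) (hne : v ≠ sr t) : rule G H s t v = rule G H' s t v := by
  have r1 := hv.down h0 hne
  have l1 : ht (rf G t v) < ht v := by rw [ht_rf]; omega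
  by_cases ha : G.Adj t s
  · have a1 := pr_rf_adj G ha v
    have a2 := pr_rf_self G t v
    by_cases h1 : 0 < pr G v t + pr G v s
    · have r2 : IsRoot G (rf G s (rf G t v)) := r1.down (by omega) (fun h => by
        have q1 : pr G (rf G t v) s = 2 := by rw [h, pr_sr_self]
        have q2 : pr G (rf G t v) t = -1 := by rw [h, pr_sr_adj G ha.symm]
        omega)
      have l2 : ht (rf G s (rf G t v)) < ht v := by rw [ht_rf]; omega
      simp only [rule, if_pos ha, if_pos h1, h _ _ r2 l2]
    · simp only [rule, if_pos ha, if_neg h1, h _ _ r1 l1]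
  · simp only [rule, if_neg ha, h _ _ r1 l1]

theorem ne_sr_of_nonsimple {I : Type*} {v : I → ℤ} (h : ¬ ∃ t, v = sr t) (i : I) : v ≠ sr i :=
  fun hi => h ⟨i, hi⟩

theorem nonsimple_of_descent {v : I → ℤ} {t : I} (h0 : 0 < pr G v t) (hne : v ≠ sr t) :
    ¬ ∃ i, v = sr i := by
  rintro ⟨i, rfl⟩
  exact hne (by rw [eq_of_pr_sr_pos h0])

theorem coeffStep_congr {H H' : I → (I → ℤ) → ℤ} {v : I → ℤ} (hv : IsRoot G v)
    (h : ∀ i w, IsRoot G w → ht w < ht v → H i w = H' i w) (s : I) :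
    coeffStep G H s v = coeffStep G H' s v := by
  rw [coeffStep, coeffStep]
  split_ifs with h1 h2 h3 h4
  · rfl
  · rfl
  · rfl
  · exact rule_congr hv h (by omega) h4.choose_spec (ne_sr_of_nonsimple h3 _)
  · rfl

theorem coeffIter_eq {v : I → ℤ} (hv : IsRoot G v) {n m : ℕ} (hn : ht v ≤ n) (hm : ht v ≤ m)
    (s : I) : coeffIter G n s v = coeffIter G m s v := by
  have := hv.one_le_ht
  induction n generalizing m v s with
  | zero => omega
  | succ n ih =>
    cases m with
    | zero => omega
    | succ m =>
      exact coeffStep_congr hv (fun i w hw hlt =>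
        ih hw (by omega) (by omega) _ hw.one_le_ht) s

theorem coeff_eq_step {v : I → ℤ} (hv : IsRoot G v) (s : I) :
    coeff G s v = coeffStep G (coeff G) s v := by
  have := hv.one_le_ht
  rw [coeff, coeffIter_eq hv (m := (ht v).toNat + 1) (by omega) (by omega)]
  refine coeffStep_congr hv (fun i w hw hlt => ?_) s
  have := hw.one_le_ht
  exact coeffIter_eq hw (by omega) (by omega) i

theorem coeff_rules (hT : ∀ i j k, G.Adj i j → G.Adj j k → ¬ G.Adj i k) (N : ℤ) :
    Rules G (coeff G) N := by
  have main : ∀ n : ℕ, Rules G (coeff G) n := by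
    intro n
    induction n with
    | zero =>
      refine ⟨fun hv => ?_, fun s => ?_, fun hts => ?_, fun hv => ?_⟩
      · have := hv.1.one_le_ht; have := hv.2; omega
      · rw [coeff_eq_step (.simple s), coeffStep, if_pos (by rw [pr_sr_self]; norm_num),
          if_pos rfl]
      · rename_i s t
        rw [coeff_eq_step (.simple t), coeffStep,
          if_neg (fun h => hts (eq_of_pr_sr_pos h)), if_pos ⟨t, rfl⟩]
      · have := hv.1.one_le_ht; have := hv.2; omega
    | succ n ih =>
      refine ⟨fun hv h1 h2 => ?_, ih.self, ih.simple, fun hv hs h0 hne => ?_⟩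
      · rw [coeff_eq_step hv.1, coeffStep, if_pos h1, if_neg h2]
      · rename_i s t v
        have hlt := hv.2
        have R : Rules G (coeff G) (ht v) :=
          ⟨fun hw => ih.pos ⟨hw.1, by have := hw.2; omega⟩, ih.self, ih.simple,
            fun hw => ih.rule ⟨hw.1, by have := hw.2; omega⟩⟩
        have hns := nonsimple_of_descent h0 hne
        have hex : ∃ t, 0 < pr G v t := ⟨t, h0⟩
        rw [coeff_eq_step hv.1, coeffStep, if_neg (by omega), if_neg hns, dif_pos hex]
        exact rule_eq_rule hT R hv.1 hs hex.choose_spec h0 (ne_sr_of_nonsimple hns _) hne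
  have R := main N.toNat
  have hN := Int.self_le_toNat N
  exact ⟨fun hw => R.pos ⟨hw.1, by have := hw.2; omega⟩, R.self, R.simple,
            fun hw => R.rule ⟨hw.1, by have := hw.2; omega⟩⟩

theorem IsRoot.rootBelow {v : I → ℤ} (h : IsRoot G v) : RootBelow G (ht v + 1) v :=
  ⟨h, by omega⟩

variable (hT : ∀ i j k, G.Adj i j → G.Adj j k → ¬ G.Adj i k)

include hT

theorem coeff_rf_of_nonadj_of_pos {s t : I} (hst : t ≠ s) (ha : ¬ G.Adj t s) {v : I → ℤ}
    (hv : IsRoot G v) (h0 : 0 < pr G v t) (hne : v ≠ sr t) :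
    coeff G s (rf G t v) = coeff G s v := by
  have R := coeff_rules hT (ht v + 1)
  have a1 := pr_rf_nonadj G hst ha v
  have a2 := pr_rf_self G t v
  rcases le_or_gt (pr G v s) 0 with hs | hs
  · exact (R.nonadj hv.rootBelow ha hs h0 hne).symm
  · have ha' : ¬ G.Adj s t := fun h => ha h.symm
    rw [R.pos hv.rootBelow hs (ne_sr_of_nonadj hst.symm ha' (by omega)),
      R.pos (hv.rootBelow.down h0 hne) (by omega) (ne_sr_of_nonadj hst.symm ha' (by omega))]

theorem coeff_rf_of_nonadj {s t : I} (hst : t ≠ s) (ha : ¬ G.Adj t s) {v : I → ℤ}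
    (hv : IsRoot G v) (hne : v ≠ sr t) :
    coeff G s (rf G t v) = coeff G s v := by
  rcases lt_trichotomy (pr G v t) 0 with h | h | h
  · have := coeff_rf_of_nonadj_of_pos hT hst ha (hv.up t h)
      (by rw [pr_rf_self]; omega) (rf_ne_sr hv h t)
    rw [rf_rf] at this
    exact this.symm
  · rw [rf_eq_self G h]
  · exact coeff_rf_of_nonadj_of_pos hT hst ha hv h hne

theorem coeff_eq_of_orthogonal {s t : I} (ha : G.Adj s t) {v : I → ℤ} (hv : IsRoot G v)
    (hs : pr G v s = 0) (ht0 : pr G v t = 0) : coeff G s v = coeff G t v := by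
  induction hn : (ht v).toNat using Nat.strong_induction_on generalizing v s t with
  | _ n ih =>
  subst hn
  have key : ∀ {w : I → ℤ}, IsRoot G w → ht w < ht v → ∀ {s t : I}, G.Adj s t →
      pr G w s = 0 → pr G w t = 0 → coeff G s w = coeff G t w := by
    intro w hw hlt s t ha h1 h2
    have := hw.one_le_ht
    exact ih _ (by omega) ha hw h1 h2 rfl
  have R := coeff_rules hT (ht v + 1)
  rcases hv.cases_descent with ⟨k, rfl⟩ | ⟨u, hu, hroot, hns⟩
  · have k1 : k ≠ s := by rintro rfl; rw [pr_sr_self] at hs; omega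
    have k2 : k ≠ t := by rintro rfl; rw [pr_sr_self] at ht0; omega
    rw [R.simple k1, R.simple k2]
  have hlt : ht (rf G u v) < ht v := by rw [ht_rf]; omega
  have half : ∀ {s t : I}, G.Adj s t → pr G v s = 0 → pr G v t = 0 → G.Adj u s →
      coeff G s v = coeff G t v := by
    intro s t ha hs ht0 hus
    have hut : ¬ G.Adj u t := hT u s t hus ha
    have hut' : u ≠ t := by rintro rfl; omega
    have htu : ¬ G.Adj t u := fun h => hut h.symm
    have a1 : pr G (rf G u v) u = _ := pr_rf_self G u v
    have a2 : pr G (rf G u v) s = _ := pr_rf_adj G hus v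
    have a3 : pr G (rf G u v) t = _ := pr_rf_nonadj G hut' hut v
    have n1 : rf G u v ≠ sr s := ne_sr_of_adj ha (by omega)
    have b1 := hv.rootBelow.down hu (hns u)
    rw [R.adj_pos hv.rootBelow hus (by omega) hu (hns u) (by omega),
      R.nonadj hv.rootBelow hut (by omega) hu (hns u),
      R.adj_pos b1 ha (by omega) (by omega) n1 (by omega)]
    have b2 := b1.down (t := s) (by omega) n1
    set ζ := rf G s (rf G u v)
    have c1 : pr G ζ s = _ := pr_rf_self G s _
    have c2 : pr G ζ u = _ := pr_rf_adj G hus.symm _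
    have c3 : pr G ζ t = _ := pr_rf_adj G ha _
    have n2 : ζ ≠ sr t := fun h => by
      have q1 : pr G ζ t = 2 := by rw [h, pr_sr_self]
      have q2 : pr G ζ s = -1 := by rw [h, pr_sr_adj G ha.symm]
      omega
    have d1 : pr G (rf G t ζ) s = _ := pr_rf_adj G ha.symm ζ
    have d2 : pr G (rf G t ζ) u = _ := pr_rf_nonadj G hut'.symm htu ζ
    rw [← coeff_rf_of_nonadj hT hut'.symm htu b2.1 n2]
    have b3 := b2.down (t := t) (by omega) n2
    rw [key b3.1 (by
      have : ht ζ < ht v := by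
        have : ht ζ = _ := ht_rf s (rf G u v)
        omega
      rw [ht_rf]; omega) hus (by omega) (by omega)]
  by_cases hus : G.Adj u s
  · exact half ha hs ht0 hus
  by_cases hut : G.Adj u t
  · exact (half ha.symm ht0 hs hut).symm
  have hus' : u ≠ s := by rintro rfl; omega
  have hut' : u ≠ t := by rintro rfl; omega
  rw [R.nonadj hv.rootBelow hus (by omega) hu (hns u),
    R.nonadj hv.rootBelow hut (by omega) hu (hns u)]
  exact key hroot hlt ha (by rwa [pr_rf_nonadj G hus' hus]) (by rwa [pr_rf_nonadj G hut' hut])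

end Existence

section Form

variable {I : Type*} [Fintype I] (G : SimpleGraph I)

open scoped Classical in
/-- The linear form coefficients `f s`, on roots. -/
noncomputable def cf (s : I) (v : I → ℤ) : ℝ := if IsRoot G v then (coeff G s v : ℝ) - 1 else 0

open scoped Classical in
/-- The degenerate operator `T i`. -/
noncomputable def opT (i : I) (F : (I → ℤ) → ℝ) (v : I → ℤ) : ℝ :=
  if ¬ IsRoot G v then F v
  else if v = sr i then 0
  else if 0 < pr G v i then F (rf G i v)
  else if pr G v i = 0 then F v
  else (F v + F (rf G i v)) / 2

variable {G}

theorem cf_root {s : I} {v : I → ℤ} (hv : IsRoot G v) : cf G s v = (coeff G s v : ℝ) - 1 :=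
  if_pos hv

theorem opT_nonroot {i : I} {F : (I → ℤ) → ℝ} {v : I → ℤ} (hv : ¬ IsRoot G v) :
    opT G i F v = F v := if_pos hv

theorem opT_sr {i : I} {F : (I → ℤ) → ℝ} : opT G i F (sr i) = 0 := by
  rw [opT, if_neg (by simp [IsRoot.simple i]), if_pos rfl]

theorem opT_pos {i : I} {F : (I → ℤ) → ℝ} {v : I → ℤ} (hv : IsRoot G v) (hne : v ≠ sr i)
    (h : 0 < pr G v i) : opT G i F v = F (rf G i v) := by
  rw [opT, if_neg (by simpa), if_neg hne, if_pos h]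

theorem opT_zero {i : I} {F : (I → ℤ) → ℝ} {v : I → ℤ} (h : pr G v i = 0) :
    opT G i F v = F v := by
  have hne : v ≠ sr i := ne_sr_of_self (G := G) (by omega)
  simp [opT, hne, h]

theorem opT_neg {i : I} {F : (I → ℤ) → ℝ} {v : I → ℤ} (hv : IsRoot G v)
    (h : pr G v i < 0) : opT G i F v = (F v + F (rf G i v)) / 2 := by
  rw [opT, if_neg (by simpa), if_neg (ne_sr_of_self (G := G) (by omega)), if_neg (by omega),
    if_neg (by omega)]

theorem opT_le_zero {i : I} {F : (I → ℤ) → ℝ} {v : I → ℤ} (hv : IsRoot G v)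
    (h : pr G v i ≤ 0) : opT G i F v = (F v + F (rf G i v)) / 2 := by
  rcases h.lt_or_eq with h | h
  · exact opT_neg hv h
  · rw [opT_zero h, rf_eq_self G h]; ring

variable (hT : ∀ i j k, G.Adj i j → G.Adj j k → ¬ G.Adj i k)

include hT

theorem cf_self (s : I) : cf G s (sr s) = 1 := by
  rw [cf_root (.simple s), (coeff_rules hT 0).self]; norm_num

theorem cf_sr {s t : I} (h : t ≠ s) : cf G s (sr t) = 0 := by
  rw [cf_root (.simple t), (coeff_rules hT 0).simple h]; norm_num

theorem cf_pos {s : I} {v : I → ℤ} (hv : IsRoot G v) (h : 0 < pr G v s) (hne : v ≠ sr s) :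
    cf G s v = -1 := by
  rw [cf_root hv, (coeff_rules hT _).pos hv.rootBelow h hne]; norm_num

theorem opT_cf_of_nonadj {s t : I} (hst : t ≠ s) (ha : ¬ G.Adj t s) :
    opT G t (cf G s) = cf G s := by
  funext v
  by_cases hv : IsRoot G v
  swap
  · exact opT_nonroot hv
  by_cases hne : v = sr t
  · rw [hne, opT_sr, cf_sr hT hst]
  rcases lt_or_ge 0 (pr G v t) with h | h
  · rw [opT_pos hv hne h, cf_root hv, cf_root (hv.down h hne), coeff_rf_of_nonadj hT hst ha hv hne]
  · have hr : IsRoot G (rf G t v) := by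
      rcases h.lt_or_eq with h | h
      · exact hv.up t h
      · rwa [rf_eq_self G h]
    rw [opT_le_zero hv h, cf_root hv, cf_root hr, coeff_rf_of_nonadj hT hst ha hv hne]
    ring

theorem opT_cf_of_adj_aux {s t : I} (ha : G.Adj s t) {v : I → ℤ} (hv : IsRoot G v)
    (hle : pr G v t ≤ pr G v s) : opT G s (cf G t) v = opT G t (cf G s) v := by
  by_cases hs : v = sr s
  · have h1 : IsRoot G (sr s + sr t) := by
      rw [← rf_sr_adj ha]
      exact (IsRoot.simple s).up t (by rw [pr_sr_adj G ha]; norm_num)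
    have h2 : pr G (sr s + sr t) s = 1 := by
      rw [pr_add, pr_sr_self, pr_sr_adj G ha.symm]; norm_num
    have h3 : cf G s (sr s + sr t) = -1 :=
      cf_pos hT h1 (by omega) (ne_sr_of_self (G := G) (by omega))
    rw [hs, opT_sr, opT_neg (.simple s) (by rw [pr_sr_adj G ha]; norm_num), cf_self hT,
      rf_sr_adj ha, h3]
    norm_num
  by_cases ht' : v = sr t
  · rw [ht', pr_sr_self, pr_sr_adj G ha.symm] at hle
    omega
  have a1 := pr_rf_self G s v
  have a2 := pr_rf_adj G ha v
  have b1 := pr_rf_self G t v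
  have b2 := pr_rf_adj G ha.symm v
  by_cases hst : v = sr s + sr t
  · have h2 : pr G v s = 1 := by
      rw [hst, pr_add, pr_sr_self, pr_sr_adj G ha.symm]; norm_num
    have h3 : pr G v t = 1 := by
      rw [hst, pr_add, pr_sr_self, pr_sr_adj G ha]; norm_num
    rw [opT_pos hv hs (by omega), opT_pos hv ht' (by omega), hst, rf_add_adj ha, add_comm,
      rf_add_adj ha.symm, cf_self hT, cf_self hT]
  have n1 : rf G s v ≠ sr t := fun h => hst (by
    rw [← rf_rf G s v, h, rf_sr_adj ha.symm, add_comm])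
  have n2 : rf G t v ≠ sr s := fun h => hst (by rw [← rf_rf G t v, h, rf_sr_adj ha])
  rcases lt_trichotomy (pr G v s) 0 with x | x | x
  · have r1 := hv.up s x
    have r2 := hv.up t (v := v) (by omega)
    have c1 : coeff G s (rf G t v) = _ :=
      (coeff_rules hT _).adj_neg r2.rootBelow ha.symm (by omega) (by omega)
        (rf_ne_sr hv (by omega) t) (by omega)
    have c2 : coeff G t (rf G s v) = _ :=
      (coeff_rules hT _).adj_neg r1.rootBelow ha (by omega) (by omega)
        (rf_ne_sr hv (by omega) s) (by omega)
    rw [rf_rf] at c1 c2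
    rw [opT_neg hv x, opT_neg hv (by omega), cf_root hv, cf_root hv, cf_root r1, cf_root r2, c1, c2]
    push_cast
    ring
  · rcases hle.lt_or_eq with y | y
    · have r2 := hv.up t (v := v) (by omega)
      have c1 : coeff G s (rf G t v) = _ :=
        (coeff_rules hT _).adj_zero r2.rootBelow ha.symm (by omega) (by omega)
          (rf_ne_sr hv (by omega) t) (by omega)
      rw [rf_rf] at c1
      rw [opT_zero x, opT_neg hv (by omega), cf_root hv, cf_root hv, cf_root r2, c1]
      push_cast
      ring
    · rw [opT_zero x, opT_zero (by omega), cf_root hv, cf_root hv,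
        coeff_eq_of_orthogonal hT ha hv x (by omega)]
  · have r1 := hv.down x hs
    rw [opT_pos hv hs x]
    rcases lt_trichotomy (pr G v t) 0 with y | y | y
    · have r2 := hv.up t y
      rw [opT_neg hv y, cf_pos hT hv x hs]
      rcases lt_or_ge 0 (pr G v s + pr G v t) with z | z
      · rw [cf_pos hT r1 (by omega) n1, cf_pos hT r2 (by omega) n2]
        norm_num
      · have c1 : coeff G s (rf G t v) = _ :=
          (coeff_rules hT _).adj_pos r2.rootBelow ha.symm (by omega) (by omega)
            (rf_ne_sr hv (by omega) t) (by omega)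
        rw [rf_rf] at c1
        rw [cf_root r1, cf_root r2, c1]
        push_cast
        ring
    · rw [opT_zero y, cf_pos hT hv x hs, cf_pos hT r1 (by omega) n1]
    · rw [opT_pos hv ht' y, cf_pos hT r1 (by omega) n1,
        cf_pos hT (hv.down y ht') (by omega) n2]

theorem opT_cf_of_adj {s t : I} (ha : G.Adj s t) :
    opT G s (cf G t) = opT G t (cf G s) := by
  funext v
  by_cases hv : IsRoot G v
  swap
  · rw [opT_nonroot hv, opT_nonroot hv, cf, cf, if_neg hv, if_neg hv]
  rcases le_total (pr G v t) (pr G v s) with h | h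
  · exact opT_cf_of_adj_aux hT ha hv h
  · exact (opT_cf_of_adj_aux hT ha.symm hv h).symm

end Form


section Operators

variable {I : Type*} [Fintype I] {G : SimpleGraph I}

theorem IsRoot.rf {v : I → ℤ} (hv : IsRoot G v) {i : I} (hne : v ≠ sr i) :
    IsRoot G (rf G i v) := by
  rcases lt_trichotomy (pr G v i) 0 with h | h | h
  · exact hv.up i h
  · rwa [rf_eq_self G h]
  · exact hv.down h hne

theorem IsRoot.add_adj {i j : I} (h : G.Adj i j) : IsRoot G (sr i + sr j) := by
  rw [← rf_sr_adj h]
  exact (IsRoot.simple i).up j (by rw [pr_sr_adj G h]; norm_num)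

theorem pr_add_adj {i j : I} (h : G.Adj i j) : pr G (sr i + sr j) i = 1 := by
  rw [pr_add, pr_sr_self, pr_sr_adj G h.symm]; norm_num

theorem pr_add_adj' {i j : I} (h : G.Adj i j) : pr G (sr i + sr j) j = 1 := by
  rw [add_comm, pr_add_adj h.symm]

theorem add_ne_sr {i j : I} (h : G.Adj i j) (k : I) : sr i + sr j ≠ sr k := by
  intro he
  have h1 := pr_add_adj h
  have h2 := pr_add_adj' h
  rw [he] at h1 h2
  obtain rfl := eq_of_pr_sr_pos (G := G) (i := k) (j := i) (by omega)
  have := eq_of_pr_sr_pos (G := G) (i := k) (j := j) (by omega)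
  exact h.ne this

theorem pr_add_adj_comm {i j : I} (h : G.Adj i j) (F : (I → ℤ) → ℝ) :
    opT G i F (sr i + sr j) = F (sr j) := by
  rw [opT_pos (.add_adj h) (add_ne_sr h i) (by rw [pr_add_adj h]; norm_num), add_comm,
    rf_add_adj h.symm]

theorem opT_sr_adj {i j : I} (h : G.Adj i j) (F : (I → ℤ) → ℝ) :
    opT G j F (sr i) = (F (sr i) + F (sr i + sr j)) / 2 := by
  rw [opT_neg (.simple i) (by rw [pr_sr_adj G h]; norm_num), rf_sr_adj h]

theorem opT_sr_nonadj {i j : I} (hne : i ≠ j) (h : ¬ G.Adj i j) (F : (I → ℤ) → ℝ) :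
    opT G j F (sr i) = F (sr i) := opT_zero (pr_sr_nonadj G hne h)

/-- Coefficient of `F v` in `opT i F v`, as a function of the pairing. -/
noncomputable def ca (x : ℤ) : ℝ := if 0 < x then 0 else if x = 0 then 1 else 1 / 2

/-- Coefficient of `F (rf i v)` in `opT i F v`, as a function of the pairing. -/
noncomputable def cb (x : ℤ) : ℝ := if 0 < x then 1 else if x = 0 then 0 else 1 / 2

theorem ca_cb_cases (x : ℤ) :
    (0 < x ∧ ca x = 0 ∧ cb x = 1 ∧ ca (-x) = 1 / 2 ∧ cb (-x) = 1 / 2) ∨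
    (x < 0 ∧ ca x = 1 / 2 ∧ cb x = 1 / 2 ∧ ca (-x) = 0 ∧ cb (-x) = 1) ∨
    (x = 0 ∧ ca x = 1 ∧ cb x = 0 ∧ ca (-x) = 1 ∧ cb (-x) = 0) := by
  rcases lt_trichotomy 0 x with h | h | h
  · left; simp [ca, cb, h, h.ne', h.le]
  · right; right; simp [ca, cb, h.symm]
  · right; left; simp [ca, cb, h, h.ne, h.le]

theorem ca_cb_braid (x y : ℤ) :
    ca x * (ca y * ca x) + cb x * (ca (x + y) * cb (-x)) =
      ca y * (ca x * ca y) + cb y * (ca (x + y) * cb (-y)) ∧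
    ca x * (ca y * cb x) + cb x * (ca (x + y) * ca (-x)) = ca y * (cb x * ca (x + y)) ∧
    ca x * (cb y * ca (x + y)) = ca y * (ca x * cb y) + cb y * (ca (x + y) * ca (-y)) ∧
    ca x * (cb y * cb (x + y)) = cb y * (cb (x + y) * ca x) ∧
    cb x * (cb (x + y) * ca y) = ca y * (cb x * cb (x + y)) := by
  rcases ca_cb_cases x with ⟨hx, a1, a2, a3, a4⟩ | ⟨hx, a1, a2, a3, a4⟩ | ⟨hx, a1, a2, a3, a4⟩ <;>
    rcases ca_cb_cases y with ⟨hy, b1, b2, b3, b4⟩ | ⟨hy, b1, b2, b3, b4⟩ |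
      ⟨hy, b1, b2, b3, b4⟩ <;>
    rcases ca_cb_cases (x + y) with ⟨hz, c1, c2, -⟩ | ⟨hz, c1, c2, -⟩ | ⟨hz, c1, c2, -⟩ <;>
    first
    | omega
    | (rw [a1, a2, a3, a4, b1, b2, b3, b4, c1, c2]; norm_num)

theorem opT_eq {i : I} {F : (I → ℤ) → ℝ} {v : I → ℤ} (hv : IsRoot G v) (hne : v ≠ sr i) :
    opT G i F v = ca (pr G v i) * F v + cb (pr G v i) * F (rf G i v) := by
  rw [opT, if_neg (by simpa), if_neg hne, ca, cb]
  split_ifs <;> ring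

theorem opT_comm {s t : I} (hst : s ≠ t) (ha : ¬ G.Adj s t) (F : (I → ℤ) → ℝ) :
    opT G s (opT G t F) = opT G t (opT G s F) := by
  have ha' : ¬ G.Adj t s := fun h => ha h.symm
  funext v
  by_cases hv : IsRoot G v
  swap
  · rw [opT_nonroot hv, opT_nonroot hv, opT_nonroot hv, opT_nonroot hv]
  by_cases h1 : v = sr s
  · rw [h1, opT_sr, opT_sr_nonadj hst ha, opT_sr]
  by_cases h2 : v = sr t
  · rw [h2, opT_sr, opT_sr_nonadj hst.symm ha', opT_sr]
  have n1 : rf G s v ≠ sr t := fun h => h2 (by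
    rw [← rf_rf G s v, h, rf_sr_nonadj hst.symm ha'])
  have n2 : rf G t v ≠ sr s := fun h => h1 (by rw [← rf_rf G t v, h, rf_sr_nonadj hst ha])
  rw [opT_eq hv h1, opT_eq hv h2, opT_eq (hv.rf h1) n1, opT_eq hv h2, opT_eq (hv.rf h2) n2,
    opT_eq hv h1, pr_rf_nonadj G hst ha, pr_rf_nonadj G hst.symm ha', rf_comm G hst ha]
  ring

theorem opT_braid {s t : I} (ha : G.Adj s t) (F : (I → ℤ) → ℝ) :
    opT G s (opT G t (opT G s F)) = opT G t (opT G s (opT G t F)) := by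
  funext v
  by_cases hv : IsRoot G v
  swap
  · simp only [opT_nonroot hv]
  have half : ∀ {s t : I}, G.Adj s t → v = sr s →
      opT G s (opT G t (opT G s F)) v = opT G t (opT G s (opT G t F)) v := by
    intro s t ha h1
    rw [h1, opT_sr, opT_sr_adj ha, opT_sr, pr_add_adj_comm ha, opT_sr]
    norm_num
  by_cases h1 : v = sr s
  · exact half ha h1
  by_cases h2 : v = sr t
  · exact (half ha.symm h2).symm
  by_cases h3 : v = sr s + sr t
  · rw [h3, pr_add_adj_comm ha, opT_sr, add_comm, pr_add_adj_comm ha.symm, opT_sr]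
  have e1 : ∀ {v}, rf G s v = sr t → v = sr s + sr t := fun {v} h => by
    rw [← rf_rf G s v, h, rf_sr_adj ha.symm, add_comm]
  have e2 : ∀ {v}, rf G t v = sr s → v = sr s + sr t := fun {v} h => by
    rw [← rf_rf G t v, h, rf_sr_adj ha]
  have e3 : ∀ {v}, rf G s v = sr s + sr t → v = sr t := fun {v} h => by
    rw [← rf_rf G s v, h, add_comm, rf_add_adj ha.symm]
  have e4 : ∀ {v}, rf G t v = sr s + sr t → v = sr s := fun {v} h => by
    rw [← rf_rf G t v, h, rf_add_adj ha]
  have e5 : ∀ {v}, IsRoot G v → rf G s v ≠ sr s := fun {v} hw h => by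
    have : v = - sr s := by rw [← rf_rf G s v, h, rf_sr_self]
    exact not_isRoot_neg_sr s (this ▸ hw)
  have e6 : ∀ {v}, IsRoot G v → rf G t v ≠ sr t := fun {v} hw h => by
    have : v = - sr t := by rw [← rf_rf G t v, h, rf_sr_self]
    exact not_isRoot_neg_sr t (this ▸ hw)
  have rs := hv.rf h1
  have rt := hv.rf h2
  have s1 := e5 hv
  have s2 : rf G s v ≠ sr t := fun h => h3 (e1 h)
  have s3 : rf G s v ≠ sr s + sr t := fun h => h2 (e3 h)
  have t1 := e6 hv
  have t2 : rf G t v ≠ sr s := fun h => h3 (e2 h)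
  have t3 : rf G t v ≠ sr s + sr t := fun h => h1 (e4 h)
  have rts := rs.rf s2
  have rst := rt.rf t2
  have u2 : rf G t (rf G s v) ≠ sr s := fun h => s3 (e2 h)
  have u2' : rf G s (rf G t v) ≠ sr t := fun h => t3 (e1 h)
  have p1 : pr G (rf G t (rf G s v)) s = pr G v t := by
    rw [pr_rf_adj G ha.symm, pr_rf_adj G ha, pr_rf_self]; ring
  have p2 : pr G (rf G s (rf G t v)) t = pr G v s := by
    rw [pr_rf_adj G ha, pr_rf_adj G ha.symm, pr_rf_self]; ring
  have q1 := rf_braid G ha v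
  rw [opT_eq hv h1, opT_eq hv h2, opT_eq rs s2, opT_eq hv h1, opT_eq rt t2, opT_eq rs s1,
    opT_eq rts u2, opT_eq hv h2, opT_eq hv h1, opT_eq rt t2, opT_eq hv h2, opT_eq rs s2,
    opT_eq rt t1, opT_eq rst u2', p1, p2, pr_rf_adj G ha, pr_rf_adj G ha.symm, pr_rf_self,
    pr_rf_self, rf_rf, rf_rf, q1, add_comm (pr G v t)]
  generalize pr G v s = x
  generalize pr G v t = y
  generalize F (rf G t (rf G s (rf G t v))) = f1
  generalize F (rf G t (rf G s v)) = f2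
  generalize F (rf G s (rf G t v)) = f3
  generalize F (rf G t v) = f4
  generalize F (rf G s v) = f5
  generalize F v = f6
  obtain ⟨k1, k2, k3, k4, k5⟩ := ca_cb_braid x y
  linear_combination f6 * k1 + f5 * k2 + f4 * k3 + f3 * k4 + f2 * k5

theorem opT_opT {s : I} {F : (I → ℤ) → ℝ} (hF : F (sr s) = 0) (v : I → ℤ) :
    opT G s (opT G s F) v = (opT G s F v + F v) / 2 := by
  by_cases hv : IsRoot G v
  swap
  · rw [opT_nonroot hv, opT_nonroot hv]; ring
  by_cases h1 : v = sr s
  · rw [h1, opT_sr, opT_sr, hF]; ring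
  rcases lt_trichotomy (pr G v s) 0 with h | h | h
  · rw [opT_neg hv h, opT_pos (hv.up s h) (rf_ne_sr hv h s) (by rw [pr_rf_self]; omega), rf_rf]
  · rw [opT_zero h, opT_zero h]; ring
  · rw [opT_pos hv h1 h, opT_pos hv h1 h, opT_neg (hv.down h h1) (by rw [pr_rf_self]; omega), rf_rf]

theorem opT_add_smul (s : I) (F K : (I → ℤ) → ℝ) (c : ℝ) (v : I → ℤ) :
    opT G s (fun w => F w + c * K w) v = opT G s F v + c * opT G s K v := by
  simp only [opT]
  split_ifs <;> ring

variable (G) in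
/-- The Krammer-type operators with parameter `τ`. -/
noncomputable def op (τ : ℝ) (i : I) (F : (I → ℤ) → ℝ) : (I → ℤ) → ℝ :=
  fun v => opT G i F v + τ * F (sr i) * cf G i v

theorem opT_op (τ : ℝ) (s t : I) (F : (I → ℤ) → ℝ) (v : I → ℤ) :
    opT G s (op G τ t F) v = opT G s (opT G t F) v + τ * F (sr t) * opT G s (cf G t) v :=
  opT_add_smul s _ _ _ v

theorem op_zero (i : I) (F : (I → ℤ) → ℝ) : op G 0 i F = opT G i F := by
  funext v
  simp [op]

variable (hT : ∀ i j k, G.Adj i j → G.Adj j k → ¬ G.Adj i k)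

include hT

theorem op_comm (τ : ℝ) {s t : I} (hst : s ≠ t) (ha : ¬ G.Adj s t) (F : (I → ℤ) → ℝ) :
    op G τ s (op G τ t F) = op G τ t (op G τ s F) := by
  have ha' : ¬ G.Adj t s := fun h => ha h.symm
  funext v
  change opT G s (op G τ t F) v + τ * op G τ t F (sr s) * cf G s v =
    opT G t (op G τ s F) v + τ * op G τ s F (sr t) * cf G t v
  rw [opT_op, opT_op, opT_cf_of_nonadj hT hst ha, opT_cf_of_nonadj hT hst.symm ha', op, op,
    cf_sr hT hst, cf_sr hT hst.symm, opT_sr_nonadj hst ha,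
    opT_sr_nonadj hst.symm ha',
    opT_comm hst ha]
  ring

theorem op_braid_aux (τ : ℝ) {s t : I} (ha : G.Adj s t) (F : (I → ℤ) → ℝ) (v : I → ℤ) :
    op G τ s (op G τ t (op G τ s F)) v =
      opT G s (opT G t (opT G s F)) v +
      τ * (F (sr s) + F (sr t) + F (sr s + sr t)) / 2 * opT G s (cf G t) v +
      τ * (F (sr s) * cf G t v + F (sr t) * cf G s v) / 2 := by
  have c1 : cf G s (sr t) = 0 := cf_sr hT ha.ne'
  have c2 : cf G t (sr s) = 0 := cf_sr hT ha.ne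
  have c3 : cf G s (sr s + sr t) = -1 :=
    cf_pos hT (.add_adj ha) (by rw [pr_add_adj ha]; norm_num) (add_ne_sr ha s)
  have c4 : cf G t (sr s + sr t) = -1 :=
    cf_pos hT (.add_adj ha) (by rw [pr_add_adj' ha]; norm_num) (add_ne_sr ha t)
  have e1 : op G τ s F (sr s) = τ * F (sr s) := by rw [op, opT_sr, cf_self hT]; ring
  have e2 : op G τ s F (sr t) = (F (sr t) + F (sr s + sr t)) / 2 := by
    rw [op, opT_sr_adj ha.symm, c1, add_comm (sr t)]; ring
  have e3 : op G τ s F (sr s + sr t) = F (sr t) - τ * F (sr s) := by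
    rw [op, pr_add_adj_comm ha, c3]; ring
  have e4 : opT G t (op G τ s F) = fun w => opT G t (opT G s F) w +
      τ * F (sr s) * opT G t (cf G s) w := by
    funext w; rw [opT_op]
  have e5 : op G τ t (op G τ s F) (sr s) = F (sr t) / 2 := by
    rw [op, opT_sr_adj ha, e1, e3, c2]; ring
  rw [op, opT_op, e2, e4, opT_add_smul, ← opT_cf_of_adj hT ha, opT_opT c2, e5]
  ring

theorem op_braid (τ : ℝ) {s t : I} (ha : G.Adj s t) (F : (I → ℤ) → ℝ) :
    op G τ s (op G τ t (op G τ s F)) = op G τ t (op G τ s (op G τ t F)) := by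
  funext v
  rw [op_braid_aux hT τ ha, op_braid_aux hT τ ha.symm, opT_braid ha, opT_cf_of_adj hT ha,
    add_comm (sr t)]
  ring

end Operators


section Words

variable {I : Type*} [Fintype I] {G : SimpleGraph I}

variable (G) in
open scoped Classical in
/-- The inverse of `op τ i`, for `τ ≠ 0`. -/
noncomputable def opInv (τ : ℝ) (i : I) (K : (I → ℤ) → ℝ) : (I → ℤ) → ℝ := fun v =>
  if v = sr i then K (sr i) / τ
  else if IsRoot G v ∧ pr G v i < 0 then K (rf G i v) - K (sr i) * cf G i (rf G i v)
  else if IsRoot G v ∧ 0 < pr G v i then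
    2 * (K (rf G i v) - K (sr i) * cf G i (rf G i v)) - (K v - K (sr i) * cf G i v)
  else K v - K (sr i) * cf G i v

/-- Evaluation of a word in the degenerate operators. -/
noncomputable def tw (G : SimpleGraph I) (w : List I) (F : (I → ℤ) → ℝ) : (I → ℤ) → ℝ :=
  w.foldr (opT G) F

/-- Evaluation of a word in the operators with parameter `τ`. -/
noncomputable def opw (G : SimpleGraph I) (τ : ℝ) (w : List I) (F : (I → ℤ) → ℝ) :
    (I → ℤ) → ℝ := w.foldr (op G τ) F

theorem opw_zero (w : List I) (F : (I → ℤ) → ℝ) : opw G 0 w F = tw G w F := by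
  induction w with
  | nil => rfl
  | cons i w ih =>
    change op G 0 i (opw G 0 w F) = opT G i (tw G w F)
    rw [ih, op_zero]

theorem tw_append (w w' : List I) (F : (I → ℤ) → ℝ) :
    tw G (w ++ w') F = tw G w (tw G w' F) := by simp [tw]

theorem opT_nonneg {i : I} {F : (I → ℤ) → ℝ} (hF : ∀ v, 0 ≤ F v) (v : I → ℤ) :
    0 ≤ opT G i F v := by
  have h1 := hF v
  have h2 := hF (rf G i v)
  rw [opT]
  split_ifs <;> linarith

theorem tw_nonneg {w : List I} {F : (I → ℤ) → ℝ} (hF : ∀ v, 0 ≤ F v) (v : I → ℤ) :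
    0 ≤ tw G w F v := by
  induction w generalizing v with
  | nil => exact hF v
  | cons i w ih => exact opT_nonneg ih v

theorem tw_add_smul (w : List I) (F K : (I → ℤ) → ℝ) (c : ℝ) :
    tw G w (fun v => F v + c * K v) = fun v => tw G w F v + c * tw G w K v := by
  induction w with
  | nil => rfl
  | cons i w ih =>
    change opT G i (tw G w _) = fun v => opT G i (tw G w F) v + c * opT G i (tw G w K) v
    rw [ih]
    funext v
    exact opT_add_smul i _ _ c v

open scoped Classical in
/-- The indicator of a vector. -/
noncomputable def ind (u : I → ℤ) : (I → ℤ) → ℝ := Pi.single u 1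

theorem ind_self (u : I → ℤ) : ind u u = 1 := by simp [ind]

theorem ind_ne {u v : I → ℤ} (h : v ≠ u) : ind u v = 0 := by simp [ind, h]

theorem ind_nonneg (u v : I → ℤ) : 0 ≤ ind u v := by
  by_cases h : v = u
  · rw [h, ind_self]; norm_num
  · rw [ind_ne h]

theorem tw_ind_eq_zero {w : List I} {K : (I → ℤ) → ℝ} {u : I → ℤ} (hK : ∀ v, 0 ≤ K v)
    (hu : 0 < K u) (h : tw G w K = 0) : tw G w (ind u) = 0 := by
  funext v
  have h1 : 0 ≤ tw G w (fun v => K v + (-K u) * ind u v) v := by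
    refine tw_nonneg (fun v => ?_) v
    by_cases hv : v = u
    · rw [hv, ind_self]; linarith
    · rw [ind_ne hv]; linarith [hK v]
  rw [tw_add_smul, h] at h1
  have h2 := tw_nonneg (G := G) (w := w) (ind_nonneg u) v
  have h3 : (0 : ℝ) ≤ 0 + -K u * tw G w (ind u) v := h1
  change tw G w (ind u) v = 0
  nlinarith

theorem tw_snoc_ind_eq_zero {w : List I} {i : I} {u u' : I → ℤ}
    (hu : 0 < opT G i (ind u) u') (h : tw G (w ++ [i]) (ind u) = 0) : tw G w (ind u') = 0 := by
  rw [tw_append] at h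
  exact tw_ind_eq_zero (opT_nonneg (ind_nonneg u)) hu h

theorem continuous_opT {K : ℝ → (I → ℤ) → ℝ} (hK : ∀ v, Continuous fun τ => K τ v) (i : I)
    (v : I → ℤ) : Continuous fun τ => opT G i (K τ) v := by
  simp only [opT]
  split_ifs
  exacts [continuous_const, hK _, hK v, ((hK v).add (hK _)).div_const 2, hK v]

theorem continuous_opw (w : List I) (F : (I → ℤ) → ℝ) (v : I → ℤ) :
    Continuous fun τ => opw G τ w F v := by
  induction w generalizing v with
  | nil => exact continuous_const
  | cons i w ih =>
    change Continuous fun τ => opT G i (opw G τ w F) v + τ * opw G τ w F (sr i) * cf G i v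
    exact (continuous_opT ih i v).add ((continuous_id.mul (ih _)).mul continuous_const)

variable (hT : ∀ i j k, G.Adj i j → G.Adj j k → ¬ G.Adj i k)

include hT

theorem op_at_sr (τ : ℝ) (i : I) (F : (I → ℤ) → ℝ) : op G τ i F (sr i) = τ * F (sr i) := by
  rw [op, opT_sr, cf_self hT]; ring

theorem opInv_op {τ : ℝ} (hτ : τ ≠ 0) (i : I) (F : (I → ℤ) → ℝ) :
    opInv G τ i (op G τ i F) = F := by
  funext v
  rw [opInv, op_at_sr hT]
  simp only [op]
  by_cases h1 : v = sr i
  · rw [if_pos h1, h1]; field_simp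
  rw [if_neg h1]
  by_cases hv : IsRoot G v
  swap
  · rw [if_neg (fun h => hv h.1), if_neg (fun h => hv h.1), opT_nonroot hv]; ring
  rcases lt_trichotomy (pr G v i) 0 with h | h | h
  · rw [if_pos ⟨hv, h⟩, opT_pos (hv.up i h) (rf_ne_sr hv h i) (by rw [pr_rf_self]; omega), rf_rf]
    ring
  · rw [if_neg (by omega), if_neg (by omega), opT_zero h]; ring
  · rw [if_neg (by omega), if_pos ⟨hv, h⟩, opT_pos hv h1 h,
      opT_neg (hv.down h h1) (by rw [pr_rf_self]; omega), rf_rf]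
    ring

theorem op_opInv {τ : ℝ} (hτ : τ ≠ 0) (i : I) (K : (I → ℤ) → ℝ) :
    op G τ i (opInv G τ i K) = K := by
  funext v
  have e : τ * opInv G τ i K (sr i) = K (sr i) := by
    rw [opInv, if_pos rfl]; field_simp
  rw [op, e]
  by_cases h1 : v = sr i
  · rw [h1, opT_sr, cf_self hT]; ring
  by_cases hv : IsRoot G v
  swap
  · rw [opT_nonroot hv, opInv, if_neg h1, if_neg (fun h => hv h.1), if_neg (fun h => hv h.1)]
    ring
  rcases lt_trichotomy (pr G v i) 0 with h | h | h
  · have a := pr_rf_self G i v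
    rw [opT_neg hv h, opInv, opInv, if_neg h1, if_pos ⟨hv, h⟩, if_neg (rf_ne_sr hv h i),
      if_neg (by omega), if_pos ⟨hv.up i h, by omega⟩, rf_rf]
    ring
  · rw [opT_zero h, opInv, if_neg h1, if_neg (by omega), if_neg (by omega)]
    ring
  · have a := pr_rf_self G i v
    have hd := hv.down h h1
    have : rf G i v ≠ sr i := fun h' => by rw [h', pr_sr_self] at a; omega
    rw [opT_pos hv h1 h, opInv, if_neg this, if_pos ⟨hd, by omega⟩, rf_rf]
    ring

omit hT in
variable (I) in
/-- The group in which the words are evaluated. -/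
abbrev Target := ({τ : ℝ // τ ≠ 0} → Equiv.Perm ((I → ℤ) → ℝ)) × Multiplicative ℤ

/-- The image of an atom in the target group. -/
noncomputable def atom (i : I) : Target I :=
  (fun τ => ⟨op G τ.1 i, opInv G τ.1 i, opInv_op hT τ.2 i, op_opInv hT τ.2 i⟩,
    Multiplicative.ofAdd 1)

/-- The image of a word in the target group. -/
noncomputable def wp (w : List I) : Target I := (w.map (atom hT)).prod

theorem wp_append (w w' : List I) : wp hT (w ++ w') = wp hT w * wp hT w' := by
  simp [wp]

theorem wp_length (w : List I) : (wp hT w).2 = Multiplicative.ofAdd (w.length : ℤ) := by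
  induction w with
  | nil => rfl
  | cons i w ih =>
    change Multiplicative.ofAdd (1 : ℤ) * (wp hT w).2 = _
    rw [ih, ← ofAdd_add, List.length_cons]
    push_cast
    rw [add_comm]

theorem length_eq_of_wp_eq {w w' : List I} (h : wp hT w = wp hT w') : w.length = w'.length := by
  have := congrArg Prod.snd h
  rw [wp_length, wp_length] at this
  exact_mod_cast Multiplicative.ofAdd.injective this

theorem wp_fst (w : List I) (τ : {τ : ℝ // τ ≠ 0}) (F : (I → ℤ) → ℝ) :
    (wp hT w).1 τ F = opw G τ.1 w F := by
  induction w with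
  | nil => rfl
  | cons i w ih =>
    change op G τ.1 i ((wp hT w).1 τ F) = op G τ.1 i (opw G τ.1 w F)
    rw [ih]

theorem tw_eq_of_wp_eq {w w' : List I} (h : wp hT w = wp hT w') (F : (I → ℤ) → ℝ) :
    tw G w F = tw G w' F := by
  funext v
  rw [← opw_zero, ← opw_zero]
  have : (fun τ => opw G τ w F v) = fun τ => opw G τ w' F v := by
    refine Continuous.ext_on (dense_compl_singleton (0 : ℝ)) (continuous_opw w F v)
      (continuous_opw w' F v) fun τ hτ => ?_
    have h1 := wp_fst hT w ⟨τ, hτ⟩ F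
    have h2 := wp_fst hT w' ⟨τ, hτ⟩ F
    rw [h, h2] at h1
    exact (congrFun h1 v).symm
  exact congrFun this 0

theorem atom_comm {i j : I} (hne : i ≠ j) (ha : ¬ G.Adj i j) :
    atom hT i * atom hT j = atom hT j * atom hT i := by
  refine Prod.ext (funext fun τ => Equiv.ext fun F => ?_) rfl
  exact op_comm hT τ.1 hne ha F

theorem atom_braid {i j : I} (ha : G.Adj i j) :
    atom hT i * atom hT j * atom hT i = atom hT j * atom hT i * atom hT j := by
  refine Prod.ext (funext fun τ => Equiv.ext fun F => ?_) rfl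
  exact op_braid hT τ.1 ha F

theorem exists_snoc {w : List I} {i : I} (h : tw G w (ind (sr i)) = 0) :
    ∃ w', wp hT w = wp hT (w' ++ [i]) := by
  induction hn : w.length using Nat.strong_induction_on generalizing w i with
  | _ n ih =>
  rcases List.eq_nil_or_concat w with rfl | ⟨w1, j, rfl⟩
  · have := congrFun h (sr i)
    change ind (sr i) (sr i) = 0 at this
    rw [ind_self] at this
    norm_num at this
  rw [List.concat_eq_append] at hn h ⊢
  rw [List.length_append, List.length_singleton] at hn
  by_cases hij : i = j
  · exact ⟨w1, by rw [hij]⟩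
  have hsr : sr i ≠ sr j := fun h => hij (sr_injective h)
  by_cases ha : G.Adj i j
  · have h1 : tw G w1 (ind (sr i)) = 0 := tw_snoc_ind_eq_zero (by
      rw [opT_sr_adj ha, ind_self]; linarith [ind_nonneg (sr i) (sr i + sr j)]) h
    have h2 : tw G w1 (ind (sr j + sr i)) = 0 := tw_snoc_ind_eq_zero (by
      rw [pr_add_adj_comm ha.symm, ind_self]; norm_num) h
    obtain ⟨w2, e1⟩ := ih _ (by omega) h1 rfl
    have l1 := length_eq_of_wp_eq hT e1
    rw [List.length_append, List.length_singleton] at l1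
    rw [tw_eq_of_wp_eq hT e1] at h2
    have h3 : tw G w2 (ind (sr j)) = 0 := tw_snoc_ind_eq_zero (by
      rw [opT_sr_adj ha.symm, ind_self]; linarith [ind_nonneg (sr j + sr i) (sr j)]) h2
    obtain ⟨w3, e2⟩ := ih _ (by omega) h3 rfl
    refine ⟨w3 ++ [i, j], ?_⟩
    rw [wp_append, e1, wp_append, e2]
    have := atom_braid hT ha
    simp only [wp, List.map_append, List.prod_append, List.map_cons, List.map_nil, List.prod_cons,
      List.prod_nil, mul_one,
      mul_assoc] at this ⊢
    rw [this]
  · obtain ⟨w2, e⟩ := ih w1.length (by omega) (tw_snoc_ind_eq_zero (by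
      rw [opT_sr_nonadj hij ha, ind_self]; norm_num) h) rfl
    refine ⟨w2 ++ [j], ?_⟩
    rw [wp_append, e]
    have := atom_comm hT hij ha
    simp only [wp, List.map_append, List.prod_append, List.map_cons, List.map_nil, List.prod_cons,
      List.prod_nil, mul_one,
      mul_assoc] at this ⊢
    rw [this]

omit hT in
theorem tw_at_sr {L : List I} {j : I} (h : ∀ i ∈ L, j ≠ i ∧ ¬ G.Adj j i) (F : (I → ℤ) → ℝ) :
    tw G L F (sr j) = F (sr j) := by
  induction L with
  | nil => rfl
  | cons i L ih =>
    change opT G i (tw G L F) (sr j) = _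
    have := h i (by simp)
    rw [opT_sr_nonadj this.1 this.2, ih fun k hk => h k (by simp [hk])]

theorem exists_append_of_independent {w L : List I} (hL : L.Nodup)
    (hind : ∀ i ∈ L, ∀ j ∈ L, ¬ G.Adj i j) (h : ∀ i ∈ L, tw G w (ind (sr i)) = 0) :
    ∃ w', wp hT w = wp hT (w' ++ L) := by
  induction L with
  | nil => exact ⟨w, by simp⟩
  | cons j L ih =>
    obtain ⟨hj, hL⟩ := List.nodup_cons.1 hL
    obtain ⟨w1, e⟩ := ih hL (fun i hi k hk => hind i (by simp [hi]) k (by simp [hk]))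
      fun i hi => h i (by simp [hi])
    have h1 := h j (by simp)
    rw [tw_eq_of_wp_eq hT e, tw_append] at h1
    have h2 : tw G w1 (ind (sr j)) = 0 := by
      refine tw_ind_eq_zero (tw_nonneg (ind_nonneg _)) ?_ h1
      rw [tw_at_sr (fun i hi => ⟨?_, hind j (by simp) i (by simp [hi])⟩), ind_self]
      · norm_num
      · rintro rfl; exact hj hi
    obtain ⟨w2, e2⟩ := exists_snoc hT h2
    refine ⟨w2, ?_⟩
    rw [e, wp_append, e2, wp_append, wp_append, ← List.singleton_append (l := L), wp_append,
      mul_assoc]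

end Words


section Steps

variable {I : Type*} [Fintype I] {G : SimpleGraph I}

theorem exists_of_opT_ne_zero {j : I} {F : (I → ℤ) → ℝ} {v : I → ℤ} (h : opT G j F v ≠ 0) :
    ∃ u, F u ≠ 0 ∧ (IsRoot G u → IsRoot G v) ∧ (u = v ∧ pr G v j ≤ 0 ∨ u = rf G j v ∨
      ¬ IsRoot G v ∧ u = v) := by
  by_cases hv : IsRoot G v
  swap
  · rw [opT_nonroot hv] at h
    exact ⟨v, h, id, .inr (.inr ⟨hv, rfl⟩)⟩
  by_cases h1 : v = sr j
  · rw [h1, opT_sr] at h; exact absurd rfl h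
  rcases lt_or_ge 0 (pr G v j) with h2 | h2
  · rw [opT_pos hv h1 h2] at h
    exact ⟨_, h, fun _ => hv, .inr (.inl rfl)⟩
  · rw [opT_le_zero hv h2] at h
    by_cases h3 : F v = 0
    · refine ⟨_, fun h4 => h ?_, fun _ => hv, .inr (.inl rfl)⟩
      rw [h3, h4]; norm_num
    · exact ⟨_, h3, fun _ => hv, .inl ⟨rfl, h2⟩⟩

/-- Backward step: the support of the image under an independent list of atoms. -/
theorem exists_of_tw_ne_zero {L : List I} (hL : L.Nodup)
    (hind : ∀ i ∈ L, ∀ j ∈ L, ¬ G.Adj i j) {F : (I → ℤ) → ℝ} (hF : ∀ u, F u ≠ 0 → IsRoot G u)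
    {v : I → ℤ} (h : tw G L F v ≠ 0) :
    ∃ u, F u ≠ 0 ∧ IsRoot G v ∧ (∀ j ∉ L, u j = v j) ∧ ∀ j ∈ L, u j + pr G v j ≤ v j := by
  suffices ∃ u, F u ≠ 0 ∧ (IsRoot G u → IsRoot G v) ∧ (∀ j ∉ L, u j = v j) ∧
      (IsRoot G v → ∀ j ∈ L, u j + pr G v j ≤ v j) by
    obtain ⟨u, h1, h2, h3, h4⟩ := this
    exact ⟨u, h1, h2 (hF u h1), h3, h4 (h2 (hF u h1))⟩
  induction L generalizing v with
  | nil => exact ⟨v, h, id, fun _ _ => rfl, by simp⟩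
  | cons j L ih =>
    obtain ⟨hj, hL⟩ := List.nodup_cons.1 hL
    obtain ⟨u1, h1, h2, h3⟩ := exists_of_opT_ne_zero h
    obtain ⟨u, g1, g2, g3, g4⟩ := ih hL (fun i hi k hk => hind i (by simp [hi]) k (by simp [hk])) h1
    refine ⟨u, g1, fun hu => h2 (g2 hu), fun i hi => ?_, fun hv i hi => ?_⟩
    · rw [List.mem_cons, not_or] at hi
      rw [g3 i hi.2]
      rcases h3 with ⟨rfl, -⟩ | rfl | ⟨-, rfl⟩
      · rfl
      · exact rf_apply_ne G hi.1 v
      · rfl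
    · rcases h3 with ⟨rfl, h3⟩ | rfl | ⟨h3, -⟩
      · rcases List.mem_cons.1 hi with rfl | hi
        · rw [g3 _ hj]; omega
        · exact g4 hv i hi
      · rcases List.mem_cons.1 hi with rfl | hi
        · rw [g3 _ hj, rf_apply_self]; omega
        · have hne : j ≠ i := by rintro rfl; exact hj hi
          have hna := hind j (by simp) i (by simp [hi])
          have hr : IsRoot G (rf G j v) := by
            by_cases hs : v = sr j
            · have : tw G (j :: L) F v = 0 := by rw [hs]; exact opT_sr
              exact absurd this h
            · exact hv.rf hs
          have := g4 hr i hi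
          rwa [pr_rf_nonadj G hne hna, rf_apply_ne G hne.symm] at this
      · exact absurd hv h3

/-- Forward step: positivity of the image under an independent list of atoms. -/
theorem tw_pos {L : List I} (hL : L.Nodup) (hind : ∀ i ∈ L, ∀ j ∈ L, ¬ G.Adj i j)
    {F : (I → ℤ) → ℝ} (hF : ∀ u, 0 ≤ F u) {u v : I → ℤ} (hv : IsRoot G v)
    (hne : ∀ j ∈ L, v ≠ sr j) (hu : 0 < F u) (hoff : ∀ j ∉ L, u j = v j)
    (hon : ∀ j ∈ L, u j = v j ∧ pr G v j ≤ 0 ∨ u j = v j - pr G v j) : 0 < tw G L F v := by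
  induction L generalizing v with
  | nil =>
    have : u = v := funext fun j => hoff j (by simp)
    exact this ▸ hu
  | cons j L ih =>
    obtain ⟨hj, hL⟩ := List.nodup_cons.1 hL
    have hind' : ∀ i ∈ L, ∀ k ∈ L, ¬ G.Adj i k :=
      fun i hi k hk => hind i (by simp [hi]) k (by simp [hk])
    have hnn : ∀ w, 0 ≤ tw G L F w := tw_nonneg hF
    change 0 < opT G j (tw G L F) v
    rcases hon j (by simp) with ⟨h1, h2⟩ | h1
    · have := ih hL hind' hv (fun i hi => hne i (by simp [hi])) (fun i hi => by
        by_cases hij : i = j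
        · rw [hij, h1]
        · exact hoff i (by simp [hij, hi])) fun i hi => hon i (by simp [hi])
      rw [opT_le_zero hv h2]
      linarith [hnn (rf G j v)]
    · have := ih hL hind' (hv.rf (hne j (by simp))) (fun i hi he => hne i (by simp [hi]) (by
          rw [← rf_rf G j v, he, rf_sr_nonadj (by rintro rfl; exact hj hi)
            (hind i (by simp [hi]) j (by simp))])) (fun i hi => by
        by_cases hij : i = j
        · rw [hij, h1, rf_apply_self]
        · rw [rf_apply_ne G hij]
          exact hoff i (by simp [hij, hi])) fun i hi => by
        have hji : j ≠ i := by rintro rfl; exact hj hi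
        rw [pr_rf_nonadj G hji (hind j (by simp) i (by simp [hi])), rf_apply_ne G hji.symm]
        exact hon i (by simp [hi])
      rcases lt_or_ge 0 (pr G v j) with h2 | h2
      · rwa [opT_pos hv (hne j (by simp)) h2]
      · rw [opT_le_zero hv h2]
        linarith [hnn v]

end Steps


/-- The colour of the `k`-th letter of an alternating word. -/
def col {B : Type*} (s t : B) (k : ℕ) : B := if Even k then s else t

/-- The alternating word with `k` letters ending in `t`. -/
def aw {B : Type*} (s t : B) : ℕ → List B
  | 0 => []
  | k + 1 => col s t (k + 1) :: aw s t k

theorem col_add_two {B : Type*} (s t : B) (k : ℕ) : col s t (k + 2) = col s t k := by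
  simp [col, Nat.even_add]

theorem col_cases {B : Type*} (s t : B) (k : ℕ) :
    (col s t k = s ∧ col s t (k + 1) = t) ∨ (col s t k = t ∧ col s t (k + 1) = s) := by
  by_cases h : Even k <;> simp [col, h, Nat.even_add_one]

section Dead

variable {I B : Type*} [Fintype I] {G : SimpleGraph I} {cl : I → B} {μ : I → ℝ}

open scoped Classical in
/-- The weighted sum of the coordinates of colour `c`. -/
noncomputable def wsum (cl : I → B) (μ : I → ℝ) (c : B) (v : I → ℤ) : ℝ :=
  ∑ i, if cl i = c then μ i * v i else 0

theorem wsum_congr {c : B} {v u : I → ℤ} (h : ∀ i, cl i = c → v i = u i) :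
    wsum cl μ c v = wsum cl μ c u := by
  classical
  refine Finset.sum_congr rfl fun i _ => ?_
  split_ifs with hi
  · rw [h i hi]
  · rfl

theorem wsum_nonneg {c : B} (hμ : ∀ i, cl i = c → 0 < μ i) {v : I → ℤ} (hv : ∀ i, 0 ≤ v i) :
    0 ≤ wsum cl μ c v := by
  classical
  refine Finset.sum_nonneg fun i _ => ?_
  split_ifs with hi
  · exact mul_nonneg (hμ i hi).le (by exact_mod_cast hv i)
  · exact le_rfl

theorem eq_zero_of_wsum {c : B} (hμ : ∀ i, cl i = c → 0 < μ i) {v : I → ℤ} (hv : ∀ i, 0 ≤ v i)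
    (h : wsum cl μ c v ≤ 0) (i : I) (hi : cl i = c) : v i = 0 := by
  classical
  have h0 : wsum cl μ c v = 0 := le_antisymm h (wsum_nonneg hμ hv)
  have h1 := (Finset.sum_eq_zero_iff_of_nonneg (fun i _ => by
    split_ifs with hi
    · exact mul_nonneg (hμ i hi).le (by exact_mod_cast hv i)
    · exact le_rfl)).1 h0 i (Finset.mem_univ i)
  rw [if_pos hi] at h1
  rcases mul_eq_zero.1 h1 with h2 | h2
  · exact absurd h2 (hμ i hi).ne'
  · exact_mod_cast h2

open scoped Classical in
theorem wsum_step {c c' : B} (hc : ∀ i j, G.Adj i j → cl i ≠ cl j) {κ : ℝ}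
    (hpos : ∀ i, cl i = c → 0 < μ i)
    (hμ : ∀ j, cl j = c' → ∑ i, (if G.Adj j i ∧ cl i = c then μ i else 0) = κ * μ j)
    {u v : I → ℤ} (hv : ∀ i, cl i ≠ c → cl i ≠ c' → v i = 0)
    (h : ∀ j, cl j = c → u j + pr G v j ≤ v j) :
    wsum cl μ c v + wsum cl μ c u ≤ κ * wsum cl μ c' v := by
  have e : κ * wsum cl μ c' v =
      ∑ j, if cl j = c then μ j * ∑ i, (if G.Adj j i then (v i : ℝ) else 0) else 0 := by
    have e1 : ∀ j, (if cl j = c then μ j * ∑ i, (if G.Adj j i then (v i : ℝ) else 0) else 0) =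
        ∑ i, (v i : ℝ) * if G.Adj i j ∧ cl j = c then μ j else 0 := by
      intro j
      split_ifs with hj
      · rw [Finset.mul_sum]
        refine Finset.sum_congr rfl fun i _ => ?_
        by_cases ha : G.Adj j i
        · rw [if_pos ha, if_pos ⟨ha.symm, hj⟩, mul_comm]
        · rw [if_neg ha, if_neg (fun h => ha h.1.symm)]; ring
      · symm
        exact Finset.sum_eq_zero fun i _ => by rw [if_neg (fun h => hj h.2), mul_zero]
    simp only [e1]
    rw [Finset.sum_comm, wsum, Finset.mul_sum]
    refine Finset.sum_congr rfl fun i _ => ?_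
    rw [← Finset.mul_sum]
    by_cases h1 : cl i = c'
    · rw [if_pos h1, hμ i h1]; ring
    rw [if_neg h1, mul_zero]
    by_cases h2 : cl i = c
    · rw [Finset.sum_eq_zero, mul_zero]
      intro j _
      rw [if_neg]
      rintro ⟨h3, h4⟩
      exact hc i j h3 (h2.trans h4.symm)
    · rw [hv i h2 h1]; simp
  rw [e, wsum, wsum, ← Finset.sum_add_distrib]
  refine Finset.sum_le_sum fun j _ => ?_
  split_ifs with hj
  · have h1 := h j hj
    have h2 : ((u j + pr G v j : ℤ) : ℝ) ≤ v j := by exact_mod_cast h1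
    rw [pr] at h2
    push_cast at h2
    rw [← mul_add]
    refine mul_le_mul_of_nonneg_left ?_ (hpos j hj).le
    linarith
  · simp

variable {L : B → List I} (hLn : ∀ c, (L c).Nodup) (hLm : ∀ c i, i ∈ L c ↔ cl i = c)
  (hc : ∀ i j, G.Adj i j → cl i ≠ cl j)

include hLn hLm hc

open scoped Classical in
theorem dead {s t : B} (hst : s ≠ t) {θ : ℝ} {m : ℕ} (hm : 2 ≤ m)
    (hθ : θ = Real.pi / m) (hpos : ∀ i, cl i = s ∨ cl i = t → 0 < μ i)
    (hμs : ∀ j, cl j = t → ∑ i, (if G.Adj j i ∧ cl i = s then μ i else 0) = 2 * Real.cos θ * μ j)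
    (hμt : ∀ j, cl j = s → ∑ i, (if G.Adj j i ∧ cl i = t then μ i else 0) = 2 * Real.cos θ * μ j)
    {i : I} (hi : cl i = s ∨ cl i = t) :
    tw G ((aw s t m).flatMap L) (ind (sr i)) = 0 := by
  have hind : ∀ c, ∀ i ∈ L c, ∀ j ∈ L c, ¬ G.Adj i j := fun c i hi j hj ha =>
    hc i j ha (((hLm c i).1 hi).trans ((hLm c j).1 hj).symm)
  have hm0 : (0 : ℝ) < m := by positivity
  have hsin : ∀ k : ℕ, k ≤ m → 0 ≤ Real.sin (k * θ) := by
    intro k hk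
    refine Real.sin_nonneg_of_nonneg_of_le_pi (by rw [hθ]; positivity) ?_
    rw [hθ, mul_div_assoc', div_le_iff₀ hm0, mul_comm]
    exact mul_le_mul_of_nonneg_left (by exact_mod_cast hk) Real.pi_pos.le
  have hposc : ∀ k, ∀ i, cl i = col s t k → 0 < μ i := fun k i h => hpos i (by
    rcases col_cases s t k with h1 | h1
    · left; rw [h, h1.1]
    · right; rw [h, h1.1])
  have hμc : ∀ k, ∀ j, cl j = col s t k →
      ∑ i, (if G.Adj j i ∧ cl i = col s t (k + 1) then μ i else 0) = 2 * Real.cos θ * μ j := by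
    intro k j hj
    rcases col_cases s t k with h1 | h1
    · rw [h1.2]; exact hμt j (hj.trans h1.1)
    · rw [h1.2]; exact hμs j (hj.trans h1.1)
  set F : ℕ → (I → ℤ) → ℝ := fun k => tw G ((aw s t k).flatMap L) (ind (sr i)) with hF
  have hFs : ∀ k, F (k + 1) = tw G (L (col s t (k + 1))) (F k) := by
    intro k
    simp only [hF, aw, List.flatMap_cons, tw_append]
  have step : ∀ k v, (∀ u, F k u ≠ 0 → IsRoot G u ∧ ∀ i, cl i ≠ s → cl i ≠ t → u i = 0) →
      F (k + 1) v ≠ 0 → ∃ u, F k u ≠ 0 ∧ IsRoot G v ∧ (∀ i, cl i ≠ s → cl i ≠ t → v i = 0) ∧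
        wsum cl μ (col s t k) u = wsum cl μ (col s t k) v ∧
        wsum cl μ (col s t (k + 1)) v + wsum cl μ (col s t (k + 1)) u ≤
          2 * Real.cos θ * wsum cl μ (col s t k) v := by
    intro k v hk hv
    rw [hFs] at hv
    obtain ⟨u, h1, h2, h3, h4⟩ := exists_of_tw_ne_zero (hLn _) (hind _) (fun u hu => (hk u hu).1) hv
    have hne : col s t k ≠ col s t (k + 1) := by
      rcases col_cases s t k with h | h <;> rw [h.1, h.2]
      · exact hst
      · exact fun h => hst h.symm
    have hsup : ∀ i, cl i ≠ s → cl i ≠ t → v i = 0 := by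
      intro i h5 h6
      rw [← h3 i, (hk u h1).2 i h5 h6]
      rw [hLm]
      rcases col_cases s t k with h | h <;> rw [h.2] <;> assumption
    refine ⟨u, h1, h2, hsup, wsum_congr fun i hi => h3 i (by rwa [hLm, hi]),
      wsum_step hc (hposc _) (hμc k) ?_ fun j hj => h4 j ((hLm _ _).2 hj)⟩
    intro i h5 h6
    rcases col_cases s t k with h | h
    · exact hsup i (h.1 ▸ h6) (h.2 ▸ h5)
    · exact hsup i (h.2 ▸ h5) (h.1 ▸ h6)
  have inv : ∀ k < m, ∀ v, F k v ≠ 0 → (IsRoot G v ∧ ∀ i, cl i ≠ s → cl i ≠ t → v i = 0) ∧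
      wsum cl μ (col s t k) v * Real.sin (k * θ) ≤
        wsum cl μ (col s t (k + 1)) v * Real.sin ((k + 1 : ℕ) * θ) := by
    intro k
    induction k with
    | zero =>
      intro h0 v hv
      have hv : v = sr i := by
        by_contra h; exact hv (ind_ne h)
      subst hv
      refine ⟨⟨.simple i, fun j h1 h2 => sr_ne ?_⟩, ?_⟩
      · rintro rfl
        exact hi.elim h1 h2
      · rw [Nat.cast_zero, zero_mul, Real.sin_zero, mul_zero]
        exact mul_nonneg (wsum_nonneg (hposc _) (IsRoot.simple (G := G) i).nonneg)
          (hsin _ (by omega))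
    | succ k ih =>
      intro hk v hv
      obtain ⟨u, h1, h2, h3, h4, h5⟩ := step k v (fun u hu => (ih (by omega) u hu).1) hv
      refine ⟨⟨h2, h3⟩, ?_⟩
      have h6 := (ih (by omega) u h1).2
      have h7 := hsin (k + 1) (by omega)
      rw [col_add_two]
      have e : Real.sin ((k + 1 + 1 : ℕ) * θ) =
          2 * Real.cos θ * Real.sin ((k + 1 : ℕ) * θ) - Real.sin (k * θ) := by
        have a1 : ((k + 1 + 1 : ℕ) : ℝ) * θ = (k + 1 : ℕ) * θ + θ := by push_cast; ring
        have a2 : (k : ℝ) * θ = (k + 1 : ℕ) * θ - θ := by push_cast; ring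
        rw [a1, a2, Real.sin_add, Real.sin_sub]; ring
      rw [e]
      rw [h4] at h6
      nlinarith [mul_le_mul_of_nonneg_right h5 h7]
  funext v
  by_contra hv
  obtain ⟨k, rfl⟩ : ∃ k, m = k + 1 := ⟨m - 1, by omega⟩
  obtain ⟨u, h1, h2, h3, h4, h5⟩ := step k v (fun u hu => (inv k (by omega) u hu).1) hv
  obtain ⟨⟨hur, -⟩, h6⟩ := inv k (by omega) u h1
  have hpi : ((k + 1 : ℕ) : ℝ) * θ = Real.pi := by rw [hθ]; field_simp
  have hpos' : 0 < Real.sin (k * θ) := by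
    have hθ0 : 0 < θ := by rw [hθ]; positivity
    have hk : (0 : ℝ) < k := by exact_mod_cast (by omega : 0 < k)
    refine Real.sin_pos_of_pos_of_lt_pi (by positivity) ?_
    rw [← hpi]
    push_cast
    linarith
  rw [hpi, Real.sin_pi, mul_zero, h4] at h6
  have hY : wsum cl μ (col s t k) v ≤ 0 := by
    by_contra h
    nlinarith
  have hY0 : wsum cl μ (col s t k) v = 0 := le_antisymm hY (wsum_nonneg (hposc _) h2.nonneg)
  have hY' : wsum cl μ (col s t (k + 1)) v ≤ 0 := by
    rw [hY0, mul_zero] at h5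
    linarith [wsum_nonneg (hposc (k + 1)) hur.nonneg]
  refine h2.ne_zero (funext fun j => ?_)
  have z1 := eq_zero_of_wsum (hposc _) h2.nonneg hY j
  have z2 := eq_zero_of_wsum (hposc _) h2.nonneg hY' j
  by_cases hjs : cl j = s
  · rcases col_cases s t k with h | h
    · exact z1 (hjs.trans h.1.symm)
    · exact z2 (hjs.trans h.2.symm)
  by_cases hjt : cl j = t
  · rcases col_cases s t k with h | h
    · exact z2 (hjt.trans h.2.symm)
    · exact z1 (hjt.trans h.1.symm)
  exact h3 j hjs hjt

end Dead


section Alive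

variable {I B : Type*} [Fintype I] {G : SimpleGraph I} {N : ℤ} {P : ℤ → I}

/-- The sum of the simple roots in an interval of a path. -/
noncomputable def iv (P : ℤ → I) (l r : ℤ) : I → ℤ := ∑ x ∈ Finset.Icc l r, sr (P x)

omit [Fintype I] in
theorem iv_self (l : ℤ) : iv P l l = sr (P l) := by simp [iv]

omit [Fintype I] in
theorem iv_succ {l r : ℤ} (h : l ≤ r) : iv P l (r + 1) = iv P l r + sr (P (r + 1)) := by
  have : Finset.Icc l (r + 1) = insert (r + 1) (Finset.Icc l r) := by
    ext x; simp only [Finset.mem_Icc, Finset.mem_insert]; omega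
  rw [iv, this, Finset.sum_insert (by simp), add_comm]
  rfl

omit [Fintype I] in
theorem iv_off {l r : ℤ} {j : I} (h : ∀ x, l ≤ x → x ≤ r → j ≠ P x) : iv P l r j = 0 := by
  rw [iv, Finset.sum_apply]
  refine Finset.sum_eq_zero fun x hx => ?_
  rw [Finset.mem_Icc] at hx
  exact sr_ne (h x hx.1 hx.2)

theorem iv_nonneg (l r : ℤ) (j : I) : 0 ≤ iv P l r j := by
  rw [iv, Finset.sum_apply]
  refine Finset.sum_nonneg fun x _ => (IsRoot.simple (G := (⊥ : SimpleGraph I)) (P x)).nonneg j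

theorem pr_nonpos_of_apply_eq_zero {v : I → ℤ} (hv : ∀ i, 0 ≤ v i) {j : I} (h : v j = 0) :
    pr G v j ≤ 0 := by
  classical
  rw [pr, h]
  have : 0 ≤ ∑ k, if G.Adj j k then v k else 0 := Finset.sum_nonneg fun k _ => by
    split_ifs
    · exact hv k
    · exact le_rfl
  omega

theorem pr_sum {ι : Type*} (S : Finset ι) (f : ι → I → ℤ) (j : I) :
    pr G (∑ x ∈ S, f x) j = ∑ x ∈ S, pr G (f x) j := by
  classical
  induction S using Finset.induction_on with
  | empty => simp [pr_zero]
  | insert a S ha ih => rw [Finset.sum_insert ha, Finset.sum_insert ha, pr_add, ih]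

section Path

variable (hinj : ∀ x y, 0 ≤ x → x < N → 0 ≤ y → y < N → P x = P y → x = y)

include hinj

omit [Fintype I] in
theorem iv_apply {l r y : ℤ} (hl : 0 ≤ l) (hr : r < N) (hy : 0 ≤ y) (hy' : y < N) :
    iv P l r (P y) = if l ≤ y ∧ y ≤ r then 1 else 0 := by
  have : ∀ x ∈ Finset.Icc l r, sr (P x) (P y) = if x = y then 1 else 0 := by
    intro x hx
    rw [Finset.mem_Icc] at hx
    split_ifs with h
    · rw [h, sr_self]
    · exact sr_ne fun h' => h (hinj _ _ (by omega) (by omega) hy hy' h'.symm)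
  rw [iv, Finset.sum_apply, Finset.sum_congr rfl this, Finset.sum_ite_eq']
  simp

variable (hadj : ∀ x y, 0 ≤ x → x < N → 0 ≤ y → y < N →
  (G.Adj (P x) (P y) ↔ y = x + 1 ∨ x = y + 1))

include hadj

theorem pr_iv {l r y : ℤ} (hl : 0 ≤ l) (hr : r < N) (hy : 0 ≤ y) (hy' : y < N) :
    pr G (iv P l r) (P y) = 2 * (if l ≤ y ∧ y ≤ r then 1 else 0) -
      (if l ≤ y - 1 ∧ y - 1 ≤ r then 1 else 0) - (if l ≤ y + 1 ∧ y + 1 ≤ r then 1 else 0) := by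
  have : ∀ x ∈ Finset.Icc l r, pr G (sr (P x)) (P y) =
      2 * (if x = y then 1 else 0) - (if x = y - 1 then 1 else 0) -
        (if x = y + 1 then 1 else 0) := by
    intro x hx
    rw [Finset.mem_Icc] at hx
    by_cases h : x = y
    · rw [h, pr_sr_self, if_pos rfl, if_neg (by omega), if_neg (by omega)]; rfl
    have ha := hadj x y (by omega) (by omega) hy hy'
    rw [if_neg h]
    by_cases h1 : y = x + 1 ∨ x = y + 1
    · rw [pr_sr_adj G (ha.2 h1)]
      split_ifs <;> omega
    · rw [pr_sr_nonadj G (fun h' => h (hinj _ _ (by omega) (by omega) hy hy' h'))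
        (fun h' => h1 (ha.1 h'))]
      split_ifs <;> omega
  rw [iv, pr_sum, Finset.sum_congr rfl this, Finset.sum_sub_distrib, Finset.sum_sub_distrib,
    ← Finset.mul_sum, Finset.sum_ite_eq', Finset.sum_ite_eq', Finset.sum_ite_eq']
  simp only [Finset.mem_Icc]

theorem isRoot_iv {l : ℤ} (hl : 0 ≤ l) (n : ℕ) (hr : l + n < N) : IsRoot G (iv P l (l + n)) := by
  induction n with
  | zero => simpa [iv_self] using IsRoot.simple _
  | succ n ih =>
    have h1 := ih (by push_cast at hr; omega)
    have h2 : pr G (iv P l (l + n)) (P (l + n + 1)) = -1 := by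
      push_cast at hr
      rw [pr_iv hinj hadj hl (by omega) (by omega) (by omega), if_neg (by omega), if_pos (by omega),
        if_neg (by omega)]
      norm_num
    have h3 := h1.up _ (by omega : pr G (iv P l (l + n)) (P (l + n + 1)) < 0)
    rw [rf, h2] at h3
    push_cast
    rw [← add_assoc, iv_succ (by omega)]
    simpa using h3

theorem isRoot_iv_of_le {l r : ℤ} (hl : 0 ≤ l) (hlr : l ≤ r) (hr : r < N) :
    IsRoot G (iv P l r) := by
  obtain ⟨n, rfl⟩ := Int.le.dest hlr
  exact isRoot_iv hinj hadj hl n hr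

theorem alive_step {L : List I} (hLn : L.Nodup) (hind : ∀ i ∈ L, ∀ j ∈ L, ¬ G.Adj i j)
    {a : ℤ} (ha : ∀ x, 0 ≤ x → x < N → (P x ∈ L ↔ (x - a) % 2 = 0))
    {F : (I → ℤ) → ℝ} (hF : ∀ u, 0 ≤ F u) {l r l' r' : ℤ} (hl : 0 ≤ l) (hl' : 0 ≤ l')
    (hlr' : l' ≤ r') (hr : r < N) (hr' : r' < N)
    (cl : l' = l ∧ (l - a) % 2 ≠ 0 ∨ l' = l - 1 ∧ (l' - a) % 2 = 0 ∨ l' = l + 1 ∧ (l - a) % 2 = 0)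
    (cr : r' = r ∧ (r - a) % 2 ≠ 0 ∨ r' = r + 1 ∧ (r' - a) % 2 = 0 ∨ r' = r - 1 ∧ (r - a) % 2 = 0)
    (hne : l' = r' → (l' - a) % 2 ≠ 0) (h : 0 < F (iv P l r)) :
    0 < tw G L F (iv P l' r') := by
  have hz : ∀ j, (∀ x, 0 ≤ x → x < N → j ≠ P x) → iv P l r j = 0 ∧ iv P l' r' j = 0 :=
    fun j hj => ⟨iv_off fun x h1 h2 => hj x (by omega) (by omega),
      iv_off fun x h1 h2 => hj x (by omega) (by omega)⟩
  refine tw_pos hLn hind hF (isRoot_iv_of_le hinj hadj hl' hlr' hr') ?_ h ?_ ?_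
  · intro j hj he
    have e1 := iv_apply hinj hl' hr' hl' (y := l') (by omega)
    have e2 := iv_apply hinj hl' hr' (y := r') (by omega) (by omega)
    rw [he, if_pos (by omega)] at e1 e2
    have f : ∀ x, sr j (P x) = 1 → P x = j := by
      intro x hx
      by_contra h
      rw [sr_ne h] at hx
      omega
    have f1 := f _ e1
    have f2 := f _ e2
    have := hinj l' r' (by omega) (by omega) (by omega) (by omega) (f1.trans f2.symm)
    exact hne this ((ha l' (by omega) (by omega)).1 (f1 ▸ hj))
  · intro j hj
    by_cases hx : ∃ x, 0 ≤ x ∧ x < N ∧ j = P x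
    · obtain ⟨x, h1, h2, rfl⟩ := hx
      rw [ha x h1 h2] at hj
      rw [iv_apply hinj hl hr h1 h2, iv_apply hinj hl' hr' h1 h2]
      split_ifs <;> omega
    · push Not at hx
      rw [(hz j hx).1, (hz j hx).2]
  · intro j hj
    by_cases hx : ∃ x, 0 ≤ x ∧ x < N ∧ j = P x
    · obtain ⟨x, h1, h2, rfl⟩ := hx
      rw [ha x h1 h2] at hj
      rw [iv_apply hinj hl hr h1 h2, iv_apply hinj hl' hr' h1 h2, pr_iv hinj hadj hl' hr' h1 h2]
      split_ifs <;> omega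
    · push Not at hx
      obtain ⟨h1, h2⟩ := hz j hx
      exact .inl ⟨by rw [h1, h2], pr_nonpos_of_apply_eq_zero (iv_nonneg l' r') h2⟩

theorem alive_of_path {L : B → List I} (hLn : ∀ c, (L c).Nodup)
    (hind : ∀ c, ∀ i ∈ L c, ∀ j ∈ L c, ¬ G.Adj i j) {s t : B} {i l₀ r₀ : ℤ} {k : ℕ}
    (hcol : ∀ (n : ℕ) x, 0 ≤ x → x < N → (P x ∈ L (col s t n) ↔ (x - (i + n)) % 2 = 0))
    (hl : 0 ≤ l₀) (hr : r₀ < N) (hlr : r₀ - l₀ = k - 1) (hli : l₀ ≤ i) (hir : i ≤ r₀) :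
    0 < tw G ((aw s t k).flatMap L) (ind (sr (P i))) (sr (P (l₀ + r₀ - i))) := by
  have key : ∀ n : ℕ, n ≤ k → ∀ l r : ℤ,
      l = (if (n : ℤ) ≤ i - l₀ then i - n else 2 * l₀ - i + n - 1) →
      r = (if (n : ℤ) ≤ r₀ - i then i + n else 2 * r₀ - i - n + 1) →
      0 < tw G ((aw s t n).flatMap L) (ind (sr (P i))) (iv P l r) := by
    intro n
    induction n with
    | zero =>
      intro _ l r hl' hr'
      rw [if_pos (by push_cast; omega)] at hl' hr'
      have e1 : l = i := by push_cast at hl'; omega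
      have e2 : r = i := by push_cast at hr'; omega
      rw [e1, e2, iv_self]
      change 0 < ind (sr (P i)) (sr (P i))
      rw [ind_self]
      norm_num
    | succ n ih =>
      intro hn l' r' hl' hr'
      have := ih (by omega) _ _ rfl rfl
      rw [aw, List.flatMap_cons, tw_append]
      push_cast at hl' hr'
      refine alive_step hinj hadj (hLn _) (hind _) (hcol (n + 1)) (tw_nonneg (ind_nonneg _))
        ?_ ?_ ?_ ?_ ?_ ?_ ?_ ?_ this
      all_goals
        push_cast
        clear this ih
        split_ifs at hl' hr' ⊢ <;> omega
  have := key k le_rfl (l₀ + r₀ - i) (l₀ + r₀ - i) (by split_ifs <;> omega) (by split_ifs <;> omega)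
  rwa [iv_self] at this

end Path

end Alive


section Fold

variable {B : Type*} {m : Sym2 B → ℕ}

/-- The tuples of path positions. -/
abbrev Pos (m : Sym2 B → ℕ) : Type _ := (p : Sym2 B) → Fin (m p - 1)

noncomputable instance [Finite B] : Fintype (Pos m) := Fintype.ofFinite _

noncomputable instance [Finite B] : Fintype (B × Pos m) := Fintype.ofFinite _

/-- A triangle-free simply laced graph folding onto the Coxeter graph with labels `m`. -/
def foldGraph (m : Sym2 B → ℕ) : SimpleGraph (B × Pos m) where
  Adj i j := i.1 ≠ j.1 ∧ (∀ q ≠ s(i.1, j.1), i.2 q = j.2 q) ∧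
    ((i.2 s(i.1, j.1) : ℕ) = j.2 s(i.1, j.1) + 1 ∨ (j.2 s(i.1, j.1) : ℕ) = i.2 s(i.1, j.1) + 1)
  symm := ⟨by
    rintro i j ⟨h1, h2, h3⟩
    rw [Sym2.eq_swap] at h2 h3
    exact ⟨h1.symm, fun q hq => (h2 q hq).symm, h3.symm⟩⟩
  loopless := ⟨fun i h => h.1 rfl⟩

theorem foldGraph_triangleFree (i j k : B × Pos m) (hij : (foldGraph m).Adj i j)
    (hjk : (foldGraph m).Adj j k) : ¬ (foldGraph m).Adj i k := by
  intro hik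
  have h1 : s(i.1, j.1) ≠ s(j.1, k.1) := fun h => by
    rw [Sym2.eq_swap, Sym2.congr_right] at h
    exact hik.1 h
  have h2 : s(i.1, j.1) ≠ s(i.1, k.1) := fun h => by
    rw [Sym2.congr_right] at h
    exact hjk.1 h
  have h3 := hij.2.2
  rw [hik.2.1 _ h2, hjk.2.1 _ h1] at h3
  omega

variable [Finite B]

/-- The vertices of colour `c`. -/
noncomputable def fiber (m : Sym2 B → ℕ) (c : B) : List (B × Pos m) :=
  (Finset.univ : Finset (Pos m)).toList.map fun ω => (c, ω)

theorem mem_fiber {c : B} {i : B × Pos m} : i ∈ fiber m c ↔ i.1 = c := by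
  simp only [fiber, List.mem_map, Finset.mem_toList, Finset.mem_univ, true_and]
  constructor
  · rintro ⟨ω, rfl⟩; rfl
  · rintro rfl; exact ⟨i.2, rfl⟩

theorem nodup_fiber (c : B) : (fiber m c).Nodup :=
  (Finset.nodup_toList _).map fun _ _ h => (Prod.ext_iff.1 h).2

theorem length_fiber (c : B) : (fiber m c).length = Fintype.card (Pos m) := by
  simp [fiber]

theorem fiber_independent (c : B) (i) (hi : i ∈ fiber m c) (j) (hj : j ∈ fiber m c) :
    ¬ (foldGraph m).Adj i j := fun h =>
  h.1 ((mem_fiber.1 hi).trans (mem_fiber.1 hj).symm)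

theorem sin_sum (N y : ℕ) (hy : y < N) (θ : ℝ) (hθ : θ = Real.pi / (N + 1 : ℕ)) :
    (∑ x : Fin N, if (x : ℕ) = y + 1 ∨ y = x + 1 then Real.sin ((x + 1 : ℕ) * θ) else 0) =
      2 * Real.cos θ * Real.sin ((y + 1 : ℕ) * θ) := by
  rw [Fin.sum_univ_eq_sum_range
    (fun x : ℕ => if x = y + 1 ∨ y = x + 1 then Real.sin ((x + 1 : ℕ) * θ) else 0) N]
  have e : ∀ x ∈ Finset.range N, (if x = y + 1 ∨ y = x + 1 then Real.sin ((x + 1 : ℕ) * θ) else 0) =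
      (if x = y + 1 then Real.sin ((x + 1 : ℕ) * θ) else 0) +
        if y = x + 1 then Real.sin ((x + 1 : ℕ) * θ) else 0 := by
    intro x _
    by_cases h1 : x = y + 1
    · rw [if_pos (.inl h1), if_pos h1, if_neg (by omega), add_zero]
    · simp [h1]
  have e1 : (∑ x ∈ Finset.range N, if x = y + 1 then Real.sin ((x + 1 : ℕ) * θ) else 0) =
      Real.sin ((y + 2 : ℕ) * θ) := by
    rw [Finset.sum_ite_eq']
    split_ifs with h
    · rfl
    · rw [Finset.mem_range] at h
      obtain rfl : N = y + 1 := by omega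
      have : ((y + 2 : ℕ) : ℝ) * θ = Real.pi := by
        rw [hθ]; field_simp
      rw [this, Real.sin_pi]
  have e2 : (∑ x ∈ Finset.range N, if y = x + 1 then Real.sin ((x + 1 : ℕ) * θ) else 0) =
      Real.sin (y * θ) := by
    cases y with
    | zero =>
      rw [Nat.cast_zero, zero_mul, Real.sin_zero]
      exact Finset.sum_eq_zero fun x _ => if_neg (by omega)
    | succ z =>
      have : ∀ x ∈ Finset.range N, (if z + 1 = x + 1 then Real.sin ((x + 1 : ℕ) * θ) else 0) =
          if x = z then Real.sin ((x + 1 : ℕ) * θ) else 0 := fun x _ =>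
        if_congr (by omega) rfl rfl
      rw [Finset.sum_congr rfl this, Finset.sum_ite_eq', if_pos (by rw [Finset.mem_range]; omega)]
  rw [Finset.sum_congr rfl e, Finset.sum_add_distrib, e1, e2]
  have a1 : ((y + 2 : ℕ) : ℝ) * θ = (y + 1 : ℕ) * θ + θ := by push_cast; ring
  have a2 : (y : ℝ) * θ = (y + 1 : ℕ) * θ - θ := by push_cast; ring
  rw [a1, a2, Real.sin_add, Real.sin_sub]
  ring

open scoped Classical in
theorem sum_neighbours {c c' : B} (hne : c ≠ c') (j : B × Pos m) (hj : j.1 = c')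
    (f : ℕ → ℝ) :
    (∑ i, if (foldGraph m).Adj j i ∧ i.1 = c then f (i.2 s(c, c')) else 0) =
      ∑ x : Fin (m s(c, c') - 1),
        if (x : ℕ) = j.2 s(c, c') + 1 ∨ (j.2 s(c, c') : ℕ) = x + 1 then f x else 0 := by
  symm
  obtain ⟨c', ω⟩ := j
  subst hj
  refine Fintype.sum_of_injective (fun x => ((c, Function.update ω s(c, c') x) : B × Pos m))
    (fun x y h => ?_) _ _ ?_ ?_
  · have := congrFun (Prod.ext_iff.1 h).2 s(c, c')
    simpa using this
  · rintro ⟨d, ω'⟩ hi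
    refine if_neg ?_
    rintro ⟨⟨h1, h2, h3⟩, h4⟩
    refine hi ⟨ω' s(c, c'), ?_⟩
    dsimp only at h1 h2 h3 h4
    subst h4
    refine Prod.ext rfl ?_
    funext q
    by_cases hq : q = s(d, c')
    · subst hq; simp
    · dsimp only
      rw [Function.update_of_ne hq]
      rw [Sym2.eq_swap] at hq
      exact h2 q hq
  · intro x
    refine if_congr ?_ ?_ rfl
    · have e : s(c', c) = s(c, c') := Sym2.eq_swap
      simp only [foldGraph, and_true]
      rw [e, Function.update_self]
      constructor
      · intro h
        refine ⟨hne.symm, fun q hq => ?_, by omega⟩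
        exact (Function.update_of_ne hq _ _).symm
      · rintro ⟨-, -, h⟩; omega
    · dsimp only
      rw [Function.update_self]

theorem dead_fiber (hm : ∀ p, 2 ≤ m p) {s t : B} (hst : s ≠ t) {i : B × Pos m}
    (hi : i.1 = s ∨ i.1 = t) :
    tw (foldGraph m) ((aw s t (m s(s, t))).flatMap (fiber m)) (ind (sr i)) = 0 := by
  classical
  have h2 := hm s(s, t)
  have hN : m s(s, t) - 1 + 1 = m s(s, t) := by omega
  refine dead (G := foldGraph m) (cl := Prod.fst) (θ := Real.pi / m s(s, t))
    (μ := fun i => Real.sin ((i.2 s(s, t) + 1 : ℕ) * (Real.pi / m s(s, t))))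
    nodup_fiber (fun c i => mem_fiber) (fun i j h => h.1) hst h2 rfl ?_ ?_ ?_ hi
  · intro i _
    have h3 := (i.2 s(s, t)).2
    refine Real.sin_pos_of_pos_of_lt_pi (by positivity) ?_
    have h0 : (0 : ℝ) < m s(s, t) := by positivity
    rw [mul_div_assoc', div_lt_iff₀ h0, mul_comm]
    exact mul_lt_mul_of_pos_left (by exact_mod_cast (by omega)) Real.pi_pos
  · intro j hj
    have := sum_neighbours hst j hj fun x => Real.sin ((x + 1 : ℕ) * (Real.pi / m s(s, t)))
    rw [this, sin_sum _ _ (j.2 s(s, t)).2 _ (by rw [hN])]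
  · intro j hj
    have := sum_neighbours hst.symm j hj fun x => Real.sin ((x + 1 : ℕ) * (Real.pi / m s(s, t)))
    rw [Sym2.eq_swap] at this
    rw [this, sin_sum _ _ (j.2 s(s, t)).2 _ (by rw [hN])]

omit [Finite B] in
theorem col_eq_col_iff {s t : B} (hst : s ≠ t) (a b : ℕ) :
    col s t a = col s t b ↔ (a % 2 = b % 2) := by
  simp only [col, Nat.even_iff]
  split_ifs with h1 h2 h2 <;> simp [hst, hst.symm] <;> omega

theorem alive_fiber {s t : B} (hst : s ≠ t) {k : ℕ} (hk : 1 ≤ k)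
    (hkm : k < m s(s, t)) {j : B × Pos m} (hj : j ∈ fiber m (col s t (k + 1))) :
    ∃ i ∈ fiber m s, 0 < tw (foldGraph m) ((aw s t k).flatMap (fiber m)) (ind (sr i)) (sr j) := by
  classical
  rw [mem_fiber] at hj
  obtain ⟨y, hy⟩ : ∃ y : ℕ, y = (j.2 s(s, t)).val := ⟨_, rfl⟩
  have hyN : y < m s(s, t) - 1 := hy ▸ (j.2 s(s, t)).2
  set P : ℤ → B × Pos m := fun x => (col s t (x.toNat + (k + 1 + y)),
    Function.update j.2 s(s, t) ⟨min x.toNat (m s(s, t) - 2), by omega⟩) with hP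
  have hPp : ∀ x, 0 ≤ x → x < (m s(s, t) : ℤ) - 1 → ((P x).2 s(s, t) : ℕ) = x.toNat := by
    intro x h1 h2
    simp only [hP, Function.update_self]
    omega
  have hPy : P y = j := by
    refine Prod.ext ?_ ?_
    · rw [hj]
      simp only [hP]
      rw [col_eq_col_iff hst]
      omega
    · have : (⟨min (y : ℤ).toNat (m s(s, t) - 2), by omega⟩ : Fin (m s(s, t) - 1)) =
          j.2 s(s, t) := Fin.ext (by simp only; omega)
      simp only [hP, this]
      exact Function.update_eq_self _ _
  have hinj : ∀ x y : ℤ, 0 ≤ x → x < (m s(s, t) : ℤ) - 1 → 0 ≤ y → y < (m s(s, t) : ℤ) - 1 →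
      P x = P y → x = y := by
    intro x z h1 h2 h3 h4 h
    have e1 := hPp x h1 h2
    have e2 := hPp z h3 h4
    rw [h, e2] at e1
    omega
  have hadj : ∀ x y : ℤ, 0 ≤ x → x < (m s(s, t) : ℤ) - 1 → 0 ≤ y → y < (m s(s, t) : ℤ) - 1 →
      ((foldGraph m).Adj (P x) (P y) ↔ y = x + 1 ∨ x = y + 1) := by
    intro x z h1 h2 h3 h4
    have e1 := hPp x h1 h2
    have e2 := hPp z h3 h4
    have hs : (P x).1 ≠ (P z).1 → s((P x).1, (P z).1) = s(s, t) := by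
      intro hne
      rcases col_cases s t (x.toNat + (k + 1 + y)) with h | h <;>
        rcases col_cases s t (z.toNat + (k + 1 + y)) with h' | h' <;>
        simp only [hP, h.1, h'.1, ne_eq, not_true_eq_false] at hne ⊢
      exact Sym2.eq_swap
    constructor
    · rintro ⟨g1, -, g3⟩
      rw [hs g1, e1, e2] at g3
      omega
    · intro h
      have g1 : (P x).1 ≠ (P z).1 := by
        simp only [hP, ne_eq]
        rw [col_eq_col_iff hst]
        omega
      refine ⟨g1, ?_, ?_⟩
      · rw [hs g1]
        intro q hq
        simp only [hP]
        rw [Function.update_of_ne hq, Function.update_of_ne hq]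
      · rw [hs g1, e1, e2]
        omega
  obtain ⟨l₀, r₀, i, h1, h2, h3, h4, h5, h6⟩ : ∃ l₀ r₀ i : ℤ, 0 ≤ l₀ ∧ r₀ < (m s(s, t) : ℤ) - 1 ∧
      r₀ - l₀ = k - 1 ∧ l₀ ≤ i ∧ i ≤ r₀ ∧ l₀ + r₀ - i = y := by
    by_cases h : y + k ≤ m s(s, t) - 1
    · exact ⟨y, y + k - 1, y + k - 1, by omega, by omega, by omega, by omega, by omega, by omega⟩
    · exact ⟨m s(s, t) - 1 - k, m s(s, t) - 2, m s(s, t) - 1 - k + m s(s, t) - 2 - y, by omega,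
        by omega, by omega, by omega, by omega, by omega⟩
  refine ⟨P i, ?_, ?_⟩
  · rw [mem_fiber]
    have : s = col s t 0 := by simp [col]
    conv_rhs => rw [this]
    simp only [hP]
    rw [col_eq_col_iff hst]
    omega
  · have := alive_of_path (G := foldGraph m) hinj hadj (L := fiber m) (s := s) (t := t) (k := k)
      nodup_fiber fiber_independent (fun n x hx1 hx2 => ?_) h1 h2 h3 h4 h5
    · rwa [h6, hPy] at this
    · rw [mem_fiber]
      simp only [hP]
      rw [col_eq_col_iff hst]
      omega

end Fold


section FoldRelation

variable {B : Type*} [Finite B] {m : Sym2 B → ℕ}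

/-- The image of a word under the folding. -/
noncomputable def fold (m : Sym2 B → ℕ) (w : List B) : List (B × Pos m) := w.flatMap (fiber m)

theorem fold_append (w w' : List B) : fold m (w ++ w') = fold m w ++ fold m w' :=
  List.flatMap_append

theorem length_fold (w : List B) : (fold m w).length = w.length * Fintype.card (Pos m) := by
  induction w with
  | nil => simp [fold]
  | cons a w ih =>
    have : fold m (a :: w) = fiber m a ++ fold m w := List.flatMap_cons ..
    rw [this, List.length_append, ih, length_fiber, List.length_cons]
    ring

omit [Finite B] in
theorem length_aw (s t : B) (k : ℕ) : (aw s t k).length = k := by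
  induction k with
  | zero => rfl
  | succ k ih => rw [aw, List.length_cons, ih]

theorem dead_of_alive {s t : B} (hst : s ≠ t) {k : ℕ} (hk : 1 ≤ k) (hkm : k < m s(s, t))
    {w w' : List (B × Pos m)}
    (hw : ∀ i ∈ fiber m s, tw (foldGraph m) w (ind (sr i)) = 0)
    (h : wp foldGraph_triangleFree w = wp foldGraph_triangleFree (w' ++ fold m (aw s t k)))
    (j : B × Pos m) (hj : j ∈ fiber m (col s t (k + 1))) :
    tw (foldGraph m) w' (ind (sr j)) = 0 := by
  obtain ⟨i, hi, hij⟩ := alive_fiber hst hk hkm hj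
  refine tw_ind_eq_zero (tw_nonneg (ind_nonneg _)) hij ?_
  rw [← hw i hi, tw_eq_of_wp_eq _ h, tw_append]
  rfl

theorem wp_fold_aw (hm : ∀ p, 2 ≤ m p) {s t : B} (hst : s ≠ t) :
    wp foldGraph_triangleFree (fold m (aw s t (m s(s, t)))) =
      wp foldGraph_triangleFree (fold m (aw t s (m s(s, t)))) := by
  have hd : ∀ c : B, c = s ∨ c = t → ∀ i ∈ fiber m c,
      tw (foldGraph m) (fold m (aw s t (m s(s, t)))) (ind (sr i)) = 0 := by
    intro c hc i hi
    refine dead_fiber hm hst ?_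
    rw [mem_fiber.1 hi]
    exact hc
  have key : ∀ k ≤ m s(s, t), ∃ w',
      wp foldGraph_triangleFree (fold m (aw s t (m s(s, t)))) =
        wp foldGraph_triangleFree (w' ++ fold m (aw t s k)) := by
    intro k
    induction k with
    | zero => exact fun _ => ⟨_, by simp [fold, aw]; rfl⟩
    | succ k ih =>
      intro hk
      obtain ⟨w', h⟩ := ih (by omega)
      have h0 : ∀ j ∈ fiber m (col t s (k + 1)), tw (foldGraph m) w' (ind (sr j)) = 0 := by
        intro j hj
        rcases Nat.eq_zero_or_pos k with rfl | hk0
        · rw [← hd s (.inl rfl) j (by simpa [col] using hj), tw_eq_of_wp_eq _ h]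
          simp [fold, aw]
        · exact dead_of_alive hst.symm hk0 (by rw [Sym2.eq_swap]; omega) (hd t (.inr rfl)) h j hj
      obtain ⟨w'', h''⟩ := exists_append_of_independent foldGraph_triangleFree (nodup_fiber _)
        (fiber_independent _) h0
      refine ⟨w'', ?_⟩
      have e : fold m (aw t s (k + 1)) = fiber m (col t s (k + 1)) ++ fold m (aw t s k) :=
        List.flatMap_cons ..
      rw [h, e, ← List.append_assoc, wp_append, h'', ← wp_append]
  obtain ⟨w', h⟩ := key _ le_rfl
  have hl := length_eq_of_wp_eq _ h
  rw [List.length_append, length_fold, length_fold, length_aw, length_aw] at hl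
  obtain rfl : w' = [] := List.eq_nil_of_length_eq_zero (by omega)
  exact h

end FoldRelation


theorem opT_ind_self {I : Type*} [Fintype I] {G : SimpleGraph I} (i : I) :
    opT G i (ind (sr i)) = 0 := by
  funext v
  by_cases h1 : v = sr i
  · rw [h1, opT_sr]; rfl
  by_cases hv : IsRoot G v
  swap
  · rw [opT_nonroot hv, ind_ne h1]; rfl
  rcases lt_trichotomy (pr G v i) 0 with h | h | h
  · rw [opT_neg hv h, ind_ne h1, ind_ne (rf_ne_sr hv h i), add_zero, zero_div]; rfl
  · rw [opT_zero h, ind_ne h1]; rfl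
  · rw [opT_pos hv h1 h, ind_ne]
    · rfl
    · intro h2
      have h3 := pr_rf_self G i v
      rw [h2, pr_sr_self] at h3
      omega

theorem tw_zero {I : Type*} [Fintype I] {G : SimpleGraph I} (w : List I) : tw G w 0 = 0 := by
  induction w with
  | nil => rfl
  | cons i w ih =>
    change opT G i (tw G w 0) = 0
    rw [ih]
    funext v
    simp [opT]

theorem tw_ind_eq_zero_of_mem {I : Type*} [Fintype I] {G : SimpleGraph I}
    (hT : ∀ i j k, G.Adj i j → G.Adj j k → ¬ G.Adj i k) {L : List I}
    (hind : ∀ i ∈ L, ∀ j ∈ L, ¬ G.Adj i j) {i : I} (hi : i ∈ L) (w : List I) :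
    tw G (w ++ L) (ind (sr i)) = 0 := by
  classical
  have hp : wp hT L = wp hT (L.erase i ++ [i]) := by
    have h1 : (L.map (atom hT)).Perm ((L.erase i ++ [i]).map (atom hT)) :=
      ((List.perm_cons_erase hi).trans (List.perm_append_singleton i _).symm).map _
    refine h1.prod_eq' (List.pairwise_map.2 (List.pairwise_of_forall_mem_list ?_))
    intro a ha b hb
    by_cases hab : a = b
    · rw [hab]; exact Commute.refl _
    · exact atom_comm hT hab (hind a ha b hb)
  rw [tw_append, tw_eq_of_wp_eq hT hp, tw_append]
  change tw G w (tw G _ (opT G i (ind (sr i)))) = 0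
  rw [opT_ind_self, tw_zero, tw_zero]

theorem prod_wp_fiber {B : Type*} [Finite B] {m : Sym2 B → ℕ} (w : List B) :
    (w.map fun s => wp foldGraph_triangleFree (fiber m s)).prod =
      wp foldGraph_triangleFree (fold m w) := by
  induction w with
  | nil => rfl
  | cons a w ih =>
    have : fold m (a :: w) = fiber m a ++ fold m w := List.flatMap_cons ..
    rw [List.map_cons, List.prod_cons, ih, this, wp_append]

theorem aw_eq_altList {B : Type*} (s t : B) (k : ℕ) :
    aw s t k = ArtinTitsPaper.altList (col s t k) (col s t (k + 1)) k := by
  induction k with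
  | zero => rfl
  | succ k ih => rw [aw, ArtinTitsPaper.altList, ih, col_add_two]

theorem aw_eq_altList_or {B : Type*} (s t : B) (k : ℕ) :
    (aw s t k = ArtinTitsPaper.altList s t k ∧ aw t s k = ArtinTitsPaper.altList t s k) ∨
    (aw s t k = ArtinTitsPaper.altList t s k ∧ aw t s k = ArtinTitsPaper.altList s t k) := by
  rw [aw_eq_altList, aw_eq_altList]
  by_cases h : Even k <;> simp [col, h, Nat.even_add_one]

theorem aw_snoc {B : Type*} (s t : B) {k : ℕ} (hk : 1 ≤ k) : ∃ l, aw s t k = l ++ [t] := by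
  induction k with
  | zero => omega
  | succ k ih =>
    rcases Nat.eq_zero_or_pos k with rfl | h
    · exact ⟨[], by simp [aw, col]⟩
    · obtain ⟨l, hl⟩ := ih h
      exact ⟨col s t (k + 1) :: l, by rw [aw, hl]; rfl⟩

end SmallType

namespace ArtinTitsPaper

open SmallType

variable {B : Type*} (M : CoxeterMatrix B)

/-- The element of the Artin group represented by a positive word. -/
def gp (w : List B) : Artin M := (w.map (gen M)).prod

@[simp] theorem gp_nil : gp M [] = 1 := rfl

theorem gp_append (w w' : List B) : gp M (w ++ w') = gp M w * gp M w' := by simp [gp]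

theorem gp_cons (s : B) (w : List B) : gp M (s :: w) = gen M s * gp M w := by simp [gp]

theorem gp_singleton (s : B) : gp M [s] = gen M s := by simp [gp]

theorem map_of_prod_eq_gp (l : List B) :
    QuotientGroup.mk' (Subgroup.normalClosure (braidRels M)) ((l.map FreeGroup.of).prod) =
      gp M l := by
  rw [map_list_prod, List.map_map]
  rfl

theorem gp_altList {s t : B} (hst : s ≠ t) (h : M s t ≠ 0) :
    gp M (altList s t (M s t)) = gp M (altList t s (M s t)) := by
  have h1 : _ ∈ braidRels M := ⟨s, t, hst, h, rfl⟩
  have h2 := (QuotientGroup.eq_one_iff _).2 (Subgroup.subset_normalClosure h1)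
  have h3 : QuotientGroup.mk' (Subgroup.normalClosure (braidRels M))
    (((altList s t (M s t)).map FreeGroup.of).prod *
          (((altList t s (M s t)).map FreeGroup.of).prod)⁻¹) = 1 := h2
  rw [map_mul, map_inv, map_of_prod_eq_gp, map_of_prod_eq_gp] at h3
  exact mul_inv_eq_one.1 h3

theorem gp_aw {s t : B} (hst : s ≠ t) (h : M s t ≠ 0) :
    gp M (aw s t (M s t)) = gp M (aw t s (M s t)) := by
  rcases aw_eq_altList_or s t (M s t) with ⟨h1, h2⟩ | ⟨h1, h2⟩ <;> rw [h1, h2, gp_altList M hst h]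

/-- A homomorphism out of the Artin group. -/
def artinLift {H : Type*} [Group H] (f : B → H) (hf : ∀ s t : B, s ≠ t → M s t ≠ 0 →
    ((altList s t (M s t)).map f).prod = ((altList t s (M s t)).map f).prod) : Artin M →* H :=
  PresentedGroup.toGroup (rels := braidRels M) (f := f) (by
    rintro r ⟨s, t, hst, h, rfl⟩
    rw [map_mul, map_inv, map_list_prod, map_list_prod, List.map_map, List.map_map, mul_inv_eq_one]
    simpa [Function.comp_def] using hf s t hst h)

theorem artinLift_gp {H : Type*} [Group H] (f : B → H) (hf) (w : List B) :
    artinLift M f hf (gp M w) = (w.map f).prod := by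
  rw [gp, map_list_prod, List.map_map]
  congr 2
  funext s
  exact PresentedGroup.toGroup.of _

theorem length_altList (s t : B) (n : ℕ) : (altList s t n).length = n := by
  induction n generalizing s t with
  | zero => rfl
  | succ n ih => rw [altList, List.length_cons, ih]

/-- The length homomorphism. -/
def lenHom : Artin M →* Multiplicative ℤ :=
  artinLift M (fun _ => Multiplicative.ofAdd 1) (by simp [length_altList])

theorem lenHom_gp (w : List B) : lenHom M (gp M w) = Multiplicative.ofAdd (w.length : ℤ) := by
  rw [lenHom, artinLift_gp]
  simp [← ofAdd_nsmul]

theorem length_eq_of_gp_eq {w w' : List B} (h : gp M w = gp M w') : w.length = w'.length := by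
  have := congrArg (lenHom M) h
  rw [lenHom_gp, lenHom_gp] at this
  exact_mod_cast Multiplicative.ofAdd.injective this

open scoped Classical in
/-- The finite labels approximating `M`. -/
noncomputable def labels (N : ℕ) : Sym2 B → ℕ :=
  Sym2.lift ⟨fun s t => if s = t then 2 else if M s t = 0 then N + 2 else M s t, fun s t => by
    simp only [M.symmetric s t, eq_comm (a := s)]⟩

theorem labels_eq (N : ℕ) {s t : B} (hst : s ≠ t) (h : M s t ≠ 0) :
    labels M N s(s, t) = M s t := by
  simp [labels, hst, h]

theorem labels_of_zero (N : ℕ) {s t : B} (hst : s ≠ t) (h : M s t = 0) :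
    labels M N s(s, t) = N + 2 := by
  simp [labels, hst, h]

theorem two_le_labels (N : ℕ) (p : Sym2 B) : 2 ≤ labels M N p := by
  induction p with
  | _ s t =>
    by_cases hst : s = t
    · simp [labels, hst]
    · by_cases h : M s t = 0
      · rw [labels_of_zero M N hst h]; omega
      · rw [labels_eq M N hst h]
        have := M.off_diagonal s t hst
        omega

variable [Finite B]

/-- The folding homomorphism. -/
noncomputable def foldHom (N : ℕ) : Artin M →* Target (B × Pos (labels M N)) :=
  artinLift M (fun s => wp foldGraph_triangleFree (fiber (labels M N) s)) (by
    intro s t hst h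
    rw [prod_wp_fiber, prod_wp_fiber]
    have := wp_fold_aw (two_le_labels M N) hst
    rw [labels_eq M N hst h] at this
    rcases aw_eq_altList_or s t (M s t) with ⟨h1, h2⟩ | ⟨h1, h2⟩ <;> rw [h1, h2] at this
    · exact this
    · exact this.symm)

theorem wp_fold_eq_of_gp_eq (N : ℕ) {w w' : List B} (h : gp M w = gp M w') :
    wp foldGraph_triangleFree (fold (labels M N) w) =
      wp foldGraph_triangleFree (fold (labels M N) w') := by
  have e : ∀ w : List B, foldHom M N (gp M w) =
      wp foldGraph_triangleFree (fold (labels M N) w) := by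
    intro w
    rw [foldHom, artinLift_gp, prod_wp_fiber]
  rw [← e, h, e]

end ArtinTitsPaper

namespace ArtinTitsPaper

open SmallType

variable {B : Type*} (M : CoxeterMatrix B) [Finite B]

/-- The folded word annihilates the simple roots of colour `s`. -/
def Dead (N : ℕ) (w : List B) (s : B) : Prop :=
  ∀ i ∈ fiber (labels M N) s,
    tw (foldGraph (labels M N)) (fold (labels M N) w) (ind (sr i)) = 0

variable {M}

theorem dead_snoc (N : ℕ) {w w' : List B} {s : B} (h : gp M w = gp M (w' ++ [s])) :
    Dead M N w s := by
  intro i hi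
  have e : fold (labels M N) [s] = fiber (labels M N) s := by simp [fold]
  rw [tw_eq_of_wp_eq _ (wp_fold_eq_of_gp_eq M N h), fold_append, e]
  exact tw_ind_eq_zero_of_mem foldGraph_triangleFree (fiber_independent s) hi _

theorem exists_append_aw {N : ℕ} {w : List B} (ih : ∀ w' : List B, w'.length < w.length → ∀ c,
    Dead M N w' c → ∃ w'', gp M w' = gp M (w'' ++ [c])) {s t : B} (hst : s ≠ t)
    (hs : Dead M N w s) (ht : ∃ w', gp M w = gp M (w' ++ [t])) {k : ℕ} (hk : 1 ≤ k)
    (hkm : k ≤ labels M N s(s, t)) : ∃ w', gp M w = gp M (w' ++ aw s t k) := by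
  induction k, hk using Nat.le_induction with
  | base => exact ht
  | succ k hk ih' =>
    obtain ⟨w', h⟩ := ih' (by omega)
    have hl := length_eq_of_gp_eq M h
    rw [List.length_append, length_aw] at hl
    have h1 := wp_fold_eq_of_gp_eq M N h
    rw [fold_append] at h1
    obtain ⟨w'', h2⟩ := ih w' (by omega) (col s t (k + 1))
      (dead_of_alive hst hk (by omega) hs h1)
    refine ⟨w'', ?_⟩
    rw [h, gp_append, h2, gp_append, gp_append, gp_singleton, aw, gp_cons, mul_assoc]

omit [Finite B] in
theorem ne_zero_of_append_aw {N : ℕ} {w w' : List B} (hN : w.length ≤ N) {s t : B} (hst : s ≠ t)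
    (h : gp M w = gp M (w' ++ aw s t (labels M N s(s, t)))) : M s t ≠ 0 := by
  intro h0
  have hl := length_eq_of_gp_eq M h
  rw [List.length_append, length_aw, labels_of_zero M N hst h0] at hl
  omega

theorem exists_snoc_of_dead {N : ℕ} {w : List B} (hN : w.length ≤ N) {s : B}
    (h : Dead M N w s) : ∃ w', gp M w = gp M (w' ++ [s]) := by
  induction hn : w.length using Nat.strong_induction_on generalizing w s with
  | _ n ih =>
  subst hn
  rcases List.eq_nil_or_concat w with rfl | ⟨w1, t, rfl⟩
  · have : Nonempty (Pos (labels M N)) :=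
      ⟨fun p => ⟨0, by have := two_le_labels M N p; omega⟩⟩
    obtain ⟨ω⟩ := this
    have h1 := congrFun (h (s, ω) (mem_fiber.2 rfl)) (sr (s, ω))
    change ind (sr (s, ω)) (sr (s, ω)) = 0 at h1
    rw [ind_self] at h1
    norm_num at h1
  rw [List.concat_eq_append] at *
  by_cases hst : s = t
  · exact ⟨w1, by rw [hst]⟩
  have h2 := two_le_labels M N s(s, t)
  obtain ⟨w2, e⟩ := exists_append_aw (fun w' hw' c hc => ih _ hw' (by omega) hc rfl) hst h
    ⟨w1, rfl⟩ (by omega) le_rfl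
  have h0 := ne_zero_of_append_aw hN hst e
  rw [labels_eq M N hst h0] at e h2
  obtain ⟨l, hl⟩ := aw_snoc t s (k := M s t) (by omega)
  refine ⟨w2 ++ l, ?_⟩
  rw [e, gp_append, gp_aw M hst h0, hl, ← gp_append, List.append_assoc]

theorem exists_append_altList {w w₁ w₂ : List B} {s t : B} (hst : s ≠ t)
    (h₁ : gp M w = gp M (w₁ ++ [s])) (h₂ : gp M w = gp M (w₂ ++ [t])) :
    M s t ≠ 0 ∧ ∃ w', gp M w = gp M (w' ++ altList s t (M s t)) := by
  have h2 := two_le_labels M w.length s(s, t)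
  obtain ⟨w', e⟩ := exists_append_aw (N := w.length)
    (fun w' hw' c hc => exists_snoc_of_dead (by omega) hc) hst
    (dead_snoc _ h₁) ⟨w₂, h₂⟩ (by omega) le_rfl
  have h0 := ne_zero_of_append_aw le_rfl hst e
  refine ⟨h0, w', ?_⟩
  rw [labels_eq M _ hst h0] at e
  rw [e, gp_append, gp_append]
  rcases aw_eq_altList_or s t (M s t) with ⟨h3, -⟩ | ⟨h3, -⟩
  · rw [h3]
  · rw [h3, gp_altList M hst h0]

end ArtinTitsPaper

namespace ArtinTitsPaper

open SmallType

variable {B : Type*} {M : CoxeterMatrix B}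

section Basics

theorem mem_posMonOn_iff {X : Set B} {g : Artin M} :
    g ∈ posMonOn M X ↔ ∃ w : List B, (∀ s ∈ w, s ∈ X) ∧ gp M w = g := by
  constructor
  · intro h
    refine Submonoid.closure_induction (motive := fun g _ => ∃ w : List B, (∀ s ∈ w, s ∈ X) ∧
      gp M w = g) ?_ ⟨[], by simp⟩ ?_ h
    · rintro _ ⟨s, hs, rfl⟩
      exact ⟨[s], by simpa using hs, gp_singleton M s⟩
    · rintro _ _ - - ⟨w, hw, rfl⟩ ⟨w', hw', rfl⟩
      refine ⟨w ++ w', fun s hs => ?_, gp_append M w w'⟩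
      rcases List.mem_append.1 hs with h | h
      · exact hw s h
      · exact hw' s h
  · rintro ⟨w, hw, rfl⟩
    refine Submonoid.list_prod_mem _ fun x hx => ?_
    obtain ⟨s, hs, rfl⟩ := List.mem_map.1 hx
    exact Submonoid.subset_closure ⟨s, hw s hs, rfl⟩

theorem posMonOn_univ : posMonOn M Set.univ = posMon M := by
  rw [posMonOn, posMon, Set.image_univ]

theorem posMonOn_le (X : Set B) : posMonOn M X ≤ posMon M :=
  Submonoid.closure_mono (Set.image_subset_range _ _)

theorem mem_posMon_iff {g : Artin M} : g ∈ posMon M ↔ ∃ w : List B, gp M w = g := by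
  rw [← posMonOn_univ, mem_posMonOn_iff]
  simp

theorem gp_mem_posMon (w : List B) : gp M w ∈ posMon M := mem_posMon_iff.2 ⟨w, rfl⟩

theorem gen_mem_posMon (s : B) : gen M s ∈ posMon M :=
  Submonoid.subset_closure ⟨s, rfl⟩

theorem gp_mem_posMonOn {X : Set B} {w : List B} (hw : ∀ s ∈ w, s ∈ X) :
    gp M w ∈ posMonOn M X := mem_posMonOn_iff.2 ⟨w, hw, rfl⟩

/-- The integer length. -/
def ilen (g : Artin M) : ℤ := (lenHom M g).toAdd

theorem ilen_mul (a b : Artin M) : ilen (a * b) = ilen a + ilen b := by simp [ilen]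

theorem ilen_gp (w : List B) : ilen (gp M w) = w.length := by simp [ilen, lenHom_gp]

theorem ilen_gen (s : B) : ilen (gen M s) = 1 := by
  rw [← gp_singleton, ilen_gp]; simp

theorem ilen_nonneg {g : Artin M} (hg : g ∈ posMon M) : 0 ≤ ilen g := by
  obtain ⟨w, rfl⟩ := mem_posMon_iff.1 hg
  rw [ilen_gp]; omega

theorem eq_one_of_ilen {g : Artin M} (hg : g ∈ posMon M) (h : ilen g = 0) : g = 1 := by
  obtain ⟨w, rfl⟩ := mem_posMon_iff.1 hg
  rw [ilen_gp] at h
  rw [List.eq_nil_of_length_eq_zero (by omega : w.length = 0), gp_nil]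

theorem eq_gen_of_ilen {g : Artin M} (hg : g ∈ posMon M) (h : ilen g = 1) : ∃ s, g = gen M s := by
  obtain ⟨w, rfl⟩ := mem_posMon_iff.1 hg
  rw [ilen_gp] at h
  obtain ⟨s, rfl⟩ := List.length_eq_one_iff.1 (by omega : w.length = 1)
  exact ⟨s, gp_singleton M s⟩

theorem eq_one_or_exists_mul_gen {g : Artin M} (hg : g ∈ posMon M) :
    g = 1 ∨ ∃ h ∈ posMon M, ∃ s, g = h * gen M s := by
  obtain ⟨w, rfl⟩ := mem_posMon_iff.1 hg
  rcases List.eq_nil_or_concat w with rfl | ⟨w, s, rfl⟩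
  · exact .inl rfl
  · exact .inr ⟨_, gp_mem_posMon w, s, by rw [List.concat_eq_append, gp_append, gp_singleton]⟩

theorem rdvd_refl (a : Artin M) : rdvd M a a := ⟨1, one_mem _, one_mul a⟩

theorem rdvd_mul_left {c : Artin M} (hc : c ∈ posMon M) (a : Artin M) : rdvd M a (c * a) :=
  ⟨c, hc, rfl⟩

theorem rdvd.trans {a b c : Artin M} (h : rdvd M a b) (h' : rdvd M b c) : rdvd M a c := by
  obtain ⟨x, hx, rfl⟩ := h
  obtain ⟨y, hy, rfl⟩ := h'
  exact ⟨y * x, mul_mem hy hx, mul_assoc _ _ _⟩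

theorem rdvd.mul_right {a b : Artin M} (h : rdvd M a b) (c : Artin M) :
    rdvd M (a * c) (b * c) := by
  obtain ⟨x, hx, rfl⟩ := h
  exact ⟨x, hx, (mul_assoc _ _ _).symm⟩

theorem rdvd.of_mul_right {a b c : Artin M} (h : rdvd M (a * c) (b * c)) : rdvd M a b := by
  obtain ⟨x, hx, h⟩ := h
  exact ⟨x, hx, mul_right_cancel ((mul_assoc _ _ _).trans h)⟩

theorem rdvd.ilen_le {a b : Artin M} (h : rdvd M a b) : ilen a ≤ ilen b := by
  obtain ⟨x, hx, rfl⟩ := h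
  rw [ilen_mul]
  have := ilen_nonneg hx
  omega

theorem aw_succ_snoc (s t : B) (k : ℕ) : aw s t (k + 1) = aw t s k ++ [t] := by
  induction k with
  | zero => simp [aw, col]
  | succ k ih =>
    rw [aw, ih, col_add_two, aw]
    have : col t s (k + 1) = col s t k := by
      by_cases h : Even k <;> simp [col, h, Nat.even_add_one]
    rw [this]; rfl

theorem mem_aw {s t c : B} {k : ℕ} (h : c ∈ aw s t k) : c = s ∨ c = t := by
  induction k with
  | zero => simp [aw] at h
  | succ k ih =>
    rw [aw, List.mem_cons] at h
    rcases h with h | h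
    · rw [h, col]; split_ifs <;> simp
    · exact ih h

theorem two_le_label {s t : B} (hst : s ≠ t) (h : M s t ≠ 0) : ∃ k, M s t = k + 2 := by
  have := M.off_diagonal s t hst
  exact ⟨M s t - 2, by omega⟩

end Basics

variable [Finite B]

theorem rdvd_aw {g : Artin M} (hg : g ∈ posMon M) {s t : B} (hst : s ≠ t)
    (hs : rdvd M (gen M s) g) (ht : rdvd M (gen M t) g) :
    M s t ≠ 0 ∧ rdvd M (gp M (aw s t (M s t))) g := by
  obtain ⟨w, rfl⟩ := mem_posMon_iff.1 hg
  obtain ⟨c, hc, h1⟩ := hs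
  obtain ⟨d, hd, h2⟩ := ht
  obtain ⟨w₁, rfl⟩ := mem_posMon_iff.1 hc
  obtain ⟨w₂, rfl⟩ := mem_posMon_iff.1 hd
  obtain ⟨h0, w', h⟩ := exists_append_altList (w := w) (w₁ := w₁) (w₂ := w₂) hst
    (by rw [gp_append, gp_singleton, h1]) (by rw [gp_append, gp_singleton, h2])
  refine ⟨h0, gp M w', gp_mem_posMon _, ?_⟩
  rw [h, gp_append]
  rcases aw_eq_altList_or s t (M s t) with ⟨h3, -⟩ | ⟨h3, -⟩
  · rw [h3]
  · rw [h3, gp_altList M hst h0]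

theorem support_aux {X : Set B} {w : List B} (hw : ∀ s ∈ w, s ∈ X) {h : Artin M}
    (hh : h ∈ posMon M) {l : List B} (e : gp M w = h * gp M l) :
    (∀ s ∈ l, s ∈ X) ∧ h ∈ posMonOn M X := by
  induction hn : w.length using Nat.strong_induction_on generalizing w h l with
  | _ n ih =>
  subst hn
  rcases List.eq_nil_or_concat l with rfl | ⟨l, s, rfl⟩
  · rw [gp_nil, mul_one] at e
    exact ⟨by simp, e ▸ gp_mem_posMonOn hw⟩
  rcases List.eq_nil_or_concat w with rfl | ⟨w, t, rfl⟩
  · have := congrArg ilen e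
    rw [ilen_mul, ilen_gp, ilen_gp] at this
    have := ilen_nonneg hh
    simp at *
    omega
  simp only [List.concat_eq_append] at *
  have ht : t ∈ X := hw t (by simp)
  have hw1 : ∀ s ∈ w, s ∈ X := fun s hs => hw s (by simp [hs])
  have hl : w.length < (w ++ [t]).length := by simp
  have e' : gp M w * gen M t = h * gp M l * gen M s := by
    rwa [gp_append, gp_append, gp_singleton, gp_singleton, ← mul_assoc] at e
  by_cases hst : s = t
  · subst hst
    obtain ⟨h1, h2⟩ := ih _ hl hw1 hh (mul_right_cancel e') rfl
    refine ⟨fun c hc => ?_, h2⟩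
    rcases List.mem_append.1 hc with hc | hc
    · exact h1 c hc
    · rw [List.mem_singleton.1 hc]; exact ht
  obtain ⟨h0, c, hc, h1⟩ := rdvd_aw (gp_mem_posMon (M := M) (w ++ [t])) hst
    ⟨h * gp M l, mul_mem hh (gp_mem_posMon _), by rw [e, gp_append, gp_singleton, mul_assoc]⟩
    ⟨gp M w, gp_mem_posMon _, by rw [gp_append, gp_singleton]⟩
  obtain ⟨k, hk⟩ := two_le_label hst h0
  have h2 : gp M w = c * gp M (aw t s (k + 1)) := by
    rw [hk, aw_succ_snoc, gp_append, gp_append, gp_singleton, ← mul_assoc] at h1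
    exact (mul_right_cancel h1).symm
  obtain ⟨h3, h4⟩ := ih _ hl hw1 hc h2 rfl
  have hs : s ∈ X := h3 s (by rw [aw_succ_snoc]; simp)
  have h5 : h * gp M l = c * gp M (aw s t (k + 1)) := by
    have : gp M (aw s t (k + 2)) = gp M (aw t s (k + 2)) := by
      rw [← hk]; exact gp_aw M hst h0
    rw [hk, this, aw_succ_snoc, gp_append, gp_append, gp_singleton, gp_singleton, e',
      ← mul_assoc] at h1
    exact (mul_right_cancel h1).symm
  obtain ⟨v, hv, rfl⟩ := mem_posMonOn_iff.1 h4
  rw [← gp_append] at h5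
  have hlen := congrArg ilen h5
  rw [ilen_mul, ilen_gp] at hlen
  have hlen2 := congrArg ilen e'
  rw [ilen_mul, ilen_mul, ilen_mul, ilen_gp, ilen_gen, ilen_gen, ilen_gp] at hlen2
  rw [ilen_gp] at hlen
  obtain ⟨h6, h7⟩ := ih _ (by omega) (w := v ++ aw s t (k + 1)) (fun c hc => by
    rcases List.mem_append.1 hc with hc | hc
    · exact hv c hc
    · rcases mem_aw hc with rfl | rfl <;> assumption) hh h5.symm rfl
  refine ⟨fun c hc => ?_, h7⟩
  rcases List.mem_append.1 hc with hc | hc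
  · exact h6 c hc
  · rw [List.mem_singleton.1 hc]; exact hs

theorem mem_posMonOn_of_mul {X : Set B} {a b : Artin M} (ha : a ∈ posMon M) (hb : b ∈ posMon M)
    (h : a * b ∈ posMonOn M X) : a ∈ posMonOn M X ∧ b ∈ posMonOn M X := by
  obtain ⟨w, hw, e⟩ := mem_posMonOn_iff.1 h
  obtain ⟨l, rfl⟩ := mem_posMon_iff.1 hb
  obtain ⟨h1, h2⟩ := support_aux hw ha e
  exact ⟨h2, gp_mem_posMonOn h1⟩

theorem mem_of_gen_mem {X : Set B} {s : B} (h : gen M s ∈ posMonOn M X) : s ∈ X := by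
  obtain ⟨w, hw, e⟩ := mem_posMonOn_iff.1 h
  exact (support_aux hw (one_mem _) (l := [s]) (by rw [e, one_mul, gp_singleton])).1 s (by simp)

theorem gen_injective : Function.Injective (gen M) := fun s t h => by
  refine mem_of_gen_mem (M := M) (X := {t}) ?_
  rw [h]
  exact Submonoid.subset_closure ⟨t, rfl, rfl⟩

end ArtinTitsPaper

namespace ArtinTitsPaper

open SmallType

variable {B : Type*} {M : CoxeterMatrix B}

/-- `D` is the least common left-multiple of `a` and `b`. -/
def IsLcm (a b D : Artin M) : Prop :=
  D ∈ posMon M ∧ rdvd M a D ∧ rdvd M b D ∧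
    ∀ E ∈ posMon M, rdvd M a E → rdvd M b E → rdvd M D E

/-- `D` is the least common left-multiple of the generators in `Z`. -/
def IsGenLcm (Z : Set B) (D : Artin M) : Prop :=
  D ∈ posMon M ∧ (∀ z ∈ Z, rdvd M (gen M z) D) ∧
    ∀ E ∈ posMon M, (∀ z ∈ Z, rdvd M (gen M z) E) → rdvd M D E

theorem IsLcm.mul_right {a b D c : Artin M} (ha : a ∈ posMon M) (hc : c ∈ posMon M)
    (h : IsLcm a b D) : IsLcm (a * c) (b * c) (D * c) := by
  obtain ⟨h1, h2, h3, h4⟩ := h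
  refine ⟨mul_mem h1 hc, h2.mul_right c, h3.mul_right c, ?_⟩
  rintro E hE ⟨x, hx, rfl⟩ hb
  rw [← mul_assoc] at hb ⊢
  exact (h4 _ (mul_mem hx ha) (rdvd_mul_left hx a) hb.of_mul_right).mul_right c

variable [Finite B]

theorem exists_isLcm {G a b : Artin M} (ha : a ∈ posMon M) (hb : b ∈ posMon M)
    (haG : rdvd M a G) (hbG : rdvd M b G) : ∃ D, IsLcm a b D := by
  obtain ⟨n, hn⟩ : ∃ n : ℕ, ilen G < n := ⟨(ilen G).toNat + 1, by omega⟩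
  induction n generalizing G a b with
  | zero =>
    have := haG.ilen_le
    have := ilen_nonneg ha
    omega
  | succ n ih =>
    rcases eq_one_or_exists_mul_gen ha with rfl | ⟨a₀, ha₀, s, rfl⟩
    · exact ⟨b, hb, ⟨b, hb, mul_one b⟩, rdvd_refl b, fun E _ _ h => h⟩
    rcases eq_one_or_exists_mul_gen hb with rfl | ⟨b₀, hb₀, t, rfl⟩
    · exact ⟨_, ha, rdvd_refl _, ⟨_, ha, mul_one _⟩, fun E _ h _ => h⟩
    have hG : G ∈ posMon M := by
      obtain ⟨x, hx, rfl⟩ := haG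
      exact mul_mem hx ha
    have hsG := (rdvd_mul_left ha₀ (gen M s)).trans haG
    have htG := (rdvd_mul_left hb₀ (gen M t)).trans hbG
    have hsG' := hsG
    have htG' := htG
    obtain ⟨Gs, hGs, es⟩ := hsG'
    obtain ⟨Gt, hGt, et⟩ := htG'
    have ls := congrArg ilen es
    have lt := congrArg ilen et
    rw [ilen_mul, ilen_gen] at ls lt
    by_cases hst : s = t
    · subst hst
      rw [← es] at haG hbG
      obtain ⟨D, hD⟩ := ih ha₀ hb₀ haG.of_mul_right hbG.of_mul_right (by omega)
      exact ⟨_, hD.mul_right ha₀ (gen_mem_posMon s)⟩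
    obtain ⟨h0, K, hK, eK⟩ := rdvd_aw hG hst hsG htG
    obtain ⟨k, hk⟩ := two_le_label hst h0
    obtain ⟨V, hV, eV⟩ : ∃ V ∈ posMon M, gp M (aw s t (M s t)) = V * gen M s :=
      ⟨gp M (aw s t (k + 1)), gp_mem_posMon _, by
        rw [gp_aw M hst h0, hk, aw_succ_snoc, gp_append, gp_singleton]⟩
    obtain ⟨U, hU, eU⟩ : ∃ U ∈ posMon M, gp M (aw s t (M s t)) = U * gen M t :=
      ⟨gp M (aw t s (k + 1)), gp_mem_posMon _, by
        rw [hk, aw_succ_snoc, gp_append, gp_singleton]⟩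
    have eK1 : K * V = Gs := by rw [eV, ← es, ← mul_assoc] at eK; exact mul_right_cancel eK
    have eK2 : K * U = Gt := by rw [eU, ← et, ← mul_assoc] at eK; exact mul_right_cancel eK
    have haGs : rdvd M a₀ Gs := by rw [← es] at haG; exact haG.of_mul_right
    have hbGt : rdvd M b₀ Gt := by rw [← et] at hbG; exact hbG.of_mul_right
    obtain ⟨A, hA⟩ := ih ha₀ hV haGs ⟨K, hK, eK1⟩ (by omega)
    obtain ⟨C, hC⟩ := ih hb₀ hU hbGt ⟨K, hK, eK2⟩ (by omega)
    have hAs := hA.mul_right ha₀ (gen_mem_posMon s)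
    have hCt := hC.mul_right hb₀ (gen_mem_posMon t)
    obtain ⟨-, -, ⟨A', hA', rfl⟩, hAmin⟩ := hA
    obtain ⟨-, -, ⟨C', hC', rfl⟩, hCmin⟩ := hC
    have hAK : rdvd M A' K := by
      have := hAmin Gs hGs haGs ⟨K, hK, eK1⟩
      rw [← eK1] at this
      exact this.of_mul_right
    have hCK : rdvd M C' K := by
      have := hCmin Gt hGt hbGt ⟨K, hK, eK2⟩
      rw [← eK2] at this
      exact this.of_mul_right
    have lK := congrArg ilen eK
    rw [eV, ilen_mul, ilen_mul, ilen_gen] at lK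
    have := ilen_nonneg hV
    obtain ⟨D, hD⟩ := ih hA' hC' hAK hCK (by omega)
    have hδ : gp M (aw s t (M s t)) ∈ posMon M := gp_mem_posMon _
    obtain ⟨h1, h2, h3, h4⟩ := hD.mul_right hA' hδ
    rw [mul_assoc, ← eV] at hAs
    rw [mul_assoc, ← eU] at hCt
    refine ⟨_, h1, hAs.2.1.trans h2, hCt.2.1.trans h3, fun E hE haE hbE => ?_⟩
    have hsE := (rdvd_mul_left ha₀ (gen M s)).trans haE
    have htE := (rdvd_mul_left hb₀ (gen M t)).trans hbE
    have hδE := (rdvd_aw hE hst hsE htE).2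
    refine h4 E hE (hAs.2.2.2 E hE haE ?_) (hCt.2.2.2 E hE hbE ?_)
    · exact hδE
    · exact hδE

theorem exists_isGenLcm {G : Artin M} (hG : G ∈ posMon M) (Z : Set B)
    (h : ∀ z ∈ Z, rdvd M (gen M z) G) : ∃ D : Artin M, IsGenLcm Z D := by
  induction Z, Z.toFinite using Set.Finite.induction_on with
  | empty => exact ⟨1, one_mem _, by simp, fun E hE _ => ⟨E, hE, mul_one E⟩⟩
  | @insert z Z _ _ ih =>
    obtain ⟨D, hD1, hD2, hD3⟩ := ih fun y hy => h y (Set.mem_insert_of_mem z hy)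
    obtain ⟨D', h1, h2, h3, h4⟩ := exists_isLcm hD1 (gen_mem_posMon z)
      (hD3 G hG fun y hy => h y (Set.mem_insert_of_mem z hy)) (h z (Set.mem_insert z Z))
    refine ⟨D', h1, fun y hy => ?_, fun E hE hy => ?_⟩
    · rcases hy with rfl | hy
      · exact h3
      · exact (hD2 y hy).trans h2
    · exact h4 E hE (hD3 E hE fun y hy' => hy y (Set.mem_insert_of_mem z hy'))
        (hy z (Set.mem_insert z Z))

theorem IsGenLcm.exists_mul_gen {Z : Set B} {D : Artin M} (h : IsGenLcm Z D) {z : B}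
    (hz : z ∈ Z) : ∃ s, D * gen M z = gen M s * D := by
  obtain ⟨h1, h2, h3⟩ := h
  have hDz := mul_mem h1 (gen_mem_posMon z)
  obtain ⟨c, hc, e⟩ := h3 _ hDz fun y hy => by
    by_cases hyz : y = z
    · subst hyz
      exact rdvd_mul_left h1 _
    obtain ⟨h0, K, hK, e⟩ := rdvd_aw h1 hyz (h2 y hy) (h2 z hz)
    obtain ⟨k, hk⟩ := two_le_label hyz h0
    have e2 : gp M (aw y z (M y z)) * gen M z = gp M (aw y z (M y z + 1)) := by
      rw [gp_aw M hyz h0, aw_succ_snoc, gp_append, gp_singleton]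
    rw [← e, mul_assoc, e2]
    refine (?_ : rdvd M (gen M y) _).trans (rdvd_mul_left hK _)
    rw [aw, gp_cons, gp_aw M hyz h0, hk, aw_succ_snoc, gp_append, gp_singleton, ← mul_assoc]
    exact rdvd_mul_left (mul_mem (gen_mem_posMon _) (gp_mem_posMon _)) _
  have hl := congrArg ilen e
  rw [ilen_mul, ilen_mul, ilen_gen] at hl
  obtain ⟨s, rfl⟩ := eq_gen_of_ilen hc (by omega)
  exact ⟨s, e.symm⟩

theorem IsGenLcm.exists_gen_mul {X : Set B} {D : Artin M} (h : IsGenLcm X D)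
    (hX : D ∈ posMonOn M X) {y : B} (hy : y ∈ X) : ∃ x ∈ X, D * gen M x = gen M y * D := by
  have h1 : ∀ x : X, ∃ s : X, D * gen M x = gen M s * D := by
    rintro ⟨x, hx⟩
    obtain ⟨s, hs⟩ := h.exists_mul_gen hx
    have h2 : gen M s * D ∈ posMonOn M X :=
      hs ▸ mul_mem hX (Submonoid.subset_closure ⟨x, hx, rfl⟩)
    exact ⟨⟨s, mem_of_gen_mem (mem_posMonOn_of_mul (gen_mem_posMon s) h.1 h2).1⟩, hs⟩
  choose σ hσ using h1
  have hinj : Function.Injective σ := fun a b hab => by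
    have := (hσ a).trans ((hab ▸ rfl : gen M (σ a) * D = gen M (σ b) * D).trans (hσ b).symm)
    exact Subtype.ext (gen_injective (mul_left_cancel this))
  obtain ⟨x, hx⟩ := Finite.surjective_of_injective hinj ⟨y, hy⟩
  refine ⟨x, x.2, ?_⟩
  rw [hσ x, hx]

omit [Finite B] in
theorem aw_reverse (s t : B) (k : ℕ) : (aw s t k).reverse = altList t s k := by
  induction k generalizing s t with
  | zero => rfl
  | succ k ih => rw [aw_succ_snoc, List.reverse_append, ih]; rfl

end ArtinTitsPaper

namespace ArtinTitsPaper

open SmallType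

variable {B : Type*} {M : CoxeterMatrix B}

theorem prod_op_gen (w : List B) : (w.map fun s => MulOpposite.op (gen M s)).prod =
    MulOpposite.op (gp M w.reverse) := by
  induction w with
  | nil => rfl
  | cons a w ih =>
    rw [List.map_cons, List.prod_cons, ih, List.reverse_cons, gp_append, gp_singleton]; rfl

variable (M) in
/-- The reversal antiautomorphism. -/
def revHom : Artin M →* (Artin M)ᵐᵒᵖ :=
  artinLift M (fun s => MulOpposite.op (gen M s)) (by
    intro s t hst h
    rw [prod_op_gen, prod_op_gen, ← aw_reverse, ← aw_reverse, List.reverse_reverse,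
      List.reverse_reverse, gp_aw M hst h])

/-- The reversal of an element. -/
def rev (g : Artin M) : Artin M := (revHom M g).unop

theorem rev_gp (w : List B) : rev (gp M w) = gp M w.reverse := by
  rw [rev, revHom, artinLift_gp, prod_op_gen]; rfl

theorem rev_mul (a b : Artin M) : rev (a * b) = rev b * rev a := by
  rw [rev, map_mul]; rfl

theorem rev_gen (s : B) : rev (gen M s) = gen M s := by
  rw [← gp_singleton, rev_gp]; rfl

theorem rev_mem {X : Set B} {g : Artin M} (hg : g ∈ posMonOn M X) : rev g ∈ posMonOn M X := by
  obtain ⟨w, hw, rfl⟩ := mem_posMonOn_iff.1 hg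
  rw [rev_gp]
  exact gp_mem_posMonOn fun s hs => hw s (List.mem_reverse.1 hs)

theorem ilen_rev {g : Artin M} (hg : g ∈ posMon M) : ilen (rev g) = ilen g := by
  obtain ⟨w, rfl⟩ := mem_posMon_iff.1 hg
  rw [rev_gp, ilen_gp, ilen_gp, List.length_reverse]

variable [Finite B]

theorem IsDelta.isGenLcm {X : Set B} {Δ : Artin M} (h : IsDelta M X Δ) : IsGenLcm X Δ := by
  obtain ⟨h1, h2, h3⟩ := h
  have hΔ := posMonOn_le X h1
  have hr := posMonOn_le X (rev_mem h1)
  have hdiv : ∀ x ∈ X, rdvd M (gen M x) (rev Δ) := by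
    intro x hx
    obtain ⟨c, hc, rfl⟩ := h2 x hx
    rw [rev_mul, rev_gen]
    exact rdvd_mul_left (posMonOn_le X (rev_mem hc)) _
  obtain ⟨D, hD⟩ := exists_isGenLcm hr X hdiv
  obtain ⟨c, hc, e⟩ := hD.2.2 _ hr hdiv
  have hDX : D ∈ posMonOn M X := (mem_posMonOn_of_mul hc hD.1 (e ▸ rev_mem h1)).2
  obtain ⟨c', hc', e'⟩ := h3 D hDX fun y hy => by
    obtain ⟨x, hx, hxy⟩ := hD.exists_gen_mul hDX hy
    obtain ⟨a, ha, rfl⟩ := hD.2.1 x hx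
    refine ⟨a, (mem_posMonOn_of_mul ha (gen_mem_posMon x) hDX).1, ?_⟩
    rw [← mul_assoc] at hxy
    exact (mul_right_cancel hxy).symm
  have l1 := congrArg ilen e
  have l2 := congrArg ilen e'
  rw [ilen_mul, ilen_rev hΔ] at l1
  rw [ilen_mul] at l2
  have := ilen_nonneg hc
  have := ilen_nonneg (posMonOn_le X hc')
  rw [eq_one_of_ilen (posMonOn_le X hc') (by omega), mul_one] at e'
  rwa [e']

/-- If `d` conjugates the generator `x` to `x'`, divisibility of `H * d` by `x` descends to
divisibility of `H` by `x'`. -/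
theorem rdvd_of_rdvd_mul {d H : Artin M} (hd : d ∈ posMon M) (hH : H ∈ posMon M) {x x' : B}
    (e : d * gen M x = gen M x' * d) (hx : ¬ rdvd M (gen M x) d)
    (h : rdvd M (gen M x) (H * d)) : rdvd M (gen M x') H := by
  obtain ⟨L, h1, h2, ⟨f, hf, rfl⟩, h4⟩ := exists_isLcm (gen_mem_posMon x) hd h
    (rdvd_mul_left hH d)
  obtain ⟨a, ha, e1⟩ := h4 _ (mul_mem (gen_mem_posMon x') hd) ⟨d, hd, e⟩
    (rdvd_mul_left (gen_mem_posMon x') d)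
  rw [← mul_assoc] at e1
  have e2 := mul_right_cancel e1
  have l := congrArg ilen e2
  rw [ilen_mul, ilen_gen] at l
  have := ilen_nonneg hf
  have := ilen_nonneg ha
  have hf1 : ilen f ≠ 0 := fun h0 => by
    rw [eq_one_of_ilen hf h0, one_mul] at h2
    exact hx h2
  rw [eq_one_of_ilen ha (by omega), one_mul] at e2
  rw [e2] at h4
  exact (h4 _ (mul_mem hH hd) h (rdvd_mul_left hH d)).of_mul_right

theorem exists_eq_mul_conj {X : Set B} {d : Artin M} (hd : d ∈ posMon M)
    (hconj : ∀ x ∈ X, ∃ x', d * gen M x = gen M x' * d) (hred : rreduced M X d)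
    {v : List B} (hv : ∀ x ∈ v, x ∈ X) {K F : Artin M} (hK : K ∈ posMon M) (hF : F ∈ posMon M)
    (e : K * d = F * gp M v) : ∃ K' ∈ posMon M, K = K' * (d * gp M v * d⁻¹) := by
  induction v using List.reverseRecOn generalizing K with
  | nil => exact ⟨K, hK, by simp⟩
  | append_singleton v x ih =>
    have hx := hv x (by simp)
    obtain ⟨x', hx'⟩ := hconj x hx
    rw [gp_append, gp_singleton, ← mul_assoc] at e
    obtain ⟨K₁, hK₁, rfl⟩ := rdvd_of_rdvd_mul hd hK hx' (hred x hx)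
      ⟨_, mul_mem hF (gp_mem_posMon v), e.symm⟩
    rw [mul_assoc, ← hx', ← mul_assoc] at e
    obtain ⟨K', hK', rfl⟩ := ih (fun y hy => hv y (by simp [hy])) hK₁ (mul_right_cancel e)
    refine ⟨K', hK', ?_⟩
    rw [gp_append, gp_singleton, eq_mul_inv_of_mul_eq hx'.symm]
    group

omit [Finite B] in
theorem conj_mem_posMonOn {X X' : Set B} {d : Artin M}
    (h : ∀ x ∈ X, ∃ z ∈ X', d * gen M x = gen M z * d) {c : Artin M} (hc : c ∈ posMonOn M X) :
    d * c * d⁻¹ ∈ posMonOn M X' := by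
  obtain ⟨w, hw, rfl⟩ := mem_posMonOn_iff.1 hc
  clear hc
  induction w with
  | nil => simp
  | cons x w ih =>
    obtain ⟨z, hz, e⟩ := h x (hw x (by simp))
    have : d * gp M (x :: w) * d⁻¹ = gen M z * (d * gp M w * d⁻¹) := by
      rw [gp_cons, ← mul_assoc, e]; group
    rw [this]
    exact mul_mem (Submonoid.subset_closure ⟨z, hz, rfl⟩) (ih fun y hy => hw y (by simp [hy]))

theorem exists_gen_mul_of_conj {g : Artin M} (hg : g ∈ posMon M) {X Y : Set B} {Δ : Artin M}
    (hΔ : IsGenLcm X Δ) (hΔX : Δ ∈ posMonOn M X) (hred : rreduced M X g) {k : ℕ} (hk : 1 ≤ k)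
    (h : g * Δ ^ k * g⁻¹ ∈ posMonOn M Y) {x : B} (hx : x ∈ X) :
    ∃ r ∈ Y, g * gen M x = gen M r * g := by
  obtain ⟨n, hn⟩ : ∃ n : ℕ, ilen g < n := ⟨(ilen g).toNat + 1, by omega⟩
  induction n generalizing g X Δ x with
  | zero =>
    have := ilen_nonneg hg
    omega
  | succ n ih =>
  obtain ⟨k, rfl⟩ : ∃ l, k = l + 1 := ⟨k - 1, by omega⟩
  rcases eq_one_or_exists_mul_gen hg with rfl | ⟨g₀, hg₀, t, rfl⟩
  · rw [one_mul, inv_one, mul_one, pow_succ] at h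
    have h1 := (mem_posMonOn_of_mul (pow_mem hΔ.1 k) hΔ.1 h).2
    obtain ⟨c, hc, rfl⟩ := hΔ.2.1 x hx
    exact ⟨x, mem_of_gen_mem (mem_posMonOn_of_mul hc (gen_mem_posMon x) h1).2, by
      rw [one_mul, mul_one]⟩
  generalize hgg : g₀ * gen M t = g at *
  have htX : t ∉ X := fun ht => hred t ht ⟨g₀, hg₀, hgg⟩
  have hΔk := pow_mem hΔ.1 k
  have hG : g * Δ ^ k * Δ ∈ posMon M := mul_mem (mul_mem hg hΔk) hΔ.1
  have hGt : rdvd M (gen M t) (g * Δ ^ k * Δ) := by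
    refine ⟨g * Δ ^ (k + 1) * g⁻¹ * g₀, mul_mem (posMonOn_le Y h) hg₀, ?_⟩
    rw [mul_assoc _ g₀, hgg, pow_succ]; group
  obtain ⟨D, hD⟩ := exists_isGenLcm hG (insert t X) (by
    rintro z (rfl | hz)
    · exact hGt
    · exact (hΔ.2.1 z hz).trans (rdvd_mul_left (mul_mem hg hΔk) _))
  obtain ⟨c, hc, e⟩ := hD.2.2 _ hG (by
    rintro z (rfl | hz)
    · exact hGt
    · exact (hΔ.2.1 z hz).trans (rdvd_mul_left (mul_mem hg hΔk) _))
  obtain ⟨d, hd, rfl⟩ := hΔ.2.2 D hD.1 fun z hz => hD.2.1 z (Set.mem_insert_of_mem t hz)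
  have ecd : g * Δ ^ k = c * d := by
    rw [← mul_assoc] at e
    exact (mul_right_cancel e).symm
  have hconj : ∀ x ∈ X, ∃ x', d * gen M x = gen M x' * d := by
    intro y hy
    obtain ⟨x, hx, hxy⟩ := hΔ.exists_gen_mul hΔX hy
    obtain ⟨x', hx'⟩ := hD.exists_mul_gen (Set.mem_insert_of_mem t hx)
    rw [mul_assoc, hxy, ← mul_assoc, ← mul_assoc] at hx'
    exact ⟨x', mul_right_cancel hx'⟩
  have hdred : rreduced M X d := by
    rintro y hy ⟨d₁, hd₁, rfl⟩
    obtain ⟨x, hx, hxy⟩ := hΔ.exists_gen_mul hΔX hy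
    have hE : d₁ * gen M y * Δ = d₁ * Δ * gen M x := by rw [mul_assoc, ← hxy, mul_assoc]
    rw [hE] at hD
    have htx : t ≠ x := fun h => htX (h ▸ hx)
    have hEt : rdvd M (gen M t) (d₁ * Δ) := by
      obtain ⟨h0, K, hK, eK⟩ := rdvd_aw hD.1 htx (hD.2.1 t (Set.mem_insert t X))
        (hD.2.1 x (Set.mem_insert_of_mem t hx))
      obtain ⟨m, hm⟩ := two_le_label htx h0
      rw [hm, aw_succ_snoc, gp_append, gp_singleton, ← mul_assoc] at eK
      rw [← mul_right_cancel eK, aw_succ_snoc, gp_append, gp_singleton, ← mul_assoc]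
      exact rdvd_mul_left (mul_mem hK (gp_mem_posMon _)) _
    have := (hD.2.2 (d₁ * Δ) (mul_mem hd₁ hΔ.1) (by
      rintro z (rfl | hz)
      · exact hEt
      · exact (hΔ.2.1 z hz).trans (rdvd_mul_left hd₁ _))).ilen_le
    rw [ilen_mul, ilen_gen] at this
    omega
  obtain ⟨H, hH, rfl⟩ : ∃ H ∈ posMon M, g = H * d := by
    obtain ⟨v, hv, ev⟩ := mem_posMonOn_iff.1 (pow_mem hΔX k)
    obtain ⟨H, hH, eH⟩ := exists_eq_mul_conj hd hconj hdred hv hc hg (by rw [ev, ecd])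
    refine ⟨H, hH, ?_⟩
    rw [eH, ev] at ecd
    refine mul_right_cancel (b := Δ ^ k) (ecd.trans ?_)
    group
  have hd1 : ilen d ≠ 0 := by
    intro h0
    rw [eq_one_of_ilen hd h0, one_mul] at hD
    obtain ⟨a, ha, ea⟩ := hD.2.1 t (Set.mem_insert t X)
    exact htX (mem_of_gen_mem (mem_posMonOn_of_mul ha (gen_mem_posMon t) (ea ▸ hΔX)).2)
  have hd0 := ilen_nonneg hd
  have hconj' : ∀ x ∈ X, ∃ z ∈ {z : B | ∃ x ∈ X, d * gen M x = gen M z * d},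
      d * gen M x = gen M z * d := fun x hx => by
    obtain ⟨z, hz⟩ := hconj x hx
    exact ⟨z, ⟨x, hx, hz⟩, hz⟩
  have hΔ' : IsGenLcm {z : B | ∃ x ∈ X, d * gen M x = gen M z * d} (d * Δ * d⁻¹) := by
    refine ⟨posMonOn_le _ (conj_mem_posMonOn hconj' hΔX), ?_, ?_⟩
    · rintro z ⟨x, hx, hz⟩
      obtain ⟨a, ha, ea⟩ := hΔ.2.1 x hx
      have haX := (mem_posMonOn_of_mul ha (gen_mem_posMon x) (ea ▸ hΔX)).1
      refine ⟨_, posMonOn_le _ (conj_mem_posMonOn hconj' haX), ?_⟩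
      rw [← ea, eq_mul_inv_of_mul_eq hz.symm]; group
    · intro E hE hEz
      have hEd : ∀ x ∈ X, rdvd M (gen M x) (E * d) := by
        intro x hx
        obtain ⟨z, hz, ez⟩ := hconj' x hx
        obtain ⟨a, ha, rfl⟩ := hEz z hz
        rw [mul_assoc, ← ez, ← mul_assoc]
        exact rdvd_mul_left (mul_mem ha hd) _
      obtain ⟨F, hF, eF⟩ := hΔ.2.2 _ (mul_mem hE hd) hEd
      obtain ⟨v, hv, rfl⟩ := mem_posMonOn_iff.1 hΔX
      obtain ⟨K, hK, rfl⟩ := exists_eq_mul_conj hd hconj hdred hv hE hF eF.symm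
      exact rdvd_mul_left hK _
  have hred' : rreduced M {z : B | ∃ x ∈ X, d * gen M x = gen M z * d} H := by
    rintro z ⟨y, hy, ez⟩ ⟨a, ha, rfl⟩
    refine hred y hy ⟨a * d, mul_mem ha hd, ?_⟩
    rw [mul_assoc, ez, mul_assoc]
  have hY : H * (d * Δ * d⁻¹) ^ (k + 1) * H⁻¹ ∈ posMonOn M Y := by
    rw [conj_pow]
    convert h using 1
    group
  obtain ⟨z, hz, ez⟩ := hconj' x hx
  rw [ilen_mul] at hn
  obtain ⟨r, hr, er⟩ := ih hH hΔ' (conj_mem_posMonOn hconj' hΔX) hred' hY hz (by omega)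
  exact ⟨r, hr, by rw [mul_assoc, ez, ← mul_assoc, er, mul_assoc]⟩

end ArtinTitsPaper

namespace ArtinTitsPaper
open List
variable {B : Type*}

/-- **Lemma (Godelle).** If `X, Y ⊆ S` are of spherical type and `g ∈ A_S⁺` is reduced-`X`
with `gΔ_X^kg⁻¹ ∈ A_Y⁺` for some `k ≥ 1`, then `g ∈ Conj⁺(S;X,R)` for some `R ⊆ Y`. -/
theorem reduced_conj_delta_in_posMonOn
    [Finite B] (M : CoxeterMatrix B) (X Y : Set B)
    (hX : IsSpherical M X) (hY : IsSpherical M Y)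
    (g : Artin M) (hg : g ∈ posMon M) (hred : rreduced M X g)
    (Δ : Artin M) (hΔ : IsDelta M X Δ)
    (k : ℕ) (hk : 1 ≤ k) (h : g * Δ ^ k * g⁻¹ ∈ posMonOn M Y) :
    ∃ R ⊆ Y, g ∈ conjPos M X R := by
  refine ⟨{r ∈ Y | ∃ x ∈ X, g * gen M x = gen M r * g}, fun r hr => hr.1, hg, ?_⟩
  ext a
  constructor
  · rintro ⟨x, hx, rfl⟩
    obtain ⟨r, hr, e⟩ := exists_gen_mul_of_conj hg hΔ.isGenLcm hΔ.1 hred hk h hx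
    exact ⟨r, ⟨hr, x, hx, e⟩, e.symm⟩
  · rintro ⟨r, ⟨-, x, hx, e⟩, rfl⟩
    exact ⟨x, hx, e⟩

end ArtinTitsPaper
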